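/- Let C be a cylindric ribbon that is a subposet of the cylinder C_{k,n-k}. Then s_C(x) = Σ_{ν ⊆ k×(n-k)} c_ν s_ν(x) + s_{H^{n-k}_k}(x), where each c_ν is a non-negative integer and the sum is over partitions ν fitting in a k×(n-k) box; equivalently, the part of the Schur expansion of s_C involving partitions with more than k rows equals the Schur expansion of the cylindric hook generating function. -/

import Mathlib

open scoped Classical
open Relation

noncomputable section

/-- Formal power series in countably many variables `x_0, x_1, ...` over `ℚ`. -/
abbrev FPS := MvPowerSeries ℕ ℚ

/-- A partition, encoded as a weakly decreasing, eventually-zero function giving part sizes. -/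
def IsPtn (p : ℕ → ℕ) : Prop := Antitone p ∧ ∃ N, p N = 0

/-- The Young diagram (set of cells `(row, column)`, zero-indexed) of `p`. -/
def cells (p : ℕ → ℕ) : Set (ℕ × ℕ) := {c | c.2 < p c.1}

/-- The conjugate partition. -/
def conjPtn (p : ℕ → ℕ) : ℕ → ℕ := fun j => Nat.card {i : ℕ // j < p i}

/-- `p` fits in a `k × w` box: at most `k` parts, each of size at most `w`. -/
def FitsBox (p : ℕ → ℕ) (k w : ℕ) : Prop := p 0 ≤ w ∧ p k = 0

/-- Generating function counting fillings `T` of a set `S` of boxes satisfying a predicate `Ok`,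
weighted by content: the coefficient of `∏ x_v^{e v}` is the number of admissible fillings with
exactly `e v` boxes of `S` labelled `v`. -/
def tabSeries {X : Type} (S : Set X) (Ok : (X → ℕ) → Prop) : FPS :=
  fun e => (Nat.card {T : X → ℕ //
    Ok T ∧ (∀ x, x ∉ S → T x = 0) ∧ ∀ v, Nat.card {x : X // x ∈ S ∧ T x = v} = e v} : ℚ)

/-- Semistandardness for fillings of a set of cells in `ℕ × ℕ`:
weakly increasing along rows, strictly increasing down columns. -/
def RowColOk (S : Set (ℕ × ℕ)) (T : ℕ × ℕ → ℕ) : Prop :=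
  (∀ r c, (r, c) ∈ S → (r, c+1) ∈ S → T (r, c) ≤ T (r, c+1)) ∧
  (∀ r c, (r, c) ∈ S → (r+1, c) ∈ S → T (r, c) < T (r+1, c))

/-- The skew Schur function `s_{lam/mu}` as the generating function of semistandard skew tableaux. -/
def skewSchur (lam mu : ℕ → ℕ) : FPS :=
  tabSeries (cells lam \ cells mu) (RowColOk (cells lam \ cells mu))

/-- The Schur function `s_lam`. -/
def schur (lam : ℕ → ℕ) : FPS := skewSchur lam (fun _ => 0)

/-- A symmetric function is Schur-positive if it is a non-negative linear combination of
Schur functions. -/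
def IsSchurPos (f : FPS) : Prop :=
  ∃ (S : Finset (ℕ → ℕ)) (c : (ℕ → ℕ) → ℚ),
    (∀ p ∈ S, IsPtn p) ∧ (∀ p ∈ S, 0 ≤ c p) ∧ f = ∑ p ∈ S, c p • schur p

/-- The cylinder `C_{vu} = ℤ² / (-u,v)ℤ`. -/
abbrev Cyl (u v : ℕ) := (ℤ × ℤ) ⧸ AddSubgroup.zmultiples ((-(u : ℤ), (v : ℤ)) : ℤ × ℤ)

/-- The quotient map onto the cylinder. -/
def cmk (u v : ℕ) (a : ℤ × ℤ) : Cyl u v := QuotientAddGroup.mk a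

/-- `y` is the right neighbour of `x` in its row (a weak edge of the cylindric poset). -/
def rowAdj (u v : ℕ) (x y : Cyl u v) : Prop :=
  ∃ a : ℤ × ℤ, x = cmk u v a ∧ y = cmk u v (a.1 + 1, a.2)

/-- `y` is the next element above `x` in its column (a strict edge of the cylindric poset). -/
def colAdj (u v : ℕ) (x y : Cyl u v) : Prop :=
  ∃ a : ℤ × ℤ, x = cmk u v a ∧ y = cmk u v (a.1, a.2 + 1)

/-- The partial order on the cylinder generated by the row and column steps. -/
def cle (u v : ℕ) (x y : Cyl u v) : Prop :=
  ∃ a b : ℤ × ℤ, x = cmk u v a ∧ y = cmk u v b ∧ a.1 ≤ b.1 ∧ a.2 ≤ b.2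

/-- A cylindric skew shape: a finite convex subposet of the cylinder. -/
def IsCylShape (u v : ℕ) (C : Set (Cyl u v)) : Prop :=
  C.Finite ∧ ∀ x y z, cle u v x y → cle u v y z → x ∈ C → z ∈ C → y ∈ C

/-- Semistandardness for cylindric tableaux: weakly increasing along rows,
strictly increasing along columns. -/
def CylOk (u v : ℕ) (C : Set (Cyl u v)) (T : Cyl u v → ℕ) : Prop :=
  (∀ x y, x ∈ C → y ∈ C → rowAdj u v x y → T x ≤ T y) ∧
  (∀ x y, x ∈ C → y ∈ C → colAdj u v x y → T x < T y)

/-- The cylindric skew Schur function of a cylindric skew shape `C`. -/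
def cylSchur (u v : ℕ) (C : Set (Cyl u v)) : FPS := tabSeries C (CylOk u v C)

/-- Edgewise adjacency in `ℤ × ℤ`. -/
def adjZ (a b : ℤ × ℤ) : Prop :=
  b = (a.1 + 1, a.2) ∨ a = (b.1 + 1, b.2) ∨ b = (a.1, a.2 + 1) ∨ a = (b.1, b.2 + 1)

/-- The full preimage of `C` in `ℤ × ℤ` under the quotient map. -/
def preimg (u v : ℕ) (C : Set (Cyl u v)) : Set (ℤ × ℤ) := {a | cmk u v a ∈ C}

/-- A cylindric ribbon: a cylindric skew shape which, viewed as a subset of `ℤ²`,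
is edgewise connected and contains no `2 × 2` block of boxes. -/
def IsCylRibbon (u v : ℕ) (C : Set (Cyl u v)) : Prop :=
  IsCylShape u v C ∧ C.Nonempty ∧
  (∀ a b, a ∈ preimg u v C → b ∈ preimg u v C →
    Relation.ReflTransGen (fun p q => q ∈ preimg u v C ∧ adjZ p q) a b) ∧
  ¬ ∃ a : ℤ × ℤ, a ∈ preimg u v C ∧ (a.1 + 1, a.2) ∈ preimg u v C ∧
      (a.1, a.2 + 1) ∈ preimg u v C ∧ (a.1 + 1, a.2 + 1) ∈ preimg u v C

/-- The hook partition `(a, 1^b)`. -/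
def hookFun (a b : ℕ) : ℕ → ℕ := fun i => if i = 0 then a else if i ≤ b then 1 else 0

namespace CR

section LA
variable {n : ℕ} {V : Type} [AddCommGroup V] [Module ℂ V]

/-- vectors lying in all `H i`, `i ∉ B` -/
def VB (H : Fin n → Submodule ℂ V) (B : Finset (Fin n)) : Submodule ℂ V := ⨅ i, ⨅ (_ : i ∉ B), H i

lemma mem_VB (H : Fin n → Submodule ℂ V) (B : Finset (Fin n)) (v : V) :
    v ∈ VB H B ↔ ∀ i, i ∉ B → v ∈ H i := by
  simp [VB, Submodule.mem_iInf]

lemma VB_mono (H : Fin n → Submodule ℂ V) {A B : Finset (Fin n)} (h : A ⊆ B) : VB H A ≤ VB H B := by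
  intro v hv
  rw [mem_VB] at *
  exact fun i hi => hv i (fun h' => hi (h h'))

lemma VB_inf (H : Fin n → Submodule ℂ V) (A B : Finset (Fin n)) : VB H A ⊓ VB H B = VB H (A ∩ B) := by
  ext v
  simp only [Submodule.mem_inf, mem_VB, Finset.mem_inter]
  constructor
  · rintro ⟨h1, h2⟩ i hi
    by_cases h : i ∈ A
    · exact h2 i (fun h' => hi ⟨h, h'⟩)
    · exact h1 i h
  · intro h
    exact ⟨fun i hi => h i (fun h' => hi h'.1), fun i hi => h i (fun h' => hi h'.2)⟩

/-- the partial distributivity property -/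
def DistP (H : Fin n → Submodule ℂ V) : Prop :=
  ∀ (E G : Finset (Fin n)) (g : Fin n), g ∈ E → g ∉ G → G ⊆ E → (∃ x ∈ E, x ≠ g ∧ x ∉ G) →
    (⨆ i ∈ G, VB H (E.erase i)) ⊓ VB H (E.erase g) ≤ ⨆ i ∈ G, VB H ((E.erase g).erase i)

lemma DistP.eq {H : Fin n → Submodule ℂ V} (h : DistP H) (E G : Finset (Fin n)) (g : Fin n)
    (hg : g ∈ E) (hgG : g ∉ G) (hG : G ⊆ E) (hx : ∃ x ∈ E, x ≠ g ∧ x ∉ G) :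
    (⨆ i ∈ G, VB H (E.erase i)) ⊓ VB H (E.erase g) = ⨆ i ∈ G, VB H ((E.erase g).erase i) := by
  apply le_antisymm (h E G g hg hgG hG hx)
  apply iSup₂_le
  intro i hi
  refine le_inf (le_trans ?_ (le_iSup₂ (f := fun i (_ : i ∈ G) => VB H (E.erase i)) i hi)) ?_
  · exact VB_mono H (fun j hj => by simp at hj ⊢; tauto)
  · exact VB_mono H (fun j hj => by simp at hj ⊢; tauto)

/-- alternating sums of dimensions -/
def ee (H : Fin n → Submodule ℂ V) (E G : Finset (Fin n)) : ℤ :=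
  ∑ Y ∈ G.powerset, (-1) ^ Y.card * (Module.finrank ℂ (VB H (E \ Y)) : ℤ)

lemma ee_insert (H : Fin n → Submodule ℂ V) (E G : Finset (Fin n)) (g : Fin n) (hg : g ∉ G) :
    ee H E (insert g G) = ee H E G - ee H (E.erase g) G := by
  unfold ee
  rw [Finset.sum_powerset_insert hg, sub_eq_add_neg, ← Finset.sum_neg_distrib]
  congr 1
  apply Finset.sum_congr rfl
  intro Y hY
  have : g ∉ Y := fun h => hg (Finset.mem_powerset.1 hY h)
  rw [Finset.card_insert_of_notMem this]
  have : E \ insert g Y = E.erase g \ Y := by ext j; simp; tauto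
  rw [this]; ring

variable [FiniteDimensional ℂ V]

lemma ee_eq {H : Fin n → Submodule ℂ V} (h : DistP H) (G : Finset (Fin n)) :
    ∀ E : Finset (Fin n), G ⊆ E → (∃ x ∈ E, x ∉ G) →
    ee H E G = (Module.finrank ℂ (VB H E) : ℤ) -
      Module.finrank ℂ (⨆ i ∈ G, VB H (E.erase i) : Submodule ℂ V) := by
  induction G using Finset.induction_on with
  | empty =>
    intro E _ _
    have h2 : (⨆ i ∈ (∅ : Finset (Fin n)), VB H (E.erase i) : Submodule ℂ V) = ⊥ := by simp
    rw [h2, finrank_bot]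
    unfold ee
    rw [Finset.powerset_empty, Finset.sum_singleton, Finset.sdiff_empty]
    simp
  | insert g G hg ih =>
    intro E hE hx
    obtain ⟨x, hxE, hx⟩ := hx
    have hx1 : x ≠ g := by rintro rfl; simp at hx
    have hx2 : x ∉ G := fun h => hx (by simp [h])
    have hgE : g ∈ E := hE (by simp)
    have hGE : G ⊆ E := fun j hj => hE (by simp [hj])
    rw [ee_insert _ _ _ _ hg, ih E hGE ⟨x, hxE, hx2⟩, ih (E.erase g) ?_ ⟨x, by simp [hx1, hxE], hx2⟩,
      Finset.iSup_insert, ← h.eq E G g hgE hg hGE ⟨x, hxE, hx1, hx2⟩]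
    · have := Submodule.finrank_sup_add_finrank_inf_eq (⨆ i ∈ G, VB H (E.erase i)) (VB H (E.erase g))
      rw [sup_comm] at this
      zify at this
      linarith
    · intro j hj
      simp; exact ⟨fun h => hg (h ▸ hj), hGE hj⟩

lemma eps_exchange {H : Fin n → Submodule ℂ V} (h : DistP H) (E : Finset (Fin n)) (x y : Fin n)
    (hx : x ∈ E) (hy : y ∈ E) (hxy : x ≠ y) :
    (Module.finrank ℂ (VB H (E.erase x)) : ℤ) -
      Module.finrank ℂ (⨆ i ∈ E.erase x, VB H ((E.erase x).erase i) : Submodule ℂ V)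
      - ee H (E.erase x) (E.erase x) =
    (Module.finrank ℂ (VB H (E.erase y)) : ℤ) -
      Module.finrank ℂ (⨆ i ∈ E.erase y, VB H ((E.erase y).erase i) : Submodule ℂ V)
      - ee H (E.erase y) (E.erase y) := by
  -- common description
  have key : ∀ x y : Fin n, x ∈ E → y ∈ E → x ≠ y → ∀ S X Y : Submodule ℂ V,
     S = (⨆ i ∈ (E.erase x).erase y, VB H (E.erase i)) → X = VB H (E.erase x) → Y = VB H (E.erase y) →
     (Module.finrank ℂ (VB H (E.erase x)) : ℤ) -
      Module.finrank ℂ (⨆ i ∈ E.erase x, VB H ((E.erase x).erase i) : Submodule ℂ V)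
      - ee H (E.erase x) (E.erase x) =
      ((Module.finrank ℂ X : ℤ) + Module.finrank ℂ Y + Module.finrank ℂ S
        - Module.finrank ℂ (S ⊓ X : Submodule ℂ V) - Module.finrank ℂ (S ⊓ Y : Submodule ℂ V)
        - Module.finrank ℂ (X ⊓ Y : Submodule ℂ V) + Module.finrank ℂ (S ⊓ X ⊓ Y : Submodule ℂ V)
        - Module.finrank ℂ (VB H E) + ee H E E) := by
    intro x y hx hy hxy
    intro S X Y hS hX hY
    have e1 : ee H E E = ee H E (E.erase x) - ee H (E.erase x) (E.erase x) := by
      rw [← ee_insert _ _ _ _ (by simp), Finset.insert_erase hx]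
    rw [ee_eq h (E.erase x) E (Finset.erase_subset _ _) ⟨x, hx, by simp⟩] at e1
    have hyx : y ∈ E.erase x := by simp [hy, hxy.symm]
    have e2 : (⨆ i ∈ E.erase x, VB H (E.erase i) : Submodule ℂ V) = Y ⊔ S := by
      rw [hY, hS]
      conv_lhs => rw [← Finset.insert_erase hyx]
      rw [Finset.iSup_insert]
    have e3 : (⨆ i ∈ E.erase x, VB H ((E.erase x).erase i) : Submodule ℂ V) = (X ⊓ Y) ⊔ (S ⊓ X) := by
      rw [hX, hY, hS]
      conv_lhs => rw [← Finset.insert_erase hyx]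
      rw [Finset.iSup_insert]
      congr 1
      · rw [VB_inf, Finset.insert_erase hyx]; congr 1; ext j; simp; tauto
      · rw [Finset.insert_erase hyx, ← h.eq E _ x hx (by simp) (fun j hj => by
          simp only [Finset.mem_erase] at hj; exact hj.2.2)]
        exact ⟨y, hy, hxy.symm, by simp⟩
    rw [e2] at e1
    rw [e3, ← hX]
    have f1 := Submodule.finrank_sup_add_finrank_inf_eq Y S
    have f2 := Submodule.finrank_sup_add_finrank_inf_eq (X ⊓ Y) (S ⊓ X)
    have f3 : (X ⊓ Y) ⊓ (S ⊓ X) = S ⊓ X ⊓ Y := by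
      ext v; simp; tauto
    rw [f3] at f2
    rw [inf_comm Y S] at f1
    zify at f1 f2
    linarith
  have hE : (E.erase x).erase y = (E.erase y).erase x := by ext j; simp; tauto
  rw [key x y hx hy hxy _ _ _ rfl rfl rfl, key y x hy hx hxy.symm _ _ _ (by rw [← hE]) rfl rfl]
  rw [inf_right_comm (⨆ i ∈ (E.erase x).erase y, VB H (E.erase i)) (VB H (E.erase x)) (VB H (E.erase y)),
    inf_comm (VB H (E.erase x)) (VB H (E.erase y))]
  ring

/-- initial interval -/
def Iv (n k : ℕ) : Finset (Fin n) := Finset.univ.filter (fun i => i.val < k)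

lemma card_Iv {n k : ℕ} (h : k ≤ n) : (Iv n k).card = k := by
  unfold Iv
  rw [← Finset.card_map Fin.valEmbedding]
  conv_rhs => rw [← Finset.card_range k]
  congr 1
  ext j; simp
  constructor
  · rintro ⟨i, hi, rfl⟩; exact hi
  · intro hj; exact ⟨⟨j, by omega⟩, hj, rfl⟩

lemma VB_le_iSup {H : Fin n → Submodule ℂ V} (h : DistP H) (a : ℕ)
    (h1 : (⨆ i ∈ Iv n a, H i) = ⊤) (x : Fin n) (hx : x ∉ Iv n a) :
    ∀ (F E : Finset (Fin n)), E = Fᶜ → Iv n a ⊆ E → x ∈ E → VB H E ≤ ⨆ i ∈ Iv n a, VB H (E.erase i) := by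
  intro F
  induction F using Finset.induction_on with
  | empty =>
    rintro E rfl _ _
    intro v _
    have : (⨆ i ∈ Iv n a, VB H ((∅ᶜ : Finset (Fin n)).erase i)) = ⨆ i ∈ Iv n a, H i := by
      congr 1; ext i : 1; congr 1; ext _ v; simp [mem_VB]
    rw [this, h1]; trivial
  | insert g F hg ih =>
    rintro E rfl hE hxE
    have hgE : (insert g F)ᶜ = (Fᶜ).erase g := by ext j; simp
    rw [hgE] at hE hxE ⊢
    have h2 := ih Fᶜ rfl (fun j hj => Finset.mem_of_mem_erase (hE hj)) (Finset.mem_of_mem_erase hxE)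
    refine le_trans (le_inf ((VB_mono H (Finset.erase_subset _ _)).trans h2) le_rfl) ?_
    apply h Fᶜ (Iv n a) g (by simpa using hg) (fun h' => by simpa using hE h')
      (fun j hj => Finset.mem_of_mem_erase (hE hj))
    exact ⟨x, Finset.mem_of_mem_erase hxE, by rintro rfl; simp at hxE, hx⟩

lemma ee_union_split (H : Fin n → Submodule ℂ V) (G : Finset (Fin n)) (Z : Finset (Fin n)) :
    ∀ E : Finset (Fin n), Disjoint Z G →
    (∀ Y ⊆ Z, ee H (E \ Y) G = 0) → ee H E (Z ∪ G) = 0 := by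
  induction Z using Finset.induction_on with
  | empty => intro E _ h; simpa using h ∅ (by simp)
  | insert g Z hg ih =>
    intro E hd h
    rw [Finset.disjoint_insert_left] at hd
    rw [Finset.insert_union, ee_insert _ _ _ _ (by simp [hg, hd.1]), ih E hd.2, ih _ hd.2, sub_zero]
    · intro Y hY
      have : E.erase g \ Y = E \ insert g Y := by ext j; simp; tauto
      rw [this]; exact h _ (Finset.insert_subset_insert _ hY)
    · intro Y hY
      exact h Y (hY.trans (Finset.subset_insert _ _))

lemma ee_zero_of_bot (H : Fin n → Submodule ℂ V) (D G : Finset (Fin n)) (h : VB H D = ⊥) :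
    ee H D G = 0 := by
  apply Finset.sum_eq_zero
  intro Y _
  have : VB H (D \ Y) = ⊥ := by
    rw [eq_bot_iff, ← h]; exact VB_mono H Finset.sdiff_subset
  rw [this]; simp

lemma interval_zero {H : Fin n → Submodule ℂ V} (h : DistP H) (a b : ℕ) (hab : a + b ≤ n)
    (h1 : (⨆ i ∈ Iv n a, H i) = ⊤) (h2 : VB H (Iv n (n - b)) = ⊥) (k : ℕ) (hk : k < n) :
    ee H (Iv n k) (Iv n k) = 0 ∧
    (Module.finrank ℂ (VB H (Iv n k)) : ℤ) -
      Module.finrank ℂ (⨆ i ∈ Iv n k, VB H ((Iv n k).erase i) : Submodule ℂ V) = 0 := by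
  have sub : ∀ {s t : ℕ}, s ≤ t → Iv n s ⊆ Iv n t := by
    intro s t hst i hi; simp [Iv] at hi ⊢; omega
  by_cases hkb : k ≤ n - b
  · have hb : VB H (Iv n k) = ⊥ := by rw [eq_bot_iff, ← h2]; exact VB_mono H (sub hkb)
    refine ⟨ee_zero_of_bot H _ _ hb, ?_⟩
    have : (⨆ i ∈ Iv n k, VB H ((Iv n k).erase i) : Submodule ℂ V) = ⊥ := by
      rw [eq_bot_iff, ← hb]
      exact iSup₂_le (fun i _ => VB_mono H (Finset.erase_subset _ _))
    rw [hb, this]; simp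
  · have hak : a < k := by omega
    constructor
    · have hun : Iv n k = (Iv n k \ Iv n a) ∪ Iv n a := by
        rw [Finset.sdiff_union_of_subset (sub hak.le)]
      have := ee_union_split H (Iv n a) (Iv n k \ Iv n a) (Iv n k) Finset.sdiff_disjoint ?_
      · rwa [← hun] at this
      · intro Y hY
        have hsub : Iv n a ⊆ Iv n k \ Y := by
          intro j hj; simp only [Finset.mem_sdiff]
          exact ⟨sub hak.le hj, fun h' => (Finset.mem_sdiff.1 (hY h')).2 hj⟩
        by_cases hx : ∃ x ∈ Iv n k \ Y, x ∉ Iv n a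
        · rw [ee_eq h _ _ hsub hx]
          obtain ⟨x, hx, hxa⟩ := hx
          have := VB_le_iSup h a h1 x hxa (Iv n k \ Y)ᶜ (Iv n k \ Y) (by simp) hsub hx
          have h3 : (⨆ i ∈ Iv n a, VB H ((Iv n k \ Y).erase i)) = VB H (Iv n k \ Y) :=
            le_antisymm (iSup₂_le (fun i _ => VB_mono H (Finset.erase_subset _ _))) this
          rw [h3, sub_self]
        · push Not at hx
          apply ee_zero_of_bot
          rw [eq_bot_iff, ← h2]
          exact VB_mono H (fun j hj => sub (by omega) (hx j hj))
    · have hx : (⟨a, by omega⟩ : Fin n) ∉ Iv n a := by simp [Iv]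
      have := VB_le_iSup h a h1 ⟨a, by omega⟩ hx (Iv n k)ᶜ (Iv n k) (by simp) (sub hak.le)
        (by simp [Iv, hak])
      have h3 : (⨆ i ∈ Iv n k, VB H ((Iv n k).erase i)) = VB H (Iv n k) :=
        le_antisymm (iSup₂_le (fun i _ => VB_mono H (Finset.erase_subset _ _)))
          (this.trans (biSup_mono (fun i hi => sub hak.le hi)))
      rw [h3, sub_self]

theorem LA_main {H : Fin n → Submodule ℂ V} (h : DistP H) (a b : ℕ) (hab : a + b ≤ n)
    (h1 : (⨆ i ∈ Iv n a, H i) = ⊤) (h2 : VB H (Iv n (n - b)) = ⊥) (k : ℕ) (hk : k < n) :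
    ∀ (m : ℕ) (D : Finset (Fin n)), D.card = k → (D \ Iv n k).card = m →
    ee H D D = (Module.finrank ℂ (VB H D) : ℤ) -
      Module.finrank ℂ (⨆ i ∈ D, VB H (D.erase i) : Submodule ℂ V) := by
  intro m
  induction m with
  | zero =>
    intro D hD hm
    have : D ⊆ Iv n k := by
      rw [← Finset.sdiff_eq_empty_iff_subset]; exact Finset.card_eq_zero.1 hm
    have := Finset.eq_of_subset_of_card_le this (by rw [card_Iv hk.le, hD])
    subst this
    obtain ⟨h3, h4⟩ := interval_zero h a b hab h1 h2 k hk
    rw [h3, h4]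
  | succ m ih =>
    intro D hD hm
    obtain ⟨y, hy⟩ : (D \ Iv n k).Nonempty := by rw [← Finset.card_pos]; omega
    have hy' := Finset.mem_sdiff.1 hy
    obtain ⟨x, hx⟩ : (Iv n k \ D).Nonempty := by
      rw [← Finset.card_pos, Finset.card_sdiff_comm (by rw [card_Iv hk.le, hD])]; omega
    have hx' := Finset.mem_sdiff.1 hx
    have hxy : x ≠ y := by rintro rfl; exact hx'.2 hy'.1
    have e := eps_exchange h (insert x D) x y (by simp) (by simp [hy'.1]) hxy
    have hE : (insert x D).erase x = D := Finset.erase_insert hx'.2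
    have := ih ((insert x D).erase y) (by
        rw [Finset.card_erase_of_mem (by simp [hy'.1]), Finset.card_insert_of_notMem hx'.2, hD]; rfl) (by
        have : (insert x D).erase y \ Iv n k = (D \ Iv n k).erase y := by
          ext j; simp only [Finset.mem_sdiff, Finset.mem_erase, Finset.mem_insert]
          constructor
          · rintro ⟨⟨h1, rfl | h2⟩, h3⟩
            · exact absurd hx'.1 h3
            · exact ⟨h1, h2, h3⟩
          · rintro ⟨h1, h2, h3⟩; exact ⟨⟨h1, Or.inr h2⟩, h3⟩
        rw [this, Finset.card_erase_of_mem hy, hm]; rfl)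
    rw [hE] at e
    linarith

theorem LA_nonneg {H : Fin n → Submodule ℂ V} (h : DistP H) (a b : ℕ) (hab : a + b ≤ n)
    (h1 : (⨆ i ∈ Iv n a, H i) = ⊤) (h2 : VB H (Iv n (n - b)) = ⊥) 
    (D : Finset (Fin n)) (hk : D.card < n) : 0 ≤ ee H D D := by
  rw [LA_main h a b hab h1 h2 _ hk _ D rfl rfl]
  have : (⨆ i ∈ D, VB H (D.erase i) : Submodule ℂ V) ≤ VB H D :=
    iSup₂_le (fun i _ => VB_mono H (Finset.erase_subset _ _))
  have := Submodule.finrank_mono this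
  omega

end LA
end CR

namespace CR

section KKsec

/-- size -/
def sz (S : ℕ) (p : ℕ → ℕ) : ℕ := ∑ i ∈ Finset.range S, p i

/-- horizontal strip -/
def hs (l m : ℕ → ℕ) : Prop := ∀ i, m i ≤ l i ∧ l (i + 1) ≤ m i

lemma PP_finite (S : ℕ) : {p : ℕ → ℕ | Antitone p ∧ p S = 0 ∧ sz S p ≤ S}.Finite := by
  apply (Set.finite_range (fun (g : Fin S → Fin (S + 1)) (i : ℕ) =>
    if h : i < S then (g ⟨i, h⟩ : ℕ) else 0)).subset
  rintro p ⟨h1, h2, h3⟩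
  have hb : ∀ i, i < S → p i < S + 1 := by
    intro i hi
    have : p i ≤ sz S p := Finset.single_le_sum (f := p) (fun _ _ => Nat.zero_le _) (Finset.mem_range.2 hi)
    omega
  refine ⟨fun i => ⟨p i, hb i i.2⟩, ?_⟩
  funext i
  by_cases hi : i < S
  · simp [hi]
  · simp only [hi, dif_neg, not_false_eq_true]
    have := h1 (not_lt.1 hi)
    omega

/-- partitions of size at most `S` -/
def PP (S : ℕ) : Finset (ℕ → ℕ) := (PP_finite S).toFinset

lemma mem_PP {S : ℕ} {p : ℕ → ℕ} : p ∈ PP S ↔ Antitone p ∧ p S = 0 ∧ sz S p ≤ S := by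
  simp [PP]

lemma PP_zero {S : ℕ} {p : ℕ → ℕ} (h : p ∈ PP S) {i : ℕ} (hi : S ≤ i) : p i = 0 := by
  rw [mem_PP] at h
  have := h.1 hi
  omega

lemma mem_PP_of {S : ℕ} {p : ℕ → ℕ} (h1 : Antitone p) (h2 : p (S + 1) = 0) (h3 : sz (S + 1) p ≤ S) :
    p ∈ PP S := by
  have : p S = 0 := by
    by_contra h
    have : ∀ i ∈ Finset.range (S + 1), 1 ≤ p i := by
      intro i hi
      have := h1 (Nat.lt_succ_iff.1 (Finset.mem_range.1 hi))
      omega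
    have := Finset.card_nsmul_le_sum _ _ _ this
    unfold sz at h3
    simp only [Finset.card_range, smul_eq_mul, mul_one] at this
    exact absurd (this.trans h3) (by omega)
  rw [mem_PP]
  refine ⟨h1, this, ?_⟩
  unfold sz at *
  rw [Finset.sum_range_succ] at h3
  omega

lemma sz_succ {S : ℕ} {p : ℕ → ℕ} (h : p ∈ PP S) : sz (S + 1) p = sz S p := by
  unfold sz
  rw [Finset.sum_range_succ, PP_zero h le_rfl, add_zero]

lemma zero_PP (S : ℕ) : (0 : ℕ → ℕ) ∈ PP S := by
  rw [mem_PP]; exact ⟨fun _ _ _ => le_rfl, rfl, by simp [sz]⟩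

/-- Kostka numbers via chains -/
def KK (S : ℕ) : ℕ → (ℕ → ℕ) → (ℕ → ℕ) → ℕ
  | 0, _, l => if l = 0 then 1 else 0
  | N + 1, e, l => ∑ m ∈ (PP S).filter (fun m => hs l m ∧ sz S l = sz S m + e N), KK S N e m

lemma hs_sz {S : ℕ} {l m : ℕ → ℕ} (h : hs l m) : sz S m ≤ sz S l :=
  Finset.sum_le_sum (fun i _ => (h i).1)

lemma hs_PP {S : ℕ} {l m : ℕ → ℕ} (hl : l ∈ PP S) (h : hs l m) : m ∈ PP S := by
  rw [mem_PP] at *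
  refine ⟨antitone_nat_of_succ_le fun i => ?_, ?_, ?_⟩
  · exact ((h (i+1)).1).trans (h i).2
  · have := (h S).1; omega
  · exact (hs_sz h).trans hl.2.2

lemma hs_eq_of_sz {S : ℕ} {l m : ℕ → ℕ} (hl : l ∈ PP S) (h : hs l m) (hs' : sz S l = sz S m) : l = m := by
  have hm := hs_PP hl h
  funext i
  by_cases hi : i < S
  · exact ((Finset.sum_eq_sum_iff_of_le (fun i _ => (h i).1)).1 hs'.symm i (Finset.mem_range.2 hi)).symm
  · rw [PP_zero hl (not_lt.1 hi), PP_zero hm (not_lt.1 hi)]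

lemma hs_refl {S : ℕ} {l : ℕ → ℕ} (hl : l ∈ PP S) : hs l l := by
  rw [mem_PP] at hl
  exact fun i => ⟨le_rfl, hl.1 (Nat.le_succ i)⟩

/-- auxiliary for the local rule -/
def upf (A : ℕ) (mu nu k : ℕ → ℕ) : ℕ → ℕ
  | 0 => A
  | i + 1 => min (mu i) (nu i) + max (mu (i+1)) (nu (i+1)) - k i

lemma upf_zero (A : ℕ) (mu nu k : ℕ → ℕ) : upf A mu nu k 0 = A := rfl
lemma upf_succ (A : ℕ) (mu nu k : ℕ → ℕ) (i : ℕ) : upf A mu nu k (i+1) =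
  min (mu i) (nu i) + max (mu (i+1)) (nu (i+1)) - k i := rfl

/-- The local rule. -/
lemma local_rule {S : ℕ} {mu nu : ℕ → ℕ} (hmu : mu ∈ PP S) (hnu : nu ∈ PP S) (m : ℕ) (hm : m ≤ S) :
    ((PP S).filter (fun l => hs l mu ∧ hs l nu ∧ sz S l = m)).card =
    ((PP S).filter (fun k => hs mu k ∧ hs nu k ∧ sz S mu + sz S nu ≤ sz S k + m)).card := by
  have key : ∀ x y : ℕ → ℕ, (∀ i, x (i+1) + y i = min (mu i) (nu i) + max (mu (i+1)) (nu (i+1))) →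
      x (S + 1) = 0 → y S = 0 → 
      sz (S + 1) x + sz S y + max (mu 0) (nu 0) = sz S mu + sz S nu + x 0 := by
    intro x y h hx hy
    have e1 : sz (S + 1) x = (∑ i ∈ Finset.range S, x (i + 1)) + x 0 := by
      unfold sz; rw [Finset.sum_range_succ']
    have e2 : (∑ i ∈ Finset.range S, x (i + 1)) + sz S y =
        ∑ i ∈ Finset.range S, (min (mu i) (nu i) + max (mu (i+1)) (nu (i+1))) := by
      unfold sz; rw [← Finset.sum_add_distrib]
      exact Finset.sum_congr rfl (fun i _ => h i)
    have e3 : (∑ i ∈ Finset.range S, max (mu (i+1)) (nu (i+1))) + max (mu 0) (nu 0) =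
       ∑ i ∈ Finset.range S, max (mu i) (nu i) := by
      rw [← Finset.sum_range_succ' (fun i => max (mu i) (nu i)), Finset.sum_range_succ,
        PP_zero hmu le_rfl, PP_zero hnu le_rfl]; simp
    have e4 : sz S mu + sz S nu = ∑ i ∈ Finset.range S, (min (mu i) (nu i) + max (mu i) (nu i)) := by
      unfold sz; rw [← Finset.sum_add_distrib]
      exact Finset.sum_congr rfl (fun i _ => by omega)
    rw [Finset.sum_add_distrib] at e2 e4
    omega
  refine Finset.card_bij' 
    (fun l _ i => min (mu i) (nu i) + max (mu (i+1)) (nu (i+1)) - l (i+1))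
    (fun k _ => upf (max (mu 0) (nu 0) + (sz S k + m - sz S mu - sz S nu)) mu nu k) ?_ ?_ ?_ ?_
  · intro l hl
    simp only [Finset.mem_filter] at hl ⊢
    obtain ⟨hl, h1, h2, h3⟩ := hl
    have hs1 : hs mu (fun i => min (mu i) (nu i) + max (mu (i+1)) (nu (i+1)) - l (i+1)) := by
      intro i
      have a1 := h1 i; have a2 := h2 i; have a3 := h1 (i+1); have a4 := h2 (i+1)
      simp only [upf_zero, upf_succ]
      omega
    have hs2 : hs nu (fun i => min (mu i) (nu i) + max (mu (i+1)) (nu (i+1)) - l (i+1)) := by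
      intro i
      have a1 := h1 i; have a2 := h2 i; have a3 := h1 (i+1); have a4 := h2 (i+1)
      simp only [upf_zero, upf_succ]
      omega
    refine ⟨hs_PP hmu hs1, hs1, hs2, ?_⟩
    have := key l (fun i => min (mu i) (nu i) + max (mu (i+1)) (nu (i+1)) - l (i+1)) (by
      intro i
      have a1 := h1 i; have a2 := h2 i; have a3 := h1 (i+1); have a4 := h2 (i+1)
      skip
      omega) (PP_zero hl (by omega)) (by
      simp [PP_zero hmu le_rfl, PP_zero hnu le_rfl, PP_zero hmu (Nat.le_succ S), PP_zero hnu (Nat.le_succ S)])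
    rw [sz_succ hl] at this
    have a1 := h1 0; have a2 := h2 0
    omega
  · intro k hk
    simp only [Finset.mem_filter] at hk ⊢
    obtain ⟨hk, h1, h2, h3⟩ := hk
    have hh : ∀ mu' : ℕ → ℕ, (mu' = mu ∨ mu' = nu) → hs (upf (max (mu 0) (nu 0) + (sz S k + m - sz S mu - sz S nu)) mu nu k) mu' := by
      intro mu' h' i
      rcases i with _ | i
      · have a1 := h1 0; have a2 := h2 0
        simp only [upf_zero, upf_succ]
        rcases h' with rfl | rfl <;> omega
      · have a1 := h1 i; have a2 := h2 i; have a3 := h1 (i+1); have a4 := h2 (i+1)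
        simp only [upf_zero, upf_succ]
        rcases h' with rfl | rfl <;> omega
    have hx : (upf (max (mu 0) (nu 0) + (sz S k + m - sz S mu - sz S nu)) mu nu k) (S+1) = 0 := by
      simp [upf_succ, PP_zero hmu le_rfl, PP_zero hnu le_rfl, PP_zero hmu (Nat.le_succ S), PP_zero hnu (Nat.le_succ S)]
    have := key (upf (max (mu 0) (nu 0) + (sz S k + m - sz S mu - sz S nu)) mu nu k) k (by
      intro i
      have a1 := h1 i; have a2 := h2 i
      simp only [upf_zero, upf_succ]
      omega) hx (PP_zero hk le_rfl)
    rw [upf_zero] at this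
    have hpp : (upf (max (mu 0) (nu 0) + (sz S k + m - sz S mu - sz S nu)) mu nu k) ∈ PP S := by
      apply mem_PP_of _ hx (by omega)
      apply antitone_nat_of_succ_le
      intro i
      exact ((hh mu (Or.inl rfl) i).2).trans (hh mu (Or.inl rfl) i).1
    refine ⟨hpp, hh mu (Or.inl rfl), hh nu (Or.inr rfl), ?_⟩
    rw [sz_succ hpp] at this
    omega
  · intro l hl
    simp only [Finset.mem_filter] at hl
    obtain ⟨hl, h1, h2, h3⟩ := hl
    funext i
    rcases i with _ | i
    · have := key l (fun i => min (mu i) (nu i) + max (mu (i+1)) (nu (i+1)) - l (i+1)) (by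
        intro i
        have a1 := h1 i; have a2 := h2 i; have a3 := h1 (i+1); have a4 := h2 (i+1)
        skip
        omega) (PP_zero hl (by omega)) (by
        simp [PP_zero hmu le_rfl, PP_zero hnu le_rfl, PP_zero hmu (Nat.le_succ S), PP_zero hnu (Nat.le_succ S)])
      rw [sz_succ hl] at this
      have a1 := h1 0; have a2 := h2 0
      simp only [upf_zero, upf_succ]
      omega
    · have a1 := h1 i; have a2 := h2 i; have a3 := h1 (i+1); have a4 := h2 (i+1)
      simp only [upf_zero, upf_succ]
      omega
  · intro k hk
    simp only [Finset.mem_filter] at hk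
    obtain ⟨hk, h1, h2, h3⟩ := hk
    funext i
    have a1 := h1 i; have a2 := h2 i
    simp only [upf_zero, upf_succ]
    omega

end KKsec
end CR

namespace CR

section Gram

lemma KK_congr (S : ℕ) : ∀ (N : ℕ) (e e' : ℕ → ℕ), (∀ i < N, e i = e' i) → ∀ l, KK S N e l = KK S N e' l := by
  intro N
  induction N with
  | zero => intro e e' _ l; rfl
  | succ N ih =>
    intro e e' h l
    simp only [KK]
    rw [h N (by omega)]
    exact Finset.sum_congr rfl (fun m _ => ih e e' (fun i hi => h i (by omega)) m)

lemma KK_sz (S : ℕ) : ∀ (N : ℕ) (e : ℕ → ℕ) (l : ℕ → ℕ), KK S N e l ≠ 0 →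
    sz S l = ∑ i ∈ Finset.range N, e i := by
  intro N
  induction N with
  | zero =>
    intro e l h
    have : l = 0 := by by_contra h'; simp [KK, h'] at h
    subst this; simp [sz]
  | succ N ih =>
    intro e l h
    simp only [KK] at h
    obtain ⟨m, hm, hm'⟩ := Finset.exists_ne_zero_of_sum_ne_zero h
    rw [Finset.mem_filter] at hm
    rw [Finset.sum_range_succ, ← ih e m hm', hm.2.2]

lemma star (S : ℕ) : ∀ (p : ℕ) (f : ℕ → ℕ) (b : ℕ) (mu : ℕ → ℕ), mu ∈ PP S → sz S mu + b ≤ S →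
    ∑ l ∈ (PP S).filter (fun l => hs l mu ∧ sz S l = sz S mu + b), KK S p f l =
    ∑ g ∈ (Finset.piAntidiag (Finset.range p) b).filter (fun g => ∀ i, g i ≤ f i),
      KK S p (f - g) mu := by
  intro p
  induction p with
  | zero =>
    intro f b mu hmu hb
    simp only [Finset.range_zero, KK]
    by_cases hb0 : b = 0
    · subst hb0
      have : (PP S).filter (fun l => hs l mu ∧ sz S l = sz S mu + 0) = {mu} := by
        ext l
        simp only [Finset.mem_filter, Finset.mem_singleton, add_zero]
        constructor
        · rintro ⟨h1, h2, h3⟩; exact hs_eq_of_sz h1 h2 h3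
        · rintro rfl; exact ⟨hmu, hs_refl hmu, rfl⟩
      rw [this]
      have h2 : (Finset.piAntidiag (∅ : Finset ℕ) 0).filter (fun g : ℕ → ℕ => ∀ i, g i ≤ f i) = {0} := by
        ext g; simp
        rintro rfl; simp
      rw [h2, Finset.sum_singleton, Finset.sum_singleton]
    · rw [Finset.piAntidiag_empty_of_ne_zero hb0]
      simp only [Finset.filter_empty, Finset.sum_empty]
      apply Finset.sum_eq_zero
      intro l hl
      rw [Finset.mem_filter] at hl
      rw [if_neg]
      rintro rfl
      have := hl.2.2
      simp [sz] at this
      omega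
  | succ p ih =>
    intro f b mu hmu hb
    simp only [KK]
    have hL : ∑ l ∈ (PP S).filter (fun l => hs l mu ∧ sz S l = sz S mu + b),
          ∑ m ∈ (PP S).filter (fun m => hs l m ∧ sz S l = sz S m + f p), KK S p f m =
        ∑ k ∈ PP S, ∑ m ∈ PP S, if (sz S m + f p = sz S mu + b ∧ hs mu k ∧ hs m k ∧
          sz S mu + sz S m ≤ sz S k + (sz S mu + b)) then KK S p f m else 0 := by
      rw [Finset.sum_comm (s := PP S)]
      simp only [Finset.sum_filter]
      have : ∀ l ∈ PP S, (if hs l mu ∧ sz S l = sz S mu + b then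
          ∑ m ∈ PP S, if hs l m ∧ sz S l = sz S m + f p then KK S p f m else 0 else 0) =
          ∑ m ∈ PP S, if sz S m + f p = sz S mu + b then (if hs l mu ∧ hs l m ∧ sz S l = sz S mu + b then KK S p f m else 0) else 0 := by
        intro l _
        split_ifs with h
        · apply Finset.sum_congr rfl
          intro m _
          by_cases h1 : hs l m <;> by_cases h2 : sz S m + f p = sz S mu + b <;> simp [h1, h2, h.1, h.2, eq_comm]
          intro h3; exact absurd h3.symm h2
        · symm; apply Finset.sum_eq_zero
          intro m _
          split_ifs with h1 h2
          · exact absurd ⟨h2.1, h2.2.2⟩ h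
          · rfl
          · rfl
      rw [Finset.sum_congr rfl this, Finset.sum_comm]
      apply Finset.sum_congr rfl
      intro m hm
      by_cases h2 : sz S m + f p = sz S mu + b
      · simp only [h2, if_true, true_and]
        rw [← Finset.sum_filter, ← Finset.sum_filter, Finset.sum_const, Finset.sum_const,
          local_rule hmu hm _ hb]
      · simp [h2]
    have hR : ∑ g ∈ (Finset.piAntidiag (Finset.range (p+1)) b).filter (fun g => ∀ i, g i ≤ f i),
        ∑ m ∈ (PP S).filter (fun m => hs mu m ∧ sz S mu = sz S m + (f - g) p), KK S p (f - g) m =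
        ∑ k ∈ PP S, ∑ g ∈ (Finset.piAntidiag (Finset.range (p+1)) b).filter (fun g => ∀ i, g i ≤ f i),
          if hs mu k ∧ sz S mu = sz S k + (f - g) p then KK S p (f - g) k else 0 := by
      rw [Finset.sum_comm (s := PP S)]
      apply Finset.sum_congr rfl
      intro g _
      rw [Finset.sum_filter]
    rw [hL, hR]
    apply Finset.sum_congr rfl
    intro k hk
    by_cases hmk : hs mu k
    swap
    · simp [hmk]
    have hle := hs_sz (S := S) hmk
    by_cases hj1 : sz S mu ≤ sz S k + f p ∧ sz S k + f p - sz S mu ≤ b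
    · obtain ⟨hj1, hj2⟩ := hj1
      obtain ⟨j, hj⟩ := Nat.exists_eq_add_of_le hj1
      have hjb : j ≤ b := by omega
      have := ih f (b - j) k hk (by omega)
      rw [← Finset.sum_filter]
      have e1 : (PP S).filter (fun m => sz S m + f p = sz S mu + b ∧ hs mu k ∧ hs m k ∧
          sz S mu + sz S m ≤ sz S k + (sz S mu + b)) =
          (PP S).filter (fun m => hs m k ∧ sz S m = sz S k + (b - j)) := by
        apply Finset.filter_congr
        intro m _
        constructor
        · rintro ⟨h1, h2, h3, h4⟩; exact ⟨h3, by omega⟩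
        · rintro ⟨h1, h2⟩; exact ⟨by omega, hmk, h1, by omega⟩
      rw [e1, this, ← Finset.sum_filter]
      refine Finset.sum_bij' (fun g _ => Function.update g p j) (fun g _ => Function.update g p 0) ?_ ?_ ?_ ?_ ?_
      · intro g hg
        simp only [Finset.mem_filter, Finset.mem_piAntidiag] at hg ⊢
        obtain ⟨⟨h1, h2⟩, h3⟩ := hg
        refine ⟨⟨⟨?_, ?_⟩, ?_⟩, hmk, ?_⟩
        · rw [Finset.sum_range_succ, Function.update_self]
          rw [Finset.sum_congr rfl (g := g), h1]
          · omega
          · intro i hi; rw [Function.update_of_ne]; simp at hi; omega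
        · intro i hi
          by_cases hip : i = p
          · simp [hip]
          · rw [Function.update_of_ne hip] at hi
            have := h2 i hi
            simp at this ⊢; omega
        · intro i
          by_cases hip : i = p
          · subst hip; rw [Function.update_self]; omega
          · rw [Function.update_of_ne hip]; exact h3 i
        · simp only [Pi.sub_apply, Function.update_self]; omega
      · intro g hg
        simp only [Finset.mem_filter, Finset.mem_piAntidiag] at hg ⊢
        obtain ⟨⟨⟨h1, h2⟩, h3⟩, h4, h5⟩ := hg
        have hgp : g p = j := by
          simp only [Pi.sub_apply] at h5; have := h3 p; omega
        refine ⟨⟨?_, ?_⟩, ?_⟩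
        · rw [Finset.sum_range_succ] at h1
          rw [Finset.sum_congr rfl (g := g)]
          · rw [hgp] at h1; exact Nat.eq_sub_of_add_eq h1
          · intro i hi; rw [Function.update_of_ne]; simp at hi; omega
        · intro i hi
          by_cases hip : i = p
          · subst hip; simp at hi
          · rw [Function.update_of_ne hip] at hi
            have := h2 i hi
            simp at this ⊢; omega
        · intro i
          by_cases hip : i = p
          · subst hip; rw [Function.update_self]; omega
          · rw [Function.update_of_ne hip]; exact h3 i
      · intro g hg
        simp only [Finset.mem_filter, Finset.mem_piAntidiag] at hg
        have : g p = 0 := by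
          by_contra h; have := hg.1.2 p h; simp at this
        simp only [Function.update_idem]
        rw [← this, Function.update_eq_self]
      · intro g hg
        simp only [Finset.mem_filter, Finset.mem_piAntidiag] at hg
        obtain ⟨⟨⟨h1, h2⟩, h3⟩, h4, h5⟩ := hg
        have hgp : g p = j := by
          simp only [Pi.sub_apply] at h5; have := h3 p; omega
        simp only [Function.update_idem]
        rw [← hgp, Function.update_eq_self]
      · intro g hg
        apply KK_congr
        intro i hi
        simp only [Pi.sub_apply]
        rw [Function.update_of_ne (by omega)]
    · rw [Finset.sum_eq_zero, Finset.sum_eq_zero]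
      · intro g hg
        simp only [Finset.mem_filter, Finset.mem_piAntidiag] at hg
        obtain ⟨⟨h1, h2⟩, h3⟩ := hg
        rw [if_neg]
        rintro ⟨_, h5⟩
        simp only [Pi.sub_apply] at h5
        have := h3 p
        have : g p ≤ b := by rw [← h1, Finset.sum_range_succ]; omega
        omega
      · intro m hm
        rw [if_neg]
        rintro ⟨h1, h2, h3, h4⟩
        have := hs_sz (S := S) h3
        omega

/-- recursive count of matrices -/
def MM (p : ℕ) : ℕ → (ℕ → ℕ) → (ℕ → ℕ) → ℕ
  | 0, f, _ => if ∀ i < p, f i = 0 then 1 else 0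
  | q + 1, f, e => ∑ g ∈ (Finset.piAntidiag (Finset.range p) (e q)).filter (fun g => ∀ i, g i ≤ f i),
      MM p q (f - g) e

lemma KK_zero (S : ℕ) : ∀ (p : ℕ) (f : ℕ → ℕ), KK S p f 0 = if ∀ i < p, f i = 0 then 1 else 0 := by
  intro p
  induction p with
  | zero => intro f; simp [KK]
  | succ p ih =>
    intro f
    simp only [KK]
    have : ∀ m : ℕ → ℕ, (hs 0 m ∧ sz S 0 = sz S m + f p) ↔ (m = 0 ∧ f p = 0) := by
      intro m
      constructor
      · rintro ⟨h1, h2⟩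
        have : m = 0 := by funext i; have := (h1 i).1; simpa using this
        subst this
        exact ⟨rfl, by omega⟩
      · rintro ⟨rfl, h⟩; exact ⟨fun i => ⟨le_rfl, le_rfl⟩, by omega⟩
    simp only [this]
    by_cases h : f p = 0
    · have : (PP S).filter (fun m => m = 0 ∧ f p = 0) = {0} := by
        ext m; simp only [Finset.mem_filter, Finset.mem_singleton, h, and_true]
        constructor
        · exact fun h => h.2
        · rintro rfl; exact ⟨zero_PP S, rfl⟩
      rw [this, Finset.sum_singleton, ih]
      congr 1
      apply propext
      constructor
      · intro h' i hi
        by_cases hip : i = p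
        · rw [hip, h]
        · exact h' i (by omega)
      · intro h' i hi; exact h' i (by omega)
    · rw [if_neg (fun h' => h (h' p (by omega)))]
      simp [h]

lemma gram (S p : ℕ) : ∀ (q : ℕ) (f e : ℕ → ℕ), ∑ i ∈ Finset.range q, e i ≤ S →
    ∑ l ∈ PP S, KK S p f l * KK S q e l = MM p q f e := by
  intro q
  induction q with
  | zero =>
    intro f e _
    simp only [KK, MM, mul_ite, mul_one, mul_zero]
    rw [Finset.sum_ite_eq' (PP S) 0, if_pos (zero_PP S), KK_zero]
  | succ q ih =>
    intro f e he
    rw [Finset.sum_range_succ] at he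
    simp only [MM]
    rw [Finset.sum_congr rfl (fun g _ => (ih (f - g) e (by omega)).symm), Finset.sum_comm]
    have : ∀ l ∈ PP S, KK S p f l * KK S (q+1) e l = ∑ m ∈ PP S, if hs l m ∧ sz S l = sz S m + e q then
        KK S p f l * KK S q e m else 0 := by
      intro l _
      simp only [KK]
      rw [Finset.mul_sum, Finset.sum_filter]
    rw [Finset.sum_congr rfl this, Finset.sum_comm]
    apply Finset.sum_congr rfl
    intro m hm
    rw [← Finset.sum_filter, ← Finset.sum_mul, ← Finset.sum_mul]
    by_cases h0 : KK S q e m = 0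
    · simp [h0]
    · rw [star S p f (e q) m hm (by rw [KK_sz S q e m h0]; exact he)]

/-- matrices with prescribed margins -/
def MS (p q : ℕ) (f e : ℕ → ℕ) : Set (ℕ → ℕ → ℕ) :=
  {m | (∀ i j, m i j ≠ 0 → i < p ∧ j < q) ∧ (∀ i < p, ∑ j ∈ Finset.range q, m i j = f i) ∧
    ∀ j < q, ∑ i ∈ Finset.range p, m i j = e j}

lemma MS_finite (p q : ℕ) (f e : ℕ → ℕ) : (MS p q f e).Finite := by
  apply (Set.finite_range (fun (g : Fin p → Fin q → Fin ((∑ i ∈ Finset.range p, f i) + 1)) (i j : ℕ) =>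
    if h : i < p ∧ j < q then (g ⟨i, h.1⟩ ⟨j, h.2⟩ : ℕ) else 0)).subset
  rintro m ⟨h1, h2, h3⟩
  have hb : ∀ i < p, ∀ j < q, m i j < (∑ i ∈ Finset.range p, f i) + 1 := by
    intro i hi j hj
    have a1 : m i j ≤ ∑ j ∈ Finset.range q, m i j := 
      Finset.single_le_sum (f := m i) (fun _ _ => Nat.zero_le _) (Finset.mem_range.2 hj)
    have a2 : f i ≤ ∑ i ∈ Finset.range p, f i := 
      Finset.single_le_sum (f := f) (fun _ _ => Nat.zero_le _) (Finset.mem_range.2 hi)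
    rw [h2 i hi] at a1
    omega
  refine ⟨fun i j => ⟨m i j, hb i i.2 j j.2⟩, ?_⟩
  funext i j
  by_cases hij : i < p ∧ j < q
  · simp [hij]
  · simp only [hij, dif_neg, not_false_eq_true]
    by_contra h
    exact hij (h1 i j (Ne.symm h))

lemma MM_eq (p : ℕ) : ∀ (q : ℕ) (f e : ℕ → ℕ), MM p q f e = (MS_finite p q f e).toFinset.card := by
  intro q
  induction q with
  | zero =>
    intro f e
    simp only [MM]
    by_cases h : ∀ i < p, f i = 0
    · rw [if_pos h]; symm
      rw [Finset.card_eq_one]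
      refine ⟨0, ?_⟩
      ext m
      simp only [Set.Finite.mem_toFinset, Finset.mem_singleton, MS, Set.mem_setOf_eq]
      constructor
      · rintro ⟨h1, _, _⟩; funext i j
        by_contra h'; have := h1 i j h'; omega
      · rintro rfl
        exact ⟨by simp, by simpa using fun i hi => (h i hi).symm, by simp⟩
    · rw [if_neg h]; symm
      rw [Finset.card_eq_zero]
      ext m
      simp only [Set.Finite.mem_toFinset, MS, Set.mem_setOf_eq]
      constructor
      · rintro ⟨_, h2, _⟩; exact absurd (fun i hi => by simpa using (h2 i hi).symm) h
      · intro h; simp at h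
  | succ q ih =>
    intro f e
    simp only [MM]
    rw [Finset.card_eq_sum_card_fiberwise (f := fun m i => m i q)
      (t := (Finset.piAntidiag (Finset.range p) (e q)).filter (fun g => ∀ i, g i ≤ f i))]
    · apply Finset.sum_congr rfl
      intro g hg
      simp only [Finset.mem_filter, Finset.mem_piAntidiag] at hg
      obtain ⟨⟨hg1, hg2⟩, hg3⟩ := hg
      rw [ih]
      refine Finset.card_bij' (fun m _ i j => if j = q then g i else m i j)
        (fun m _ i j => if j = q then 0 else m i j) ?_ ?_ ?_ ?_
      · intro m hm
        simp only [Finset.mem_filter, Set.Finite.mem_toFinset, MS, Set.mem_setOf_eq] at hm ⊢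
        obtain ⟨h1, h2, h3⟩ := hm
        refine ⟨⟨?_, ?_, ?_⟩, ?_⟩
        · intro i j h
          by_cases hj : j = q
          · simp only [hj, if_true] at h
            exact ⟨by simpa using hg2 i h, by omega⟩
          · rw [if_neg hj] at h
            have := h1 i j h; omega
        · intro i hi
          rw [Finset.sum_range_succ, if_pos rfl, Finset.sum_congr rfl (g := fun j => m i j), h2 i hi]
          · have := hg3 i; simp only [Pi.sub_apply]; omega
          · intro j hj; rw [if_neg]; simp at hj; omega
        · intro j hj
          by_cases hjq : j = q
          · simp only [hjq, if_true]; exact hg1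
          · simp only [hjq, if_false]; exact h3 j (by omega)
        · funext i; simp
      · intro m hm
        simp only [Finset.mem_filter, Set.Finite.mem_toFinset, MS, Set.mem_setOf_eq] at hm ⊢
        obtain ⟨⟨h1, h2, h3⟩, h4⟩ := hm
        refine ⟨?_, ?_, ?_⟩
        · intro i j h
          by_cases hj : j = q
          · simp [hj] at h
          · rw [if_neg hj] at h
            have := h1 i j h; omega
        · intro i hi
          have := h2 i hi
          rw [Finset.sum_range_succ] at this
          rw [Finset.sum_congr rfl (g := fun j => m i j)]
          · simp only [Pi.sub_apply, ← congrFun h4 i]; omega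
          · intro j hj; rw [if_neg]; simp at hj; omega
        · intro j hj
          rw [← h3 j (by omega)]
          apply Finset.sum_congr rfl
          intro i _; rw [if_neg (by omega)]
      · intro m hm
        simp only [Set.Finite.mem_toFinset, MS, Set.mem_setOf_eq] at hm
        funext i j
        by_cases hj : j = q
        · simp only [hj, if_true]
          by_contra h
          have := hm.1 i q (Ne.symm h); omega
        · simp [hj]
      · intro m hm
        simp only [Finset.mem_filter] at hm
        funext i j
        by_cases hj : j = q
        · simp only [hj, if_true]; exact (congrFun hm.2 i).symm
        · simp [hj]
    · intro m hm
      simp only [Finset.coe_filter, Set.Finite.coe_toFinset, MS, Set.mem_setOf_eq, Finset.mem_piAntidiag] at hm ⊢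
      obtain ⟨h1, h2, h3⟩ := hm
      refine ⟨⟨h3 q (by omega), fun i hi => by simpa using (h1 i q hi).1⟩, ?_⟩
      intro i
      by_cases hi : i < p
      · rw [← h2 i hi, Finset.sum_range_succ]; omega
      · have : m i q = 0 := by
          by_contra h; exact hi (h1 i q h).1
        omega

end Gram
end CR

namespace CR

section KKprops

lemma KK_succ_zero (S N : ℕ) (e l : ℕ → ℕ) (hl : l ∈ PP S) (h : e N = 0) : KK S (N + 1) e l = KK S N e l := by
  simp only [KK]
  have : (PP S).filter (fun m => hs l m ∧ sz S l = sz S m + e N) = {l} := by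
    ext m
    simp only [Finset.mem_filter, Finset.mem_singleton, h, add_zero]
    constructor
    · rintro ⟨_, h2, h3⟩; exact (hs_eq_of_sz hl h2 h3).symm
    · rintro rfl; exact ⟨hl, hs_refl hl, rfl⟩
  rw [this, Finset.sum_singleton]

lemma KK_trail (S N : ℕ) (e l : ℕ → ℕ) (hl : l ∈ PP S) : ∀ M, N ≤ M → (∀ i, N ≤ i → i < M → e i = 0) →
    KK S M e l = KK S N e l := by
  intro M hM
  induction M, hM using Nat.le_induction with
  | base => intro _; rfl
  | succ M hM ih =>
    intro h
    rw [KK_succ_zero S M e l hl (h M hM (by omega)), ih (fun i h1 h2 => h i h1 (by omega))]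

lemma hs_diff {S : ℕ} {l m : ℕ → ℕ} (hl : l ∈ PP S) (h : hs l m) : sz S l ≤ sz S m + l 0 := by
  rw [← sz_succ hl]
  unfold sz
  rw [Finset.sum_range_succ']
  have := Finset.sum_le_sum (fun i (_ : i ∈ Finset.range S) => (h i).2)
  omega

lemma KK_big (S : ℕ) : ∀ (N : ℕ) (e l : ℕ → ℕ), l ∈ PP S → ∀ v < N, l 0 < e v → KK S N e l = 0 := by
  intro N
  induction N with
  | zero => intro e l _ v hv; omega
  | succ N ih =>
    intro e l hl v hv h
    simp only [KK]
    apply Finset.sum_eq_zero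
    intro m hm
    rw [Finset.mem_filter] at hm
    obtain ⟨hm, h1, h2⟩ := hm
    have := hs_diff hl h1
    have := (h1 0).1
    by_cases hvN : v = N
    · subst hvN; omega
    · exact ih e m hm v (by omega) (by omega)

lemma KK_rows (S : ℕ) : ∀ (N : ℕ) (e l : ℕ → ℕ), KK S N e l ≠ 0 → ∀ i, N ≤ i → l i = 0 := by
  intro N
  induction N with
  | zero =>
    intro e l h
    have : l = 0 := by by_contra h'; simp [KK, h'] at h
    subst this; simp
  | succ N ih =>
    intro e l h i hi
    simp only [KK] at h
    obtain ⟨m, hm, hm'⟩ := Finset.exists_ne_zero_of_sum_ne_zero h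
    rw [Finset.mem_filter] at hm
    obtain ⟨hm, h1, h2⟩ := hm
    obtain ⟨i, rfl⟩ : ∃ j, i = j + 1 := ⟨i - 1, by omega⟩
    have := (h1 i).2
    rw [ih e m hm' i (by omega)] at this
    omega

/-- weighted size -/
def psi (S : ℕ) (l : ℕ → ℕ) : ℕ := ∑ i ∈ Finset.range S, i * l i

lemma KK_psi (S : ℕ) : ∀ (N : ℕ) (e l : ℕ → ℕ), l ∈ PP S → KK S N e l ≠ 0 →
    psi S l ≤ ∑ v ∈ Finset.range N, v * e v ∧
    (psi S l = ∑ v ∈ Finset.range N, v * e v → ∀ i < N, l i = e i) := by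
  intro N
  induction N with
  | zero =>
    intro e l hl h
    have : l = 0 := by by_contra h'; simp [KK, h'] at h
    subst this; simp [psi]
  | succ N ih =>
    intro e l hl h
    have hrow := KK_rows S (N+1) e l h
    simp only [KK] at h
    obtain ⟨m, hm, hm'⟩ := Finset.exists_ne_zero_of_sum_ne_zero h
    rw [Finset.mem_filter] at hm
    obtain ⟨hm, h1, h2⟩ := hm
    obtain ⟨i1, i2⟩ := ih e m hm hm'
    have hrow' := KK_rows S N e m hm'
    -- termwise inequality
    have ht : ∀ i ∈ Finset.range S, i * l i + N * m i ≤ i * m i + N * l i := by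
      intro i _
      by_cases hi : i ≤ N
      · obtain ⟨d, hd⟩ := Nat.exists_eq_add_of_le (h1 i).1
        rw [hd]; nlinarith
      · rw [hrow i (by omega), hrow' i (by omega)]
    have hsum := Finset.sum_le_sum ht
    rw [Finset.sum_add_distrib, Finset.sum_add_distrib, ← Finset.mul_sum, ← Finset.mul_sum] at hsum
    change psi S l + N * sz S m ≤ psi S m + N * sz S l at hsum
    rw [h2, mul_add] at hsum
    rw [Finset.sum_range_succ]
    refine ⟨by omega, ?_⟩
    intro heq i hi
    have i3 := i2 (by omega)
    have hteq : ∑ i ∈ Finset.range S, (i * l i + N * m i) = ∑ i ∈ Finset.range S, (i * m i + N * l i) := by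
      apply le_antisymm (Finset.sum_le_sum ht)
      rw [Finset.sum_add_distrib, Finset.sum_add_distrib, ← Finset.mul_sum, ← Finset.mul_sum]
      change psi S m + N * sz S l ≤ psi S l + N * sz S m
      rw [h2, mul_add]; omega
    have hte := (Finset.sum_eq_sum_iff_of_le ht).1 hteq
    have hlt : ∀ i < N, l i = m i := by
      intro i hi
      by_cases hiS : i < S
      · have := hte i (Finset.mem_range.2 hiS)
        obtain ⟨d, hd⟩ := Nat.exists_eq_add_of_le (h1 i).1
        rw [hd] at this ⊢
        have : (N - i) * d = 0 := by
          obtain ⟨t, rfl⟩ := Nat.exists_eq_add_of_lt hi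
          have e1 : i + t + 1 - i = t + 1 := by omega
          rw [e1]; nlinarith
        rcases Nat.mul_eq_zero.1 this with h | h <;> omega
      · rw [PP_zero hl (by omega), PP_zero hm (by omega)]
    by_cases hiN : i = N
    · subst hiN
      by_cases hiS : i < S
      · -- compare sizes
        have e1 : sz S l = ∑ j ∈ Finset.range S, (m j + if j = i then l i else 0) := by
          apply Finset.sum_congr rfl
          intro j _
          by_cases hj : j = i
          · subst hj; simp [hrow' j le_rfl]
          · simp only [hj, if_false, add_zero]
            by_cases hj' : j < i
            · exact hlt j hj'
            · rw [hrow j (by omega), hrow' j (by omega)]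
        rw [Finset.sum_add_distrib, Finset.sum_ite_eq' , if_pos (Finset.mem_range.2 hiS)] at e1
        change _ = sz S m + _ at e1
        omega
      · have : sz S l = sz S m := Finset.sum_congr rfl (fun j hj => hlt j (by
          have := Finset.mem_range.1 hj; omega))
        rw [PP_zero hl (by omega)]; omega
    · rw [hlt i (by omega), i3 i (by omega)]

lemma trunc_PP {S : ℕ} {l : ℕ → ℕ} (hl : l ∈ PP S) (N : ℕ) : (fun i => if i < N then l i else 0) ∈ PP S := by
  rw [mem_PP] at *
  refine ⟨?_, ?_, ?_⟩
  · intro i j hij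
    dsimp only
    split_ifs with h1 h2
    · exact hl.1 hij
    · omega
    · omega
    · exact le_rfl
  · split_ifs
    · exact hl.2.1
    · rfl
  · refine le_trans (Finset.sum_le_sum ?_) hl.2.2
    intro i _
    split_ifs <;> omega

lemma KK_diag_aux (S : ℕ) (l : ℕ → ℕ) (hl : l ∈ PP S) : ∀ N ≤ S, KK S N l (fun i => if i < N then l i else 0) = 1 := by
  intro N
  induction N with
  | zero =>
    intro _
    simp only [KK]
    rw [if_pos]; funext i; simp
  | succ N ih =>
    intro hN
    simp only [KK]
    have hsz : sz S (fun i => if i < N + 1 then l i else 0) = sz S (fun i => if i < N then l i else 0) + l N := by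
      have : ∀ i, (if i < N + 1 then l i else 0) = (if i < N then l i else 0) + (if i = N then l N else 0) := by
        intro i
        rcases lt_trichotomy i N with h | h | h
        · rw [if_pos (by omega), if_pos h, if_neg (by omega), add_zero]
        · subst h; simp
        · rw [if_neg (by omega), if_neg (by omega), if_neg (by omega)]
      unfold sz
      simp only [this]
      rw [Finset.sum_add_distrib, Finset.sum_ite_eq', if_pos (Finset.mem_range.2 (by omega))]
    have hanti := (mem_PP.1 hl).1
    rw [Finset.sum_eq_single (fun i => if i < N then l i else 0), ih (by omega)]
    · intro m hm hne
      rw [Finset.mem_filter] at hm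
      obtain ⟨hm, h1, h2⟩ := hm
      by_contra h0
      apply hne
      have hr := KK_rows S N l m h0
      have hle : ∀ i ∈ Finset.range S, m i ≤ (fun i => if i < N then l i else 0) i := by
        intro i _
        dsimp only
        split_ifs with h
        · have := (h1 i).1; simp only [] at this; rw [if_pos (by omega)] at this; exact this
        · rw [hr i (by omega)]
      have := (Finset.sum_eq_sum_iff_of_le hle).1 (by
        change sz S m = sz S _
        omega)
      funext i
      by_cases hi : i < S
      · exact this i (Finset.mem_range.2 hi)
      · rw [PP_zero hm (by omega), if_neg (by omega)]
    · intro h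
      exfalso; apply h
      rw [Finset.mem_filter]
      refine ⟨trunc_PP hl N, ?_, hsz⟩
      intro i
      dsimp only
      constructor
      · split_ifs <;> omega
      · by_cases h : i < N
        · rw [if_pos (by omega), if_pos h]; exact hanti (Nat.le_succ i)
        · rw [if_neg (by omega)]; omega

lemma KK_diag (S : ℕ) (l : ℕ → ℕ) (hl : l ∈ PP S) : KK S S l l = 1 := by
  have := KK_diag_aux S l hl S le_rfl
  have e : (fun i => if i < S then l i else 0) = l := by
    funext i
    split_ifs with h
    · rfl
    · rw [PP_zero hl (by omega)]
  rwa [e] at this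

lemma hook_zero (a b : ℕ) : hookFun a b 0 = a := rfl
lemma hook_succ (a b i : ℕ) : hookFun a b (i+1) = if i < b then 1 else 0 := by
  simp [hookFun, Nat.succ_le_iff]

lemma sz_hook (S a b : ℕ) (h : b < S) : sz S (hookFun a b) = a + b := by
  obtain ⟨S, rfl⟩ : ∃ j, S = j + 1 := ⟨S - 1, by omega⟩
  unfold sz
  rw [Finset.sum_range_succ']
  have : ∀ i ∈ Finset.range S, hookFun a b (i+1) = if i ∈ Finset.range b then 1 else 0 := by
    intro i _
    simp [hook_succ]
  rw [Finset.sum_congr rfl this, Finset.sum_ite_mem, Finset.sum_const, Finset.range_inter_range]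
  simp [hookFun]; omega

lemma hook_PP (S a b : ℕ) (ha : 1 ≤ a) (h : a + b ≤ S) : hookFun a b ∈ PP S := by
  rw [mem_PP]
  refine ⟨?_, ?_, ?_⟩
  · apply antitone_nat_of_succ_le
    intro i
    rcases i with _ | i
    · rw [hook_zero, hook_succ]; split_ifs <;> omega
    · rw [hook_succ, hook_succ]; split_ifs <;> omega
  · simp only [hookFun]; split_ifs <;> omega
  · rw [sz_hook S a b (by omega)]; exact h

lemma hs_hook {a b : ℕ} {m : ℕ → ℕ} (h : hs (hookFun a b) m) (hb : 1 ≤ b) :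
    1 ≤ m 0 ∧ (m = hookFun (m 0) b ∨ m = hookFun (m 0) (b - 1)) := by
  have h0 := h 0
  refine ⟨?_, ?_⟩
  · simp [hookFun, hb] at h0; omega
  · obtain ⟨b, rfl⟩ : ∃ j, b = j + 1 := ⟨b - 1, by omega⟩
    by_cases hmb : m (b+1) = 1
    · left; funext i
      rcases i with _ | i
      · rfl
      · have h1 := h (i+1)
        by_cases hib : i = b
        · subst hib; rw [hmb, hook_succ, if_pos (by omega)]
        · simp only [hook_succ] at h1 ⊢
          split_ifs at h1 ⊢ <;> omega
    · right; funext i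
      have hmb' := (h (b+1)).1
      rcases i with _ | i
      · rfl
      · have h1 := h (i+1)
        simp only [hook_succ] at h1 hmb' ⊢
        by_cases hib : i = b
        · subst hib; split_ifs at hmb' ⊢ <;> omega
        · split_ifs at h1 ⊢ <;> omega

lemma hook_hs_same {a a' b : ℕ} (h1 : a' ≤ a) (h2 : 1 ≤ a') : hs (hookFun a b) (hookFun a' b) := by
  intro i
  rcases i with _ | i
  · simp only [hook_succ, hook_zero]; split_ifs <;> omega
  · simp only [hook_succ]; split_ifs <;> omega

lemma hook_hs_pred {a a' b : ℕ} (h1 : a' ≤ a) (h2 : 1 ≤ a') : hs (hookFun a b) (hookFun a' (b-1)) := by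
  intro i
  rcases i with _ | i
  · simp only [hook_succ, hook_zero]; split_ifs <;> omega
  · simp only [hook_succ]; split_ifs <;> omega

lemma KK_hook (S : ℕ) : ∀ (q : ℕ) (e : ℕ → ℕ) (a b : ℕ), 1 ≤ a → (∀ v < q + 1, 0 < e v) →
    ∑ v ∈ Finset.range (q+1), e v = a + b → a + b ≤ S →
    KK S (q+1) e (hookFun a b) = q.choose b := by
  intro q
  induction q with
  | zero =>
    intro e a b ha he hsum hS
    simp only [KK]
    simp at hsum
    by_cases hb : b = 0
    · subst hb
      rw [Finset.sum_eq_single 0]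
      · simp
      · intro m _ hm; simp [hm]
      · intro h; exfalso; apply h
        rw [Finset.mem_filter]
        refine ⟨zero_PP S, ?_, ?_⟩
        · intro i; simp [hookFun]
        · rw [sz_hook S a 0 (by omega)]; simp [sz]; omega
    · rw [Nat.choose_eq_zero_of_lt (by omega)]
      apply Finset.sum_eq_zero
      intro m hm
      rw [Finset.mem_filter] at hm
      have := (hs_hook hm.2.1 (by omega)).1
      rw [if_neg]
      rintro rfl
      simp at this
  | succ q ih =>
    intro e a b ha he hsum hS
    rw [KK]
    rw [Finset.sum_range_succ] at hsum
    have hq : q + 1 ≤ ∑ v ∈ Finset.range (q+1), e v := by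
      have := Finset.card_nsmul_le_sum (Finset.range (q+1)) e 1 (fun v hv => by
        have := Finset.mem_range.1 hv
        exact he v (by omega))
      simpa using this
    have heq := he (q+1) (by omega)
    by_cases hb : b = 0
    · subst hb
      rw [Finset.sum_eq_single (hookFun (a - e (q+1)) 0), ih e _ _ (by omega) (fun v hv => he v (by omega)) (by omega) (by omega)]
      · simp
      · intro m hm hne
        exfalso
        rw [Finset.mem_filter] at hm
        obtain ⟨hm, h1, h2⟩ := hm
        have hm' : m = hookFun (m 0) 0 := by
          funext i
          have := h1 i
          rcases i with _ | i
          · rfl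
          · simp only [hook_succ] at this ⊢
            split_ifs at this ⊢ <;> omega
        rw [hm', sz_hook S _ _ (by omega), sz_hook S _ _ (by omega)] at h2
        apply hne
        rw [hm']; congr 1; omega
      · intro h; exfalso; apply h
        rw [Finset.mem_filter]
        refine ⟨hook_PP S _ _ (by omega) (by omega), hook_hs_same (by omega) (by omega), ?_⟩
        rw [sz_hook S _ _ (by omega), sz_hook S _ _ (by omega)]; omega
    · rw [← Finset.sum_filter_add_sum_filter_not _ (fun m => m b = 1)]
      have c1 : ∑ m ∈ ((PP S).filter (fun m => hs (hookFun a b) m ∧ sz S (hookFun a b) = sz S m + e (q+1))).filter (fun m => m b = 1),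
          KK S (q+1) e m = q.choose b := by
        have hform : ∀ m ∈ ((PP S).filter (fun m => hs (hookFun a b) m ∧ sz S (hookFun a b) = sz S m + e (q+1))).filter (fun m => m b = 1),
            1 ≤ m 0 ∧ m = hookFun (m 0) b ∧ a = m 0 + e (q+1) := by
          intro m hm
          simp only [Finset.mem_filter] at hm
          obtain ⟨⟨hm, h1, h2⟩, h3⟩ := hm
          obtain ⟨h4, h5 | h5⟩ := hs_hook h1 (by omega)
          · refine ⟨h4, h5, ?_⟩
            rw [h5, sz_hook S _ _ (by omega), sz_hook S _ _ (by omega)] at h2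
            omega
          · exfalso
            rw [h5] at h3
            simp only [hookFun] at h3
            split_ifs at h3 <;> omega
        by_cases hae : e (q+1) < a
        · rw [Finset.sum_eq_single (hookFun (a - e (q+1)) b), ih e _ _ (by omega) (fun v hv => he v (by omega)) (by omega) (by omega)]
          · intro m hm hne
            exfalso
            obtain ⟨h1, h2, h3⟩ := hform m hm
            apply hne
            rw [h2]; congr 1; omega
          · intro h; exfalso; apply h
            simp only [Finset.mem_filter]
            refine ⟨⟨hook_PP S _ _ (by omega) (by omega), hook_hs_same (by omega) (by omega), ?_⟩, ?_⟩
            · rw [sz_hook S _ _ (by omega), sz_hook S _ _ (by omega)]; omega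
            · simp [hookFun, hb]
        · rw [Nat.choose_eq_zero_of_lt (by omega)]
          apply Finset.sum_eq_zero
          intro m hm
          obtain ⟨h1, h2, h3⟩ := hform m hm
          omega
      have c2 : ∑ m ∈ ((PP S).filter (fun m => hs (hookFun a b) m ∧ sz S (hookFun a b) = sz S m + e (q+1))).filter (fun m => ¬ m b = 1),
          KK S (q+1) e m = q.choose (b-1) := by
        have hform : ∀ m ∈ ((PP S).filter (fun m => hs (hookFun a b) m ∧ sz S (hookFun a b) = sz S m + e (q+1))).filter (fun m => ¬ m b = 1),
            1 ≤ m 0 ∧ m = hookFun (m 0) (b-1) ∧ a + 1 = m 0 + e (q+1) := by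
          intro m hm
          simp only [Finset.mem_filter] at hm
          obtain ⟨⟨hm, h1, h2⟩, h3⟩ := hm
          obtain ⟨h4, h5 | h5⟩ := hs_hook h1 (by omega)
          · exfalso
            rw [h5] at h3
            simp [hookFun, hb] at h3
          · refine ⟨h4, h5, ?_⟩
            rw [h5, sz_hook S _ _ (by omega), sz_hook S _ _ (by omega)] at h2
            omega
        by_cases hae : e (q+1) ≤ a
        · rw [Finset.sum_eq_single (hookFun (a + 1 - e (q+1)) (b-1)), ih e _ _ (by omega) (fun v hv => he v (by omega)) (by omega) (by omega)]
          · intro m hm hne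
            exfalso
            obtain ⟨h1, h2, h3⟩ := hform m hm
            apply hne
            rw [h2]; congr 1; omega
          · intro h; exfalso; apply h
            simp only [Finset.mem_filter]
            refine ⟨⟨hook_PP S _ _ (by omega) (by omega), hook_hs_pred (by omega) (by omega), ?_⟩, ?_⟩
            · rw [sz_hook S _ _ (by omega), sz_hook S _ _ (by omega)]; omega
            · obtain ⟨b', rfl⟩ : ∃ j, b = j + 1 := ⟨b - 1, by omega⟩
              rw [hook_succ, if_neg (by omega)]; omega
        · rw [Nat.choose_eq_zero_of_lt (by rw [Nat.lt_sub_iff_add_lt]; omega)]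
          apply Finset.sum_eq_zero
          intro m hm
          obtain ⟨h1, h2, h3⟩ := hform m hm
          omega
      rw [c1, c2]
      obtain ⟨b, rfl⟩ : ∃ j, b = j + 1 := ⟨b - 1, by omega⟩
      rw [Nat.choose_succ_succ]; simp; omega

end KKprops
end CR

namespace CR

section SSYT

/-- finite set of cells -/
def cellsF (S : ℕ) (l : ℕ → ℕ) : Finset (ℕ × ℕ) :=
  (Finset.range S ×ˢ Finset.range (l 0)).filter (fun c => c.2 < l c.1)

lemma mem_cellsF {S : ℕ} {l : ℕ → ℕ} (hl : l ∈ PP S) (x : ℕ × ℕ) : x ∈ cellsF S l ↔ x ∈ cells l := by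
  simp only [cellsF, Finset.mem_filter, Finset.mem_product, Finset.mem_range, cells, Set.mem_setOf_eq]
  constructor
  · exact fun h => h.2
  · intro h
    refine ⟨⟨?_, lt_of_lt_of_le h ((mem_PP.1 hl).1 (Nat.zero_le _))⟩, h⟩
    by_contra h'
    rw [PP_zero hl (not_lt.1 h')] at h
    omega

lemma card_cellsF {S : ℕ} {l : ℕ → ℕ} (hl : l ∈ PP S) : (cellsF S l).card = sz S l := by
  unfold cellsF sz
  rw [Finset.card_filter, Finset.sum_product]
  apply Finset.sum_congr rfl
  intro i _
  rw [← Finset.card_filter]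
  have : (Finset.range (l 0)).filter (fun c => c < l i) = Finset.range (l i) := by
    ext c
    simp only [Finset.mem_filter, Finset.mem_range]
    have := (mem_PP.1 hl).1 (Nat.zero_le i)
    omega
  dsimp only
  rw [this, Finset.card_range]

/-- semistandard tableaux of given shape and content -/
def SSet (S : ℕ) (l e : ℕ → ℕ) : Set (ℕ × ℕ → ℕ) :=
  {T | RowColOk (cells l) T ∧ (∀ x, x ∉ cells l → T x = 0) ∧
    ∀ v, ((cellsF S l).filter (fun x => T x = v)).card = e v}

lemma SSet_lt {S : ℕ} {l e : ℕ → ℕ} (hl : l ∈ PP S) {T : ℕ × ℕ → ℕ} (hT : T ∈ SSet S l e) {N : ℕ}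
    (he : ∀ v, N ≤ v → e v = 0) {x : ℕ × ℕ} (hx : x ∈ cells l) : T x < N := by
  by_contra h
  have h1 := hT.2.2 (T x)
  rw [he _ (not_lt.1 h), Finset.card_eq_zero] at h1
  have : x ∈ (cellsF S l).filter (fun y => T y = T x) := by
    rw [Finset.mem_filter]; exact ⟨(mem_cellsF hl x).2 hx, rfl⟩
  rw [h1] at this
  simp at this

lemma row_mono {l : ℕ → ℕ} {T : ℕ × ℕ → ℕ} (h : RowColOk (cells l) T) (r c : ℕ) : ∀ c', c ≤ c' → c' < l r →
    T (r, c) ≤ T (r, c') := by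
  intro c' hc'
  induction c', hc' using Nat.le_induction with
  | base => intro _; rfl
  | succ c' hc' ih =>
    intro h'
    exact (ih (by omega)).trans (h.1 r c' (by simp [cells]; omega) (by simpa [cells] using h'))

/-- extend a tableau by letters `N` -/
def extT (l m : ℕ → ℕ) (N : ℕ) (T : ℕ × ℕ → ℕ) : ℕ × ℕ → ℕ :=
  fun x => if x ∈ cells l ∧ x ∉ cells m then N else T x

lemma cells_mono {l m : ℕ → ℕ} (h : hs l m) {x : ℕ × ℕ} (hx : x ∈ cells m) : x ∈ cells l :=
  lt_of_lt_of_le hx (h x.1).1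

lemma extT_mem {S : ℕ} {l m e : ℕ → ℕ} (hl : l ∈ PP S) (hm : m ∈ PP S) (h : hs l m) {N : ℕ}
    (hsz : sz S l = sz S m + e N) (he : ∀ v, N + 1 ≤ v → e v = 0) {T : ℕ × ℕ → ℕ}
    (hT : T ∈ SSet S m (fun v => if v < N then e v else 0)) : extT l m N T ∈ SSet S l e := by
  have hlt : ∀ x, x ∈ cells m → T x < N := fun x hx => SSet_lt hm hT (N := N) (by
    intro v hv; rw [if_neg (by omega)]) hx
  obtain ⟨h1, h2, h3⟩ := hT
  have ein : ∀ x, x ∈ cells m → extT l m N T x = T x := by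
    intro x hx; unfold extT; rw [if_neg (fun h => h.2 hx)]
  have eout : ∀ x, x ∈ cells l → x ∉ cells m → extT l m N T x = N := by
    intro x hx hx'; unfold extT; rw [if_pos ⟨hx, hx'⟩]
  have ele : ∀ x, x ∈ cells l → extT l m N T x ≤ N := by
    intro x hx
    by_cases hx' : x ∈ cells m
    · rw [ein x hx']; exact (hlt x hx').le
    · rw [eout x hx hx']
  refine ⟨⟨?_, ?_⟩, ?_, ?_⟩
  · intro r c hc hc'
    by_cases hc'' : (r, c+1) ∈ cells m
    · have : (r, c) ∈ cells m := by simp only [cells, Set.mem_setOf_eq] at hc'' ⊢; omega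
      rw [ein _ hc'', ein _ this]
      exact h1.1 r c this hc''
    · rw [eout _ hc' hc'']; exact ele _ hc
  · intro r c hc hc'
    have hcm : (r, c) ∈ cells m := lt_of_lt_of_le hc' (h r).2
    rw [ein _ hcm]
    by_cases hc'' : (r+1, c) ∈ cells m
    · rw [ein _ hc'']; exact h1.2 r c hcm hc''
    · rw [eout _ hc' hc'']; exact hlt _ hcm
  · intro x hx
    unfold extT
    rw [if_neg (fun h => hx h.1)]
    exact h2 x (fun h' => hx (cells_mono h h'))
  · intro v
    have hsub : cellsF S m ⊆ cellsF S l := by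
      intro x hx
      rw [mem_cellsF hm] at hx
      rw [mem_cellsF hl]; exact cells_mono h hx
    rcases lt_trichotomy v N with hv | hv | hv
    · have := h3 v
      simp only [if_pos hv] at this
      rw [← this]
      congr 1
      ext x
      simp only [Finset.mem_filter, mem_cellsF hl, mem_cellsF hm]
      constructor
      · rintro ⟨ha, hb⟩
        by_cases hx : x ∈ cells m
        · rw [ein x hx] at hb; exact ⟨hx, hb⟩
        · rw [eout x ha hx] at hb; omega
      · rintro ⟨ha, hb⟩
        exact ⟨cells_mono h ha, by rw [ein x ha]; exact hb⟩
    · subst hv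
      have : (cellsF S l).filter (fun x => extT l m v T x = v) = cellsF S l \ cellsF S m := by
        ext x
        simp only [Finset.mem_filter, Finset.mem_sdiff, mem_cellsF hl, mem_cellsF hm]
        constructor
        · rintro ⟨ha, hb⟩
          refine ⟨ha, fun hx => ?_⟩
          rw [ein x hx] at hb; have := hlt x hx; omega
        · rintro ⟨ha, hb⟩
          exact ⟨ha, eout x ha hb⟩
      rw [this, Finset.card_sdiff_of_subset hsub, card_cellsF hl, card_cellsF hm]
      omega
    · rw [he v (by omega), Finset.card_eq_zero, Finset.filter_eq_empty_iff]
      intro x hx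
      rw [mem_cellsF hl] at hx
      have := ele x hx
      omega

/-- the shape of the letters `< N` -/
def subSh (l : ℕ → ℕ) (N : ℕ) (T : ℕ × ℕ → ℕ) : ℕ → ℕ :=
  fun i => Nat.find (p := fun c => l i ≤ c ∨ N ≤ T (i, c)) ⟨l i, Or.inl le_rfl⟩

lemma lt_subSh {l : ℕ → ℕ} {N : ℕ} {T : ℕ × ℕ → ℕ} (h : RowColOk (cells l) T) (i c : ℕ) :
    c < subSh l N T i ↔ c < l i ∧ T (i, c) < N := by
  unfold subSh
  constructor
  · intro hc
    have := Nat.find_min _ hc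
    push Not at this
    exact this
  · rintro ⟨h1, h2⟩
    by_contra hc
    rw [not_lt] at hc
    have hf := Nat.find_spec (p := fun c => l i ≤ c ∨ N ≤ T (i, c)) ⟨l i, Or.inl le_rfl⟩
    rcases hf with hf | hf
    · omega
    · have := row_mono h i _ c hc h1
      omega

lemma exists_sub {S : ℕ} {l e : ℕ → ℕ} (hl : l ∈ PP S) {N : ℕ} (he : ∀ v, N + 1 ≤ v → e v = 0)
    {T : ℕ × ℕ → ℕ} (hT : T ∈ SSet S l e) : ∃ m ∈ PP S, hs l m ∧ sz S l = sz S m + e N ∧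
    ∃ T' ∈ SSet S m (fun v => if v < N then e v else 0), extT l m N T' = T := by
  have hlt : ∀ x, x ∈ cells l → T x < N + 1 := fun x hx => SSet_lt hl hT he hx
  obtain ⟨h1, h2, h3⟩ := hT
  have hmem : ∀ x, x ∈ cells (subSh l N T) ↔ x ∈ cells l ∧ T x < N := by
    rintro ⟨i, c⟩; exact lt_subSh h1 i c
  have hh : hs l (subSh l N T) := by
    intro i
    constructor
    · by_contra h
      have := ((lt_subSh (N := N) h1 i (l i)).1 (by omega)).1
      omega
    · by_contra h
      have hc : (i + 1, subSh l N T i) ∈ cells l := by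
        simp only [cells, Set.mem_setOf_eq]; omega
      have hanti := (mem_PP.1 hl).1 (Nat.le_succ i)
      have hc' : (i, subSh l N T i) ∈ cells l := by
        simp only [cells, Set.mem_setOf_eq]; simp only [Nat.succ_eq_add_one] at hanti; omega
      have := h1.2 _ _ hc' hc
      have := hlt _ hc
      have := (lt_subSh (N := N) h1 i (subSh l N T i)).2 ⟨hc', by omega⟩
      omega
  have hm := hs_PP hl hh
  have hsub : cellsF S (subSh l N T) ⊆ cellsF S l := by
    intro x hx
    rw [mem_cellsF hm] at hx
    rw [mem_cellsF hl]; exact cells_mono hh hx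
  refine ⟨subSh l N T, hm, hh, ?_, fun x => if x ∈ cells (subSh l N T) then T x else 0, ⟨⟨?_, ?_⟩, ?_, ?_⟩, ?_⟩
  · rw [← h3 N]
    have : (cellsF S l).filter (fun x => T x = N) = cellsF S l \ cellsF S (subSh l N T) := by
      ext x
      simp only [Finset.mem_filter, Finset.mem_sdiff, mem_cellsF hl, mem_cellsF hm, hmem]
      constructor
      · rintro ⟨ha, hb⟩; exact ⟨ha, fun h => by omega⟩
      · rintro ⟨ha, hb⟩
        refine ⟨ha, ?_⟩
        have := hlt x ha
        by_contra h
        exact hb ⟨ha, by omega⟩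
    rw [this, Finset.card_sdiff_of_subset hsub, card_cellsF hl, card_cellsF hm]
    have := hs_sz (S := S) hh
    omega
  · intro r c hc hc'
    simp only [hc, hc', if_true]
    exact h1.1 r c (cells_mono hh hc) (cells_mono hh hc')
  · intro r c hc hc'
    simp only [hc, hc', if_true]
    exact h1.2 r c (cells_mono hh hc) (cells_mono hh hc')
  · intro x hx; simp [hx]
  · intro v
    dsimp only
    split_ifs with hv
    · rw [← h3 v]
      congr 1
      ext x
      simp only [Finset.mem_filter, mem_cellsF hl, mem_cellsF hm]
      constructor
      · rintro ⟨ha, hb⟩; rw [if_pos ha] at hb; exact ⟨cells_mono hh ha, hb⟩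
      · rintro ⟨ha, hb⟩
        have : x ∈ cells (subSh l N T) := (hmem x).2 ⟨ha, by omega⟩
        exact ⟨this, by rw [if_pos this]; exact hb⟩
    · rw [Finset.card_eq_zero, Finset.filter_eq_empty_iff]
      intro x hx
      rw [mem_cellsF hm] at hx
      rw [if_pos hx]
      have := ((hmem x).1 hx).2
      omega
  · funext x
    unfold extT
    by_cases hx : x ∈ cells (subSh l N T)
    · simp [hx]
    · by_cases hx' : x ∈ cells l
      · simp only [hx', hx, not_false_eq_true, and_self, if_true]
        have := hlt x hx'
        by_contra h
        exact hx ((hmem x).2 ⟨hx', by omega⟩)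
      · simp [hx, hx', h2 x hx']

lemma cells_inj {l m : ℕ → ℕ} (h : ∀ x, x ∈ cells l ↔ x ∈ cells m) : l = m := by
  funext i
  have h1 := h (i, l i)
  have h2 := h (i, m i)
  simp only [cells, Set.mem_setOf_eq] at h1 h2
  omega

lemma SSet_card (S : ℕ) : ∀ (N : ℕ) (e l : ℕ → ℕ), l ∈ PP S → (∀ v, N ≤ v → e v = 0) →
    ∃ F : Finset (ℕ × ℕ → ℕ), (∀ T, T ∈ F ↔ T ∈ SSet S l e) ∧ F.card = KK S N e l := by
  intro N
  induction N with
  | zero =>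
    intro e l hl he
    simp only [KK]
    by_cases h0 : l = 0
    · refine ⟨{0}, ?_, by simp [h0]⟩
      intro T
      have hc : ∀ x, x ∉ cells l := by intro x hx; rw [h0] at hx; simp [cells] at hx
      rw [Finset.mem_singleton]
      constructor
      · rintro rfl
        refine ⟨⟨fun r c h => absurd h (hc _), fun r c h => absurd h (hc _)⟩, fun _ _ => rfl, ?_⟩
        intro v
        rw [he v (by omega), Finset.card_eq_zero, Finset.filter_eq_empty_iff]
        intro x hx
        exact absurd ((mem_cellsF hl x).1 hx) (hc x)
      · intro hT; funext x; exact hT.2.1 x (hc x)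
    · refine ⟨∅, ?_, by simp [h0]⟩
      intro T
      simp only [Finset.notMem_empty, false_iff]
      intro hT
      apply h0
      funext i
      by_contra h
      have := SSet_lt hl hT (N := 0) he (x := (i, 0)) (by simp only [cells, Set.mem_setOf_eq]; exact Nat.pos_of_ne_zero h)
      omega
  | succ N ih =>
    intro e l hl he
    have hF : ∀ m : ℕ → ℕ, ∃ F : Finset (ℕ × ℕ → ℕ), m ∈ PP S → ((∀ T, T ∈ F ↔ T ∈ SSet S m (fun v => if v < N then e v else 0)) ∧
        F.card = KK S N e m) := by
      intro m
      by_cases hm : m ∈ PP S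
      · obtain ⟨F, h1, h2⟩ := ih (fun v => if v < N then e v else 0) m hm (by
          intro v hv; rw [if_neg (by omega)])
        refine ⟨F, fun _ => ⟨h1, ?_⟩⟩
        rw [h2]; apply KK_congr; intro i hi; simp [hi]
      · exact ⟨∅, fun h => absurd h hm⟩
    choose F hF using hF
    have hval : ∀ m ∈ PP S, hs l m → ∀ T ∈ F m, ∀ x, x ∈ cells m ↔ x ∈ cells l ∧ extT l m N T x < N := by
      intro m hm hlm T hT x
      have hT' := ((hF m hm).1 T).1 hT
      constructor
      · intro hx
        refine ⟨cells_mono hlm hx, ?_⟩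
        unfold extT
        rw [if_neg (fun h => h.2 hx)]
        exact SSet_lt hm hT' (N := N) (by intro v hv; rw [if_neg (by omega)]) hx
      · rintro ⟨h1, h2⟩
        by_contra h
        unfold extT at h2
        rw [if_pos ⟨h1, h⟩] at h2
        omega
    refine ⟨((PP S).filter (fun m => hs l m ∧ sz S l = sz S m + e N)).biUnion
      (fun m => (F m).image (extT l m N)), ?_, ?_⟩
    · intro T
      simp only [Finset.mem_biUnion, Finset.mem_filter, Finset.mem_image]
      constructor
      · rintro ⟨m, ⟨hm, h1, h2⟩, T', hT', rfl⟩
        exact extT_mem hl hm h1 h2 he (((hF m hm).1 T').1 hT')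
      · intro hT
        obtain ⟨m, hm, h1, h2, T', hT', h3⟩ := exists_sub hl he hT
        exact ⟨m, ⟨hm, h1, h2⟩, T', ((hF m hm).1 T').2 hT', h3⟩
    · rw [Finset.card_biUnion]
      · simp only [KK]
        apply Finset.sum_congr rfl
        intro m hm
        rw [Finset.mem_filter] at hm
        rw [Finset.card_image_of_injOn, (hF m hm.1).2]
        intro T hT T' hT' heq
        have a1 := ((hF m hm.1).1 T).1 hT
        have a2 := ((hF m hm.1).1 T').1 hT'
        funext x
        by_cases hx : x ∈ cells m
        · have := congrFun heq x
          unfold extT at this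
          rwa [if_neg (fun h => h.2 hx), if_neg (fun h => h.2 hx)] at this
        · rw [a1.2.1 x hx, a2.2.1 x hx]
      · intro m hm m' hm' hne
        rw [Finset.mem_coe, Finset.mem_filter] at hm hm'
        rw [Function.onFun, Finset.disjoint_left]
        intro T hT hT'
        rw [Finset.mem_image] at hT hT'
        obtain ⟨T1, h1, rfl⟩ := hT
        obtain ⟨T2, h2, h3⟩ := hT'
        apply hne
        apply cells_inj
        intro x
        rw [hval m hm.1 hm.2.1 T1 h1 x, hval m' hm'.1 hm'.2.1 T2 h2 x, h3]

theorem schur_coeff (S N : ℕ) (l : ℕ → ℕ) (hl : l ∈ PP S) (e : ℕ →₀ ℕ) (he : ∀ v, N ≤ v → e v = 0) :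
    schur l e = (KK S N e l : ℚ) := by
  obtain ⟨F, h1, h2⟩ := SSet_card S N e l hl he
  have hc : cells l \ cells (fun _ => 0) = cells l := by
    ext x; simp [cells]
  unfold schur skewSchur tabSeries
  rw [hc, ← h2]
  congr 1
  apply Nat.subtype_card
  intro T
  rw [h1]
  unfold SSet
  simp only [Set.mem_setOf_eq]
  have : ∀ v, Nat.card {x : ℕ × ℕ // x ∈ cells l ∧ T x = v} = ((cellsF S l).filter (fun x => T x = v)).card := by
    intro v
    apply Nat.subtype_card
    intro x
    rw [Finset.mem_filter, mem_cellsF hl]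
  simp only [this]

end SSYT
end CR

namespace CR

set_option linter.unusedSectionVars false
section Words
variable {n : ℕ} [NeZero n]

/-- content of a word -/
def cont (w : Fin n → ℕ) (v : ℕ) : ℕ := (Finset.univ.filter (fun p => w p = v)).card

/-- joint counts -/
def kap (c w : Fin n → ℕ) (i v : ℕ) : ℕ := (Finset.univ.filter (fun p => c p = i ∧ w p = v)).card

/-- cyclic ascents -/
def cAsc (w : Fin n → ℕ) : Finset (Fin n) := Finset.univ.filter (fun i => w i < w (i + 1))

/-- position relative to cut -/
def pos (x p : Fin n) : ℕ := (p - (x + 1)).val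

lemma pos_inj (x : Fin n) {p q : Fin n} (h : pos x p = pos x q) : p = q := by
  have := Fin.ext h
  exact sub_left_injective this

lemma pos_lt (x p : Fin n) : pos x p < n := (p - (x + 1)).2

lemma pos_self (x : Fin n) : pos x x = n - 1 := by
  unfold pos
  have h : x - (x + 1) = -1 := by abel
  rw [h]
  obtain ⟨m, rfl⟩ : ∃ m, n = m + 1 := ⟨n - 1, by have := NeZero.pos n; omega⟩
  simpa using Fin.coe_neg_one (n := m)

lemma pos_succ (x i : Fin n) (h : i ≠ x) : pos x (i + 1) = pos x i + 1 := by
  have h1 : pos x i ≠ n - 1 := by rw [← pos_self x]; exact fun h' => h (pos_inj x h')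
  have h2 := pos_lt x i
  obtain ⟨m, rfl⟩ : ∃ m, n = m + 1 := ⟨n - 1, by have := NeZero.pos n; omega⟩
  have e : i + 1 - (x + 1) = (i - (x + 1)) + 1 := by abel
  unfold pos at *
  rw [e, Fin.val_add_one, if_neg]
  intro h3
  rw [h3] at h1
  simp at h1

/-- block labels -/
def cB (x : Fin n) (B : Finset (Fin n)) (p : Fin n) : ℕ := (B.filter (fun j => pos x j < pos x p)).card

lemma cB_mono (x : Fin n) (B : Finset (Fin n)) {p q : Fin n} (h : pos x p ≤ pos x q) : cB x B p ≤ cB x B q := by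
  apply Finset.card_le_card
  intro j hj
  rw [Finset.mem_filter] at *
  exact ⟨hj.1, by omega⟩

lemma cB_succ_notMem (x : Fin n) (B : Finset (Fin n)) (i : Fin n) (hx : x ∈ B) (hi : i ∉ B) :
    cB x B (i + 1) = cB x B i := by
  unfold cB
  rw [pos_succ x i (by rintro rfl; exact hi hx)]
  congr 1
  apply Finset.filter_congr
  intro j hj
  have : pos x j ≠ pos x i := fun h => hi (pos_inj x h ▸ hj)
  omega

lemma cB_succ_mem (x : Fin n) (B : Finset (Fin n)) (i : Fin n) (hi : i ∈ B) (hix : i ≠ x) :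
    cB x B i < cB x B (i + 1) := by
  apply Finset.card_lt_card
  rw [Finset.ssubset_iff_of_subset]
  · refine ⟨i, ?_, ?_⟩
    · rw [Finset.mem_filter, pos_succ x i hix]; exact ⟨hi, by omega⟩
    · rw [Finset.mem_filter]; omega
  · intro j hj
    rw [Finset.mem_filter] at *
    rw [pos_succ x i hix]
    exact ⟨hj.1, by omega⟩

lemma cB_lt (x : Fin n) (B : Finset (Fin n)) (hx : x ∈ B) (p : Fin n) : cB x B p < B.card := by
  apply Finset.card_lt_card
  rw [Finset.filter_ssubset]
  refine ⟨x, hx, ?_⟩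
  rw [pos_self]
  have := pos_lt x p
  omega

lemma cB_surj (x : Fin n) (B : Finset (Fin n)) (hx : x ∈ B) (v : ℕ) (hv : v < B.card) :
    ∃ p ∈ B, cB x B p = v := by
  have hinj : Set.InjOn (cB x B) B := by
    have key : ∀ p q, p ∈ B → pos x p < pos x q → cB x B p < cB x B q := by
      intro p q hp hpq
      apply Finset.card_lt_card
      rw [Finset.ssubset_iff_of_subset]
      · exact ⟨p, by rw [Finset.mem_filter]; exact ⟨hp, hpq⟩, by rw [Finset.mem_filter]; omega⟩
      · intro j hj
        rw [Finset.mem_filter] at *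
        exact ⟨hj.1, by omega⟩
    intro p hp q hq h
    rcases lt_trichotomy (pos x p) (pos x q) with h' | h' | h'
    · have := key p q hp h'; omega
    · exact pos_inj x h'
    · have := key q p hq h'; omega
  have : B.image (cB x B) = Finset.range B.card := by
    apply Finset.eq_of_subset_of_card_le
    · intro v hv
      rw [Finset.mem_image] at hv
      obtain ⟨p, _, rfl⟩ := hv
      exact Finset.mem_range.2 (cB_lt x B hx p)
    · rw [Finset.card_image_of_injOn hinj, Finset.card_range]
  have h : v ∈ B.image (cB x B) := by rw [this]; exact Finset.mem_range.2 hv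
  simpa using h

lemma cont_cB_pos (x : Fin n) (B : Finset (Fin n)) (hx : x ∈ B) (v : ℕ) (hv : v < B.card) :
    0 < cont (cB x B) v := by
  obtain ⟨p, _, hp⟩ := cB_surj x B hx v hv
  exact Finset.card_pos.2 ⟨p, by simp [hp]⟩

lemma cont_eq_zero (w : Fin n → ℕ) {N : ℕ} (h : ∀ p, w p < N) {v : ℕ} (hv : N ≤ v) : cont w v = 0 := by
  unfold cont
  rw [Finset.card_eq_zero, Finset.filter_eq_empty_iff]
  intro p _ hp
  have := h p; omega

lemma lt_of_cont (w : Fin n → ℕ) {N : ℕ} (h : ∀ v, N ≤ v → cont w v = 0) (p : Fin n) : w p < N := by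
  by_contra hp
  have := h (w p) (not_lt.1 hp)
  unfold cont at this
  rw [Finset.card_eq_zero, Finset.filter_eq_empty_iff] at this
  exact this (Finset.mem_univ p) rfl

lemma sum_cont (w : Fin n → ℕ) {N : ℕ} (h : ∀ p, w p < N) : ∑ v ∈ Finset.range N, cont w v = n := by
  have := Finset.card_eq_sum_card_fiberwise (s := (Finset.univ : Finset (Fin n))) (t := Finset.range N) (f := w)
    (fun p _ => by simpa using h p)
  simp only [Finset.card_univ, Fintype.card_fin] at this
  exact this.symm

lemma kap_row (c w : Fin n → ℕ) {N : ℕ} (h : ∀ p, w p < N) (i : ℕ) :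
    ∑ v ∈ Finset.range N, kap c w i v = cont c i := by
  unfold cont kap
  rw [Finset.card_eq_sum_card_fiberwise (t := Finset.range N) (f := w) (fun p _ => by simpa using h p)]
  apply Finset.sum_congr rfl
  intro v _
  rw [Finset.filter_filter]

lemma kap_col (c w : Fin n → ℕ) {N : ℕ} (h : ∀ p, c p < N) (v : ℕ) :
    ∑ i ∈ Finset.range N, kap c w i v = cont w v := by
  unfold cont kap
  rw [Finset.card_eq_sum_card_fiberwise (t := Finset.range N) (f := c) (fun p _ => by simpa using h p)]
  apply Finset.sum_congr rfl
  intro i _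
  rw [Finset.filter_filter]
  congr 1
  ext p; simp [and_comm]

lemma kap_mem (c w : Fin n → ℕ) {p q : ℕ} (hc : ∀ x, c x < p) (hw : ∀ x, w x < q) :
    kap c w ∈ MS p q (cont c) (cont w) := by
  refine ⟨?_, fun i _ => kap_row c w hw i, fun j _ => kap_col c w hc j⟩
  intro i j h
  obtain ⟨x, hx⟩ := Finset.card_ne_zero.1 h
  rw [Finset.mem_filter] at hx
  exact ⟨hx.2.1 ▸ hc x, hx.2.2 ▸ hw x⟩

lemma kap_exists (c : Fin n → ℕ) {p q : ℕ} (hc : ∀ x, c x < p) (e : ℕ → ℕ) (m : ℕ → ℕ → ℕ)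
    (hm : m ∈ MS p q (cont c) e) : ∃ w : Fin n → ℕ, (∀ x, w x < q) ∧ kap c w = m := by
  have heq : ∀ i : ℕ, Nonempty ({x : Fin n // c x = i} ≃ (Σ j : Fin q, Fin (m i j))) := by
    intro i
    apply Fintype.card_eq.1
    rw [Fintype.card_sigma, Fintype.card_subtype]
    simp only [Fintype.card_fin]
    by_cases hi : i < p
    · have := hm.2.1 i hi
      rw [Finset.sum_range] at this
      rw [this]; rfl
    · rw [Finset.card_eq_zero.2, Finset.sum_eq_zero]
      · intro j _
        by_contra h
        exact hi (hm.1 i j h).1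
      · rw [Finset.filter_eq_empty_iff]
        intro x _ hx; exact hi (hx ▸ hc x)
  let E : ∀ i : ℕ, {x : Fin n // c x = i} ≃ (Σ j : Fin q, Fin (m i j)) := fun i => (heq i).some
  refine ⟨fun x => ((E (c x) ⟨x, rfl⟩).1 : ℕ), fun x => (E (c x) ⟨x, rfl⟩).1.2, ?_⟩
  funext i j
  have hw : ∀ (i : ℕ) (y : {x : Fin n // c x = i}), (E (c y) ⟨y, rfl⟩).1 = (E i y).1 := by
    rintro i ⟨y, rfl⟩; rfl
  unfold kap
  by_cases hj : j < q
  · have : ((Finset.univ : Finset (Fin (m i j))).card) = m i j := by simp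
    rw [← this]
    symm
    apply Finset.card_bij (fun t _ => ((E i).symm ⟨⟨j, hj⟩, t⟩ : Fin n))
    · intro t _
      rw [Finset.mem_filter]
      refine ⟨Finset.mem_univ _, ((E i).symm ⟨⟨j, hj⟩, t⟩).2, ?_⟩
      have h0 := hw i ((E i).symm ⟨⟨j, hj⟩, t⟩)
      rw [Equiv.apply_symm_apply] at h0
      exact congrArg Fin.val h0
    · intro t _ t' _ h
      have := (E i).symm.injective (Subtype.ext h)
      simpa using this
    · intro x hx
      rw [Finset.mem_filter] at hx
      obtain ⟨_, h1, h2⟩ := hx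
      have h3 := hw i ⟨x, h1⟩
      have h4 : (E i ⟨x, h1⟩).1 = ⟨j, hj⟩ := by
        rw [← h3]; exact Fin.ext h2
      rcases hE : E i ⟨x, h1⟩ with ⟨a, b⟩
      rw [hE] at h4
      dsimp only at h4
      subst h4
      refine ⟨b, Finset.mem_univ _, ?_⟩
      rw [← hE]; simp
  · have : m i j = 0 := by
      by_contra h; exact hj (hm.1 i j h).2
    rw [this, Finset.card_eq_zero, Finset.filter_eq_empty_iff]
    rintro x _ ⟨h1, h2⟩
    apply hj
    rw [← h2]
    exact (E (c x) ⟨x, rfl⟩).1.2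

lemma cont_of_kap (c w : Fin n → ℕ) {p q : ℕ} (hc : ∀ x, c x < p) (hw : ∀ x, w x < q) (e : ℕ → ℕ)
    (he : ∀ v, q ≤ v → e v = 0) (f : ℕ → ℕ) (h : kap c w ∈ MS p q f e) : cont w = e := by
  funext v
  by_cases hv : v < q
  · rw [← h.2.2 v hv, kap_col c w hc v]
  · rw [he v (by omega), cont_eq_zero w hw (by omega)]

lemma kap_swap (c w : Fin n → ℕ) (s : Equiv.Perm (Fin n)) (h : ∀ p, c (s p) = c p) : kap c (w ∘ s) = kap c w := by
  funext i v
  unfold kap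
  refine Finset.card_bij' (fun p _ => s p) (fun p _ => s.symm p) ?_ ?_ ?_ ?_
  · intro p hp; simpa [h] using hp
  · intro p hp
    have := h (s.symm p)
    simp at this
    simpa [← this] using hp
  · simp
  · simp

lemma swap_lemma (x i : Fin n) (hi : i ≠ x) (w : Fin n → ℕ) (hw : w i < w (i + 1)) :
    ∑ p, pos x p * (w ∘ Equiv.swap i (i+1)) p < ∑ p, pos x p * w p := by
  have hne : i ≠ i + 1 := by intro h; rw [← h] at hw; omega
  have hp := pos_succ x i hi
  have e1 : ∀ g : Fin n → ℕ, ∑ p, g p = g i + g (i+1) + ∑ p ∈ (Finset.univ.erase i).erase (i+1), g p := by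
    intro g
    rw [add_assoc, Finset.add_sum_erase _ _ (by simp [hne.symm]), Finset.add_sum_erase _ _ (by simp)]
  rw [e1 (fun p => pos x p * (w ∘ Equiv.swap i (i+1)) p), e1 (fun p => pos x p * w p)]
  have e2 : ∑ p ∈ (Finset.univ.erase i).erase (i+1), pos x p * (w ∘ Equiv.swap i (i+1)) p =
      ∑ p ∈ (Finset.univ.erase i).erase (i+1), pos x p * w p := by
    apply Finset.sum_congr rfl
    intro p hp
    simp at hp
    simp [Equiv.swap_apply_of_ne_of_ne hp.2 hp.1]
  rw [e2]
  simp only [Function.comp, Equiv.swap_apply_left, Equiv.swap_apply_right, hp]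
  nlinarith

lemma cB_swap (x : Fin n) (B : Finset (Fin n)) (hx : x ∈ B) (i : Fin n) (hi : i ∉ B) (p : Fin n) :
    cB x B (Equiv.swap i (i+1) p) = cB x B p := by
  have := cB_succ_notMem x B i hx hi
  by_cases h1 : p = i
  · subst h1; simp [this]
  · by_cases h2 : p = i + 1
    · subst h2; simp [this]
    · rw [Equiv.swap_apply_of_ne_of_ne h1 h2]

lemma canon_exists (x : Fin n) (B : Finset (Fin n)) (hx : x ∈ B) (q : ℕ) : ∀ (t : ℕ) (w : Fin n → ℕ),
    ∑ p, pos x p * w p = t → (∀ p, w p < q) → ∃ w' : Fin n → ℕ, (∀ p, w' p < q) ∧ kap (cB x B) w' = kap (cB x B) w ∧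
      cAsc w' ⊆ B := by
  intro t
  induction t using Nat.strong_induction_on with
  | _ t ih =>
    intro w hw hq
    by_cases h : cAsc w ⊆ B
    · exact ⟨w, hq, rfl, h⟩
    · obtain ⟨i, hi, hiB⟩ := Finset.not_subset.1 h
      have hix : i ≠ x := by rintro rfl; exact hiB hx
      have hi' : w i < w (i+1) := by simpa [cAsc] using hi
      have hlt := swap_lemma x i hix w hi'
      obtain ⟨w', h1, h2, h3⟩ := ih _ (hw ▸ hlt) (w ∘ Equiv.swap i (i+1)) rfl (fun p => hq _)
      refine ⟨w', h1, ?_, h3⟩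
      rw [h2]
      exact kap_swap _ _ _ (cB_swap x B hx i hiB)

lemma canon_anti (x : Fin n) (B : Finset (Fin n)) (w : Fin n → ℕ) (hw : cAsc w ⊆ B) (q : Fin n) :
    ∀ (d : ℕ) (p : Fin n), pos x q = pos x p + d → cB x B p = cB x B q → w q ≤ w p := by
  intro d
  induction d with
  | zero => intro p h _; rw [pos_inj x h]
  | succ d ih =>
    intro p h hc
    have hpx : p ≠ x := by
      rintro rfl
      rw [pos_self] at h
      have := pos_lt p q
      omega
    have hps := pos_succ x p hpx
    have h1 : cB x B p ≤ cB x B (p+1) := cB_mono x B (by omega)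
    have h2 : cB x B (p+1) ≤ cB x B q := cB_mono x B (by omega)
    have hpB : p ∉ B := by
      intro hp; have := cB_succ_mem x B p hp hpx; omega
    have := ih (p+1) (by omega) (by omega)
    have hn : p ∉ cAsc w := fun h' => hpB (hw h')
    simp [cAsc] at hn
    omega

lemma downset_eq (x : Fin n) (A A' : Finset (Fin n)) (hA : ∀ p ∈ A, ∀ q, pos x q ≤ pos x p → q ∈ A)
    (hA' : ∀ p ∈ A', ∀ q, pos x q ≤ pos x p → q ∈ A') (h : A.card = A'.card) : A = A' := by
  have key : ∀ A A' : Finset (Fin n), (∀ p ∈ A, ∀ q, pos x q ≤ pos x p → q ∈ A) →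
      (∀ p ∈ A', ∀ q, pos x q ≤ pos x p → q ∈ A') → A.card = A'.card → A ⊆ A' := by
    intro A A' hA hA' h p hp
    by_contra hp'
    have : A' ⊂ A := by
      rw [Finset.ssubset_iff_of_subset]
      · exact ⟨p, hp, hp'⟩
      · intro q hq
        by_contra hq'
        rcases le_total (pos x p) (pos x q) with h' | h'
        · exact hp' (hA' q hq p h')
        · exact hq' (hA p hp q h')
    have := Finset.card_lt_card this
    omega
  exact Finset.Subset.antisymm (key _ _ hA hA' h) (key _ _ hA' hA h.symm)

lemma canon_unique (x : Fin n) (B : Finset (Fin n)) (w w' : Fin n → ℕ) (hw : cAsc w ⊆ B) (hw' : cAsc w' ⊆ B)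
    {N : ℕ} (h1 : ∀ p, w p < N) (h2 : ∀ p, w' p < N) (h : kap (cB x B) w = kap (cB x B) w') : w = w' := by
  have hdown : ∀ (w : Fin n → ℕ), cAsc w ⊆ B → ∀ i v : ℕ,
      ∀ p ∈ (Finset.univ.filter (fun q => cB x B q < i ∨ (cB x B q = i ∧ v ≤ w q))), ∀ q, pos x q ≤ pos x p →
      q ∈ (Finset.univ.filter (fun q => cB x B q < i ∨ (cB x B q = i ∧ v ≤ w q))) := by
    intro w hw i v p hp q hq
    simp only [Finset.mem_filter, Finset.mem_univ, true_and] at hp ⊢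
    have hc := cB_mono x B hq
    by_cases hci : cB x B q < i
    · exact Or.inl hci
    · right
      have hpi : cB x B p = i ∧ v ≤ w p := by
        rcases hp with hp | hp
        · omega
        · exact hp
      refine ⟨by omega, ?_⟩
      have := canon_anti x B w hw p (pos x p - pos x q) q (by omega) (by omega)
      omega
  have hcard : ∀ (w : Fin n → ℕ), (∀ p, w p < N) → ∀ i v : ℕ,
      (Finset.univ.filter (fun q => cB x B q < i ∨ (cB x B q = i ∧ v ≤ w q))).card =
      (Finset.univ.filter (fun q => cB x B q < i)).card + ∑ v' ∈ Finset.Ico v N, kap (cB x B) w i v' := by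
    intro w hN i v
    rw [Finset.filter_or, Finset.card_union_of_disjoint]
    · congr 1
      rw [Finset.card_eq_sum_card_fiberwise (t := Finset.Ico v N) (f := w)]
      · apply Finset.sum_congr rfl
        intro v' hv'
        unfold kap
        rw [Finset.filter_filter]
        congr 1
        apply Finset.filter_congr
        intro p _
        rw [Finset.mem_Ico] at hv'
        constructor
        · rintro ⟨⟨a, b⟩, c⟩; exact ⟨a, c⟩
        · rintro ⟨a, c⟩; exact ⟨⟨a, by omega⟩, c⟩
      · intro p hp
        simp at hp ⊢
        exact ⟨hp.2, hN p⟩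
    · rw [Finset.disjoint_left]
      intro q hq hq'
      simp at hq hq'
      omega
  have hset : ∀ i v : ℕ, (Finset.univ.filter (fun q => cB x B q < i ∨ (cB x B q = i ∧ v ≤ w q))) =
      (Finset.univ.filter (fun q => cB x B q < i ∨ (cB x B q = i ∧ v ≤ w' q))) := by
    intro i v
    apply downset_eq x _ _ (hdown w hw i v) (hdown w' hw' i v)
    rw [hcard w h1, hcard w' h2, h]
  funext p
  have key : ∀ v, v ≤ w p ↔ v ≤ w' p := by
    intro v
    have := hset (cB x B p) v
    rw [Finset.ext_iff] at this
    simpa using this p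
  exact le_antisymm ((key _).1 le_rfl) ((key _).2 le_rfl)

/-- words with letters `< N` and content `e` -/
def Wd (n N : ℕ) (e : ℕ → ℕ) : Finset (Fin n → ℕ) :=
  (Fintype.piFinset (fun _ => Finset.range N)).filter (fun w => cont w = e)

lemma mem_Wd {N : ℕ} {e : ℕ → ℕ} {w : Fin n → ℕ} : w ∈ Wd n N e ↔ (∀ p, w p < N) ∧ cont w = e := by
  simp [Wd]

theorem NB_eq (x : Fin n) (B : Finset (Fin n)) (hx : x ∈ B) (N : ℕ) (e : ℕ → ℕ) (he : ∀ v, N ≤ v → e v = 0) :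
    ((Wd n N e).filter (fun w => cAsc w ⊆ B)).card = MM n N (cont (cB x B)) e := by
  have hcn : ∀ p, cB x B p < n := fun p => lt_of_lt_of_le (cB_lt x B hx p) (by
    simpa using Finset.card_le_univ B)
  rw [MM_eq]
  apply Finset.card_bij (fun w _ => kap (cB x B) w)
  · intro w hw
    rw [Finset.mem_filter, mem_Wd] at hw
    rw [Set.Finite.mem_toFinset, ← hw.1.2]
    exact kap_mem _ _ hcn hw.1.1
  · intro w hw w' hw' h
    rw [Finset.mem_filter, mem_Wd] at hw hw'
    exact canon_unique x B w w' hw.2 hw'.2 hw.1.1 hw'.1.1 h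
  · intro m hm
    rw [Set.Finite.mem_toFinset] at hm
    obtain ⟨w, h1, h2⟩ := kap_exists _ hcn e m hm
    obtain ⟨w', h3, h4, h5⟩ := canon_exists x B hx N _ w rfl h1
    have h6 : kap (cB x B) w' = m := h4.trans h2
    refine ⟨w', ?_, h6⟩
    rw [Finset.mem_filter, mem_Wd]
    exact ⟨⟨h3, cont_of_kap _ w' hcn h3 e he _ (h6 ▸ hm)⟩, h5⟩

/-- number of words with cyclic ascent set exactly `D` -/
def FD (N : ℕ) (D : Finset (Fin n)) (e : ℕ → ℕ) : ℕ := ((Wd n N e).filter (fun w => cAsc w = D)).card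

theorem FD_eq (N : ℕ) (D : Finset (Fin n)) (e : ℕ → ℕ) :
    (FD N D e : ℤ) = ∑ Y ∈ D.powerset, (-1) ^ Y.card * (((Wd n N e).filter (fun w => cAsc w ⊆ D \ Y)).card : ℤ) := by
  unfold FD
  simp only [Finset.card_filter, Nat.cast_sum, Finset.mul_sum]
  rw [Finset.sum_comm]
  apply Finset.sum_congr rfl
  intro w _
  by_cases hA : cAsc w ⊆ D
  · have : ∀ Y ∈ D.powerset, (-1 : ℤ) ^ Y.card * ((if cAsc w ⊆ D \ Y then 1 else 0 : ℕ) : ℤ) =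
        if Y ∈ (D \ cAsc w).powerset then (-1) ^ Y.card else 0 := by
      intro Y hY
      rw [Finset.mem_powerset] at hY
      have : cAsc w ⊆ D \ Y ↔ Y ∈ (D \ cAsc w).powerset := by
        rw [Finset.mem_powerset, Finset.subset_sdiff, Finset.subset_sdiff, disjoint_comm]
        exact ⟨fun h => ⟨hY, h.2⟩, fun h => ⟨hA, h.2⟩⟩
      rw [if_congr this rfl rfl]
      split_ifs <;> simp
    rw [Finset.sum_congr rfl this, ← Finset.sum_filter]
    have h2 : D.powerset.filter (fun Y => Y ∈ (D \ cAsc w).powerset) = (D \ cAsc w).powerset := by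
      ext Y
      simp only [Finset.mem_filter, Finset.mem_powerset]
      exact ⟨fun h => h.2, fun h => ⟨h.trans Finset.sdiff_subset, h⟩⟩
    rw [h2, Finset.sum_powerset_neg_one_pow_card]
    have h3 : cAsc w = D ↔ D \ cAsc w = ∅ := by
      rw [Finset.sdiff_eq_empty_iff_subset]
      exact ⟨fun h => by rw [h], fun h => Finset.Subset.antisymm hA h⟩
    rw [if_congr h3 rfl rfl]
    split_ifs <;> simp
  · rw [if_neg (fun h => hA (by rw [h]))]
    symm
    rw [Nat.cast_zero]
    apply Finset.sum_eq_zero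
    intro Y _
    rw [if_neg (fun h => hA (h.trans Finset.sdiff_subset))]
    simp

end Words
end CR

namespace CR

section Dist
variable {n : ℕ} [NeZero n]

/-- word of a permutation -/
def wd (w : Equiv.Perm (Fin n)) : Fin n → ℕ := fun p => (w p).val

/-- cyclic adjacent transposition -/
def ss (i : Fin n) : Equiv.Perm (Fin n) := Equiv.swap i (i + 1)

lemma wd_mul (w s : Equiv.Perm (Fin n)) : wd (w * s) = wd w ∘ s := rfl

lemma wd_inj {w w' : Equiv.Perm (Fin n)} (h : wd w = wd w') : w = w' := by
  ext p
  exact congrFun h p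

/-- potential -/
def ph (x : Fin n) (w : Equiv.Perm (Fin n)) : ℕ := ∑ p, pos x p * wd w p

lemma canon_perm {X : Type} (F : Equiv.Perm (Fin n) → X) (x : Fin n) (B : Finset (Fin n)) (hx : x ∈ B)
    (hF : ∀ i, i ∉ B → ∀ w, F (w * ss i) = F w) : ∀ (t : ℕ) (w : Equiv.Perm (Fin n)), ph x w = t →
    ∃ w', (w' = w ∨ ph x w' < ph x w) ∧ kap (cB x B) (wd w') = kap (cB x B) (wd w) ∧ cAsc (wd w') ⊆ B ∧
      F w' = F w := by
  intro t
  induction t using Nat.strong_induction_on with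
  | _ t ih =>
    intro w hw
    by_cases h : cAsc (wd w) ⊆ B
    · exact ⟨w, Or.inl rfl, rfl, h, rfl⟩
    · obtain ⟨i, hi, hiB⟩ := Finset.not_subset.1 h
      have hix : i ≠ x := by rintro rfl; exact hiB hx
      have hi' : wd w i < wd w (i+1) := by simpa [cAsc] using hi
      have hlt : ph x (w * ss i) < ph x w := swap_lemma x i hix (wd w) hi'
      obtain ⟨w', h1, h2, h3, h4⟩ := ih _ (hw ▸ hlt) (w * ss i) rfl
      refine ⟨w', Or.inr ?_, ?_, h3, ?_⟩
      · rcases h1 with rfl | h1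
        · exact hlt
        · exact h1.trans hlt
      · rw [h2, wd_mul]
        exact kap_swap _ _ _ (cB_swap x B hx i hiB)
      · rw [h4, hF i hiB]

lemma wd_lt (w : Equiv.Perm (Fin n)) (p : Fin n) : wd w p < n := (w p).2

lemma inv_const {X : Type} (F : Equiv.Perm (Fin n) → X) (x : Fin n) (B : Finset (Fin n)) (hx : x ∈ B)
    (hF : ∀ i, i ∉ B → ∀ w, F (w * ss i) = F w) (w w' : Equiv.Perm (Fin n))
    (h : kap (cB x B) (wd w) = kap (cB x B) (wd w')) : F w = F w' := by
  obtain ⟨u, _, h2, h3, h4⟩ := canon_perm F x B hx hF _ w rfl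
  obtain ⟨u', _, h2', h3', h4'⟩ := canon_perm F x B hx hF _ w' rfl
  have : u = u' := wd_inj (canon_unique x B _ _ h3 h3' (wd_lt u) (wd_lt u') (by rw [h2, h2', h]))
  rw [← h4, ← h4', this]

/-- the regular arrangement -/
def HO (i : Fin n) : Submodule ℂ (Equiv.Perm (Fin n) → ℂ) where
  carrier := {f | ∀ w, f (w * ss i) = f w}
  add_mem' := by intro a b ha hb w; simp [ha w, hb w]
  zero_mem' := by intro w; simp
  smul_mem' := by intro c a ha w; simp [ha w]

lemma mem_HO (i : Fin n) (f : Equiv.Perm (Fin n) → ℂ) : f ∈ HO i ↔ ∀ w, f (w * ss i) = f w := Iff.rfl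

/-- basis functions -/
def bO (x : Fin n) (w w' : Equiv.Perm (Fin n)) : ℂ :=
  if kap (cB x (insert x (cAsc (wd w)))) (wd w') = kap (cB x (insert x (cAsc (wd w)))) (wd w) then 1 else 0

lemma bO_self (x : Fin n) (w : Equiv.Perm (Fin n)) : bO x w w = 1 := by simp [bO]

lemma bO_tri (x : Fin n) (w w' : Equiv.Perm (Fin n)) (h : bO x w w' ≠ 0) : w' = w ∨ ph x w < ph x w' := by
  have h' : kap (cB x (insert x (cAsc (wd w)))) (wd w') = kap (cB x (insert x (cAsc (wd w)))) (wd w) := by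
    by_contra h'
    exact h (if_neg h')
  obtain ⟨u, h1, h2, h3, _⟩ := canon_perm (fun _ => ()) x (insert x (cAsc (wd w))) (by simp) (by simp) _ w' rfl
  have : u = w := wd_inj (canon_unique x (insert x (cAsc (wd w))) _ _ h3 (by simp) (wd_lt u) (wd_lt w) (by rw [h2, h']))
  subst this
  rcases h1 with h1 | h1
  · exact Or.inl h1.symm
  · exact Or.inr h1

lemma bO_mem (x : Fin n) (A : Finset (Fin n)) (hx : x ∈ A) (w : Equiv.Perm (Fin n)) (hw : cAsc (wd w) ⊆ A) :
    bO x w ∈ VB HO A := by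
  rw [mem_VB]
  intro i hi
  rw [mem_HO]
  intro u
  unfold bO
  rw [wd_mul, kap_swap (cB x (insert x (cAsc (wd w)))) (wd u) (ss i)]
  apply cB_swap
  · simp
  · rw [Finset.mem_insert]
    rintro (rfl | h)
    · exact hi hx
    · exact hi (hw h)

/-- a combination of `bO` with all coefficients at smaller potential zero -/
lemma comb_eval (x : Fin n) (a : Equiv.Perm (Fin n) → ℂ) (w : Equiv.Perm (Fin n))
    (h : ∀ u, ph x u < ph x w → a u = 0) : (∑ u, a u • bO x u) w = a w := by
  rw [Finset.sum_apply, Finset.sum_eq_single w]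
  · simp [bO_self]
  · intro u _ hu
    by_cases h0 : bO x u w = 0
    · simp [h0]
    · rcases bO_tri x u w h0 with h1 | h1
      · exact absurd h1.symm hu
      · simp [h u h1]
  · simp

lemma exists_min (x : Fin n) (a : Equiv.Perm (Fin n) → ℂ) (h : ∃ w, a w ≠ 0) :
    ∃ w, a w ≠ 0 ∧ ∀ u, ph x u < ph x w → a u = 0 := by
  obtain ⟨w, hw, hm⟩ := Finset.exists_min_image (Finset.univ.filter (fun w => a w ≠ 0)) (ph x)
    (by obtain ⟨w, hw⟩ := h; exact ⟨w, by simpa using hw⟩)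
  refine ⟨w, by simpa using hw, fun u hu => ?_⟩
  by_contra h0
  have := hm u (by simpa using h0)
  omega

lemma bO_indep (x : Fin n) : LinearIndependent ℂ (bO x) := by
  rw [Fintype.linearIndependent_iff]
  intro a ha
  by_contra h
  push Not at h
  obtain ⟨w, hw, hm⟩ := exists_min x a h
  have := comb_eval x a w hm
  rw [ha] at this
  exact hw this.symm

/-- the basis -/
def basO (x : Fin n) : Module.Basis (Equiv.Perm (Fin n)) ℂ (Equiv.Perm (Fin n) → ℂ) :=
  basisOfLinearIndependentOfCardEqFinrank (bO_indep x) (by simp)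

lemma basO_apply (x : Fin n) (w : Equiv.Perm (Fin n)) : basO x w = bO x w := by simp [basO]

lemma VB_span (x : Fin n) (A : Finset (Fin n)) (hx : x ∈ A) :
    VB HO A = Submodule.span ℂ (basO x '' {w | cAsc (wd w) ⊆ A}) := by
  apply le_antisymm
  · intro f hf
    rw [Module.Basis.mem_span_image]
    by_contra hcon
    obtain ⟨w0, hw0, hw0'⟩ := Set.not_subset.1 hcon
    let a : Equiv.Perm (Fin n) → ℂ := fun w => if cAsc (wd w) ⊆ A then 0 else (basO x).repr f w
    have ha : ∑ u, a u • bO x u ∈ VB HO A := by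
      have e : ∑ u, a u • bO x u = f - ∑ u, (if cAsc (wd u) ⊆ A then (basO x).repr f u else 0) • bO x u := by
        rw [eq_sub_iff_add_eq, ← Finset.sum_add_distrib]
        conv_rhs => rw [← (basO x).sum_repr f]
        apply Finset.sum_congr rfl
        intro u _
        rw [basO_apply, ← add_smul]
        congr 1
        simp only [a]
        split_ifs <;> simp
      rw [e]
      apply Submodule.sub_mem _ hf
      apply Submodule.sum_mem
      intro u _
      split_ifs with h
      · exact Submodule.smul_mem _ _ (bO_mem x A hx u h)
      · simp
    obtain ⟨w, hw, hm⟩ := exists_min x a ⟨w0, by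
      simp only [a]
      rw [if_neg (show ¬ cAsc (wd w0) ⊆ A from hw0')]
      simpa using hw0⟩
    have hwA : ¬ cAsc (wd w) ⊆ A := fun h => hw (if_pos h)
    obtain ⟨i, hi, hiA⟩ := Finset.not_subset.1 hwA
    have hix : i ≠ x := by rintro rfl; exact hiA hx
    have hi' : wd w i < wd w (i+1) := by simpa [cAsc] using hi
    have hlt : ph x (w * ss i) < ph x w := swap_lemma x i hix (wd w) hi'
    have e1 := comb_eval x a w hm
    have e2 := comb_eval x a (w * ss i) (fun u hu => hm u (hu.trans hlt))
    have e3 := (mem_HO i _).1 ((mem_VB _ _ _).1 ha i hiA) w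
    rw [e1, e2, hm _ hlt] at e3
    exact hw e3.symm
  · rw [Submodule.span_le]
    rintro _ ⟨w, hw, rfl⟩
    rw [basO_apply]
    exact bO_mem x A hx w hw

theorem distP_HO : DistP (HO : Fin n → Submodule ℂ (Equiv.Perm (Fin n) → ℂ)) := by
  rintro E G g hg hgG hGE ⟨x, hxE, hxg, hxG⟩
  have e1 : ∀ i ∈ G, VB HO (E.erase i) = Submodule.span ℂ (basO x '' {w | cAsc (wd w) ⊆ E.erase i}) := by
    intro i hi
    exact VB_span x _ (by simp [hxE]; rintro rfl; exact hxG hi)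
  have e2 : ∀ i ∈ G, VB HO ((E.erase g).erase i) =
      Submodule.span ℂ (basO x '' {w | cAsc (wd w) ⊆ (E.erase g).erase i}) := by
    intro i hi
    exact VB_span x _ (by simp [hxE, hxg]; rintro rfl; exact hxG hi)
  rw [VB_span x (E.erase g) (by simp [hxE, hxg]), biSup_congr e1, biSup_congr e2, ← Submodule.span_iUnion₂,
    ← Submodule.span_iUnion₂, ← Set.image_iUnion₂, ← Set.image_iUnion₂]
  rintro f ⟨h1, h2⟩
  rw [SetLike.mem_coe, Module.Basis.mem_span_image] at h1 h2
  rw [Module.Basis.mem_span_image]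
  intro w hw
  have a1 := h1 hw
  have a2 := h2 hw
  simp only [Set.mem_iUnion] at a1 ⊢
  obtain ⟨i, hi, hA⟩ := a1
  refine ⟨i, hi, ?_⟩
  intro j hj
  have := hA hj
  have := a2 hj
  simp at *
  tauto

lemma distP_transfer {V W : Type} [AddCommGroup V] [Module ℂ V] [AddCommGroup W] [Module ℂ W]
    (H : Fin n → Submodule ℂ V) (H' : Fin n → Submodule ℂ W) (j : V →ₗ[ℂ] W) (p : W →ₗ[ℂ] V)
    (hpj : ∀ v, p (j v) = v) (hj : ∀ i, ∀ v ∈ H i, j v ∈ H' i) (hp : ∀ i, ∀ v ∈ H' i, p v ∈ H i)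
    (h : DistP H') : DistP H := by
  have hjV : ∀ A, VB H A ≤ (VB H' A).comap j := by
    intro A v hv
    rw [Submodule.mem_comap, mem_VB]
    exact fun i hi => hj i v ((mem_VB _ _ _).1 hv i hi)
  have hpV : ∀ A, VB H' A ≤ (VB H A).comap p := by
    intro A v hv
    rw [Submodule.mem_comap, mem_VB]
    exact fun i hi => hp i v ((mem_VB _ _ _).1 hv i hi)
  intro E G g hg hgG hGE hx v hv
  have h1 : (⨆ i ∈ G, VB H (E.erase i)) ≤ (⨆ i ∈ G, VB H' (E.erase i)).comap j := by
    apply iSup₂_le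
    intro i hi
    exact (hjV _).trans (Submodule.comap_mono (le_iSup₂ (f := fun i (_ : i ∈ G) => VB H' (E.erase i)) i hi))
  have h2 : (⨆ i ∈ G, VB H' ((E.erase g).erase i)) ≤ (⨆ i ∈ G, VB H ((E.erase g).erase i)).comap p := by
    apply iSup₂_le
    intro i hi
    exact (hpV _).trans (Submodule.comap_mono (le_iSup₂ (f := fun i (_ : i ∈ G) => VB H ((E.erase g).erase i)) i hi))
  have h3 := h2 (h E G g hg hgG hGE hx ⟨h1 hv.1, hjV _ hv.2⟩)
  rw [Submodule.mem_comap, hpj] at h3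
  exact h3

end Dist
end CR

namespace CR

set_option linter.unusedSectionVars false
section Rep
variable {n : ℕ} [NeZero n]

/-- the group algebra of the symmetric group -/
abbrev RR (n : ℕ) := MonoidAlgebra ℂ (Equiv.Perm (Fin n))

/-- group elements in the group algebra -/
def gg (g : Equiv.Perm (Fin n)) : RR n := MonoidAlgebra.single g 1

lemma gg_mul (g h : Equiv.Perm (Fin n)) : gg (g * h) = gg g * gg h := by
  simp [gg, MonoidAlgebra.single_mul_single]

lemma gg_one : (gg 1 : RR n) = 1 := rfl

/-- coefficients -/
def cfE : RR n ≃ₗ[ℂ] (Equiv.Perm (Fin n) → ℂ) where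
  toFun x g := x.coeff g
  invFun f := MonoidAlgebra.ofCoeff (Finsupp.equivFunOnFinite.symm f)
  map_add' x y := by funext g; simp
  map_smul' c x := by funext g; simp
  left_inv x := by ext g; simp
  right_inv f := by funext g; simp

lemma gg_coeff (g : Equiv.Perm (Fin n)) (x : RR n) (h : Equiv.Perm (Fin n)) :
    cfE (gg g * x) h = cfE x (g⁻¹ * h) := by
  simp [cfE, gg, MonoidAlgebra.coeff_single_mul_apply]

lemma coeff_gg (g : Equiv.Perm (Fin n)) (x : RR n) (h : Equiv.Perm (Fin n)) :
    cfE (x * gg g) h = cfE x (h * g⁻¹) := by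
  simp [cfE, gg, MonoidAlgebra.coeff_mul_single_apply]

lemma cfE_ext {x y : RR n} (h : ∀ g, cfE x g = cfE y g) : x = y := cfE.injective (funext h)

lemma cfE_gg (g h : Equiv.Perm (Fin n)) : cfE (gg g) h = if g = h then 1 else 0 := by
  simp [cfE, gg, Finsupp.single_apply]

lemma eq_sum_gg (x : RR n) : x = ∑ g, cfE x g • gg g := by
  apply cfE_ext
  intro h
  rw [map_sum, Finset.sum_apply]
  simp [cfE_gg]

variable {m : ℕ} {d : Fin m → ℕ} [∀ i, NeZero (d i)]
  (e : RR n ≃ₐ[ℂ] ((i : Fin m) → Matrix (Fin (d i)) (Fin (d i)) ℂ))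

/-- the matrices of the group elements -/
def act (s : Fin m) (g : Equiv.Perm (Fin n)) : Matrix (Fin (d s)) (Fin (d s)) ℂ := e (gg g) s

lemma act_mul (s : Fin m) (g h : Equiv.Perm (Fin n)) : act e s (g * h) = act e s g * act e s h := by
  simp [act, gg_mul]

lemma act_one (s : Fin m) : act e s 1 = 1 := by
  simp [act, gg_one]

lemma act_act (s : Fin m) (g h : Equiv.Perm (Fin n)) (v : Fin (d s) → ℂ) :
    (act e s g).mulVec ((act e s h).mulVec v) = (act e s (g * h)).mulVec v := by
  rw [Matrix.mulVec_mulVec, act_mul]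

/-- reflection fixed spaces -/
def Hs (s : Fin m) (i : Fin n) : Submodule ℂ (Fin (d s) → ℂ) where
  carrier := {v | (act e s (ss i)).mulVec v = v}
  add_mem' := by intro a b ha hb; simp only [Set.mem_setOf_eq] at *; rw [Matrix.mulVec_add, ha, hb]
  zero_mem' := by simp
  smul_mem' := by intro c a ha; simp only [Set.mem_setOf_eq] at *; rw [Matrix.mulVec_smul, ha]

lemma mem_Hs (s : Fin m) (i : Fin n) (v) : v ∈ Hs e s i ↔ (act e s (ss i)).mulVec v = v := Iff.rfl

/-- Young subgroup invariants -/
def Inv (s : Fin m) (c : Fin n → ℕ) : Submodule ℂ (Fin (d s) → ℂ) where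
  carrier := {v | ∀ g : Equiv.Perm (Fin n), (∀ p, c (g p) = c p) → (act e s g).mulVec v = v}
  add_mem' := by intro a b ha hb g hg; rw [Matrix.mulVec_add, ha g hg, hb g hg]
  zero_mem' := by intro g hg; simp
  smul_mem' := by intro c a ha g hg; rw [Matrix.mulVec_smul, ha g hg]

lemma mem_Inv (s : Fin m) (c : Fin n → ℕ) (v) : v ∈ Inv e s c ↔
  ∀ g : Equiv.Perm (Fin n), (∀ p, c (g p) = c p) → (act e s g).mulVec v = v := Iff.rfl

lemma VB_eq_Inv (s : Fin m) (x : Fin n) (B : Finset (Fin n)) (hx : x ∈ B) :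
    VB (Hs e s) B = Inv e s (cB x B) := by
  ext v
  rw [mem_VB, mem_Inv]
  constructor
  · intro h g hg
    have := inv_const (fun w => (act e s w).mulVec v) x B hx (by
      intro i hi w
      rw [← act_act, (mem_Hs e s i v).1 (h i hi)]) g 1 (by
        have := kap_swap (cB x B) (wd 1) g hg
        rw [← wd_mul, one_mul] at this
        exact this)
    rw [this, act_one, Matrix.one_mulVec]
  · intro h i hi
    rw [mem_Hs]
    exact h (ss i) (cB_swap x B hx i hi)

lemma ss_inv (i : Fin n) : (ss i)⁻¹ = ss i := by simp [ss]

/-- matrices with one nonzero column -/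
def colM {D : ℕ} [NeZero D] (v : Fin D → ℂ) : Matrix (Fin D) (Fin D) ℂ := Matrix.of fun r c => if c = 0 then v r else 0

lemma colM_add {D : ℕ} [NeZero D] (v w : Fin D → ℂ) : colM (v + w) = colM v + colM w := by
  ext r c
  simp only [colM, Matrix.of_apply, Matrix.add_apply, Pi.add_apply]
  split_ifs <;> simp

lemma colM_smul {D : ℕ} [NeZero D] (a : ℂ) (v : Fin D → ℂ) : colM (a • v) = a • colM v := by
  ext r c
  simp only [colM, Matrix.of_apply, Matrix.smul_apply, Pi.smul_apply]
  split_ifs <;> simp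

/-- embedding of column vectors -/
def jcol (s : Fin m) : (Fin (d s) → ℂ) →ₗ[ℂ] (Equiv.Perm (Fin n) → ℂ) where
  toFun v := fun w => cfE (e.symm (Pi.single s (colM v))) w⁻¹
  map_add' a b := by
    funext w
    rw [colM_add, Pi.single_add, map_add, map_add]
    rfl
  map_smul' a b := by
    funext w
    rw [colM_smul, Pi.single_smul, map_smul, map_smul]
    rfl

/-- inversion of the argument -/
def ivE : (Equiv.Perm (Fin n) → ℂ) →ₗ[ℂ] RR n :=
  cfE.symm.toLinearMap ∘ₗ (LinearMap.funLeft ℂ ℂ (fun g : Equiv.Perm (Fin n) => g⁻¹))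

lemma cfE_ivE (f : Equiv.Perm (Fin n) → ℂ) (g) : cfE (ivE f) g = f g⁻¹ := by
  simp [ivE, LinearMap.funLeft]

/-- projection to the column -/
def pcol (s : Fin m) : (Equiv.Perm (Fin n) → ℂ) →ₗ[ℂ] (Fin (d s) → ℂ) where
  toFun f := fun r => e (ivE f) s r 0
  map_add' a b := by funext r; simp
  map_smul' a b := by funext r; simp

theorem distP_Hs (s : Fin m) : DistP (Hs e s) := by
  refine distP_transfer (Hs e s) HO (jcol e s) (pcol e s) ?_ ?_ ?_ distP_HO
  · intro v
    have : ivE (jcol e s v) = e.symm (Pi.single s (colM v)) := by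
      apply cfE_ext
      intro g
      rw [cfE_ivE]
      simp [jcol]
    funext r
    simp [pcol, this, colM]
  · intro i v hv
    rw [mem_Hs] at hv
    rw [mem_HO]
    intro w
    have h1 : gg (ss i) * e.symm (Pi.single s (colM v)) =
        e.symm (Pi.single s (colM v)) := by
      apply e.injective
      rw [map_mul, e.apply_symm_apply]
      funext t
      by_cases ht : t = s
      · subst ht
        rw [Pi.mul_apply, Pi.single_eq_same]
        ext r c
        have := congrFun hv r
        simp only [Matrix.mulVec, dotProduct, act] at this
        rw [Matrix.mul_apply]
        simp only [colM, Matrix.of_apply]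
        split_ifs with hc
        · exact this
        · simp
      · rw [Pi.mul_apply, Pi.single_eq_of_ne ht, mul_zero]
    simp only [jcol, LinearMap.coe_mk, AddHom.coe_mk]
    conv_rhs => rw [← h1]
    rw [gg_coeff, mul_inv_rev]
  · intro i f hf
    rw [mem_HO] at hf
    rw [mem_Hs]
    have h1 : gg (ss i) * ivE f = ivE f := by
      apply cfE_ext
      intro g
      rw [gg_coeff, cfE_ivE, cfE_ivE, mul_inv_rev, inv_inv, hf]
    funext r
    have h2 := congrFun (congrFun (congrFun (congrArg e h1) s) r) 0
    rw [map_mul, Pi.mul_apply, Matrix.mul_apply] at h2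
    exact h2

end Rep
end CR

namespace CR

set_option linter.unusedSectionVars false
section Gram
variable {n : ℕ} [NeZero n]

/-- Young subgroups -/
def Stb (c : Fin n → ℕ) : Finset (Equiv.Perm (Fin n)) := Finset.univ.filter (fun g => ∀ p, c (g p) = c p)

lemma mem_Stb {c : Fin n → ℕ} {g} : g ∈ Stb c ↔ ∀ p, c (g p) = c p := by simp [Stb]

lemma Stb_one (c : Fin n → ℕ) : 1 ∈ Stb c := by simp [mem_Stb]

lemma Stb_mul {c : Fin n → ℕ} {g h} (hg : g ∈ Stb c) (hh : h ∈ Stb c) : g * h ∈ Stb c := by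
  rw [mem_Stb] at *
  intro p; rw [Equiv.Perm.mul_apply, hg, hh]

lemma Stb_inv {c : Fin n → ℕ} {g} (hg : g ∈ Stb c) : g⁻¹ ∈ Stb c := by
  rw [mem_Stb] at *
  intro p; rw [← hg (g⁻¹ p)]; simp

lemma Stb_card (c : Fin n → ℕ) : ((Stb c).card : ℂ) ≠ 0 := by
  have : 0 < (Stb c).card := Finset.card_pos.2 ⟨1, Stb_one c⟩
  exact_mod_cast this.ne'

/-- averaging idempotent -/
def eps (c : Fin n → ℕ) : RR n := ((Stb c).card : ℂ)⁻¹ • ∑ g ∈ Stb c, gg g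

lemma gg_eps {c : Fin n → ℕ} {h} (hh : h ∈ Stb c) : gg h * eps c = eps c := by
  unfold eps
  rw [mul_smul_comm, Finset.mul_sum]
  congr 1
  refine Finset.sum_bij' (fun g _ => h * g) (fun g _ => h⁻¹ * g) ?_ ?_ ?_ ?_ ?_
  · intro g hg; exact Stb_mul hh hg
  · intro g hg; exact Stb_mul (Stb_inv hh) hg
  · simp
  · simp
  · intro g _; rw [gg_mul]

lemma eps_gg {c : Fin n → ℕ} {h} (hh : h ∈ Stb c) : eps c * gg h = eps c := by
  unfold eps
  rw [smul_mul_assoc, Finset.sum_mul]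
  congr 1
  refine Finset.sum_bij' (fun g _ => g * h) (fun g _ => g * h⁻¹) ?_ ?_ ?_ ?_ ?_
  · intro g hg; exact Stb_mul hg hh
  · intro g hg; exact Stb_mul hg (Stb_inv hh)
  · simp
  · simp
  · intro g _; rw [gg_mul]

lemma eps_mul_of (c : Fin n → ℕ) (x : RR n) (h : ∀ g ∈ Stb c, gg g * x = x) : eps c * x = x := by
  unfold eps
  rw [smul_mul_assoc, Finset.sum_mul, Finset.sum_congr rfl h, Finset.sum_const, ← Nat.cast_smul_eq_nsmul ℂ, smul_smul,
    inv_mul_cancel₀ (Stb_card c), one_smul]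

lemma mul_eps_of (c : Fin n → ℕ) (x : RR n) (h : ∀ g ∈ Stb c, x * gg g = x) : x * eps c = x := by
  unfold eps
  rw [mul_smul_comm, Finset.mul_sum, Finset.sum_congr rfl h, Finset.sum_const, ← Nat.cast_smul_eq_nsmul ℂ, smul_smul,
    inv_mul_cancel₀ (Stb_card c), one_smul]

variable {m : ℕ} {d : Fin m → ℕ} [∀ i, NeZero (d i)]
  (e : RR n ≃ₐ[ℂ] ((i : Fin m) → Matrix (Fin (d i)) (Fin (d i)) ℂ))

/-- dimension of invariants -/
def rk (s : Fin m) (c : Fin n → ℕ) : ℕ := Module.finrank ℂ (Inv e s c)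

lemma trace_eps (s : Fin m) (c : Fin n → ℕ) : (e (eps c) s).trace = (rk e s c : ℂ) := by
  rw [← Matrix.trace_toLin'_eq]
  apply LinearMap.IsProj.trace
  constructor
  · intro v
    rw [mem_Inv]
    intro g hg
    rw [Matrix.toLin'_apply, Matrix.mulVec_mulVec]
    congr 1
    unfold act
    rw [← Pi.mul_apply, ← map_mul, gg_eps (mem_Stb.2 hg)]
  · intro v hv
    rw [mem_Inv] at hv
    rw [Matrix.toLin'_apply]
    unfold eps
    rw [map_smul, map_sum, Pi.smul_apply, Finset.sum_apply, Matrix.smul_mulVec, Matrix.sum_mulVec,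
      Finset.sum_congr rfl (fun g hg => show (e (gg g) s).mulVec v = v from hv g (mem_Stb.1 hg)), Finset.sum_const, ← Nat.cast_smul_eq_nsmul ℂ, smul_smul,
      inv_mul_cancel₀ (Stb_card c), one_smul]

/-- two-sided multiplication -/
def Lm (x y : RR n) : RR n →ₗ[ℂ] RR n := (LinearMap.mulLeft ℂ x) ∘ₗ (LinearMap.mulRight ℂ y)

lemma Lm_apply (x y z : RR n) : Lm x y z = x * (z * y) := rfl

lemma trace_Lm (x y : RR n) : LinearMap.trace ℂ _ (Lm x y) = ∑ s, (e x s).trace * (e y s).trace := by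
  let b := (Pi.basis (fun s => Matrix.stdBasis ℂ (Fin (d s)) (Fin (d s)))).map e.symm.toLinearEquiv
  rw [LinearMap.trace_eq_matrix_trace ℂ b]
  rw [Matrix.trace, Fintype.sum_sigma]
  apply Finset.sum_congr rfl
  intro s _
  rw [Fintype.sum_prod_type, Matrix.trace, Matrix.trace, Finset.sum_mul_sum]
  apply Finset.sum_congr rfl
  intro i _
  apply Finset.sum_congr rfl
  intro j _
  rw [Matrix.diag_apply, Matrix.diag_apply, Matrix.diag_apply, LinearMap.toMatrix_apply, Lm_apply]
  have h1 : b ⟨s, (i, j)⟩ = e.symm (Pi.single s (Matrix.single i j 1)) := by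
    simp [b, Matrix.stdBasis_eq_single]
  have h2 : ∀ z, b.repr z ⟨s, (i, j)⟩ = e z s i j := by
    intro z
    simp only [b, Module.Basis.map_repr, LinearEquiv.trans_apply, Pi.basis_repr]
    rfl
  rw [h1, h2, map_mul, map_mul, e.apply_symm_apply, Pi.mul_apply, Pi.mul_apply, Pi.single_eq_same]
  simp [Matrix.mul_apply, Matrix.single_apply, Finset.sum_ite_eq, ite_and]

/-- double coset invariant -/
def dk (c c' : Fin n → ℕ) (g : Equiv.Perm (Fin n)) : ℕ → ℕ → ℕ := kap c (fun p => c' (g⁻¹ p))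

lemma perm_of_kap (c w w' : Fin n → ℕ) (h : kap c w = kap c w') : ∃ g ∈ Stb c, ∀ p, w' (g p) = w p := by
  have : ∀ y : ℕ × ℕ, Nonempty ({p : Fin n // (c p, w p) = y} ≃ {p : Fin n // (c p, w' p) = y}) := by
    rintro ⟨i, v⟩
    apply Fintype.card_eq.1
    have := congrFun (congrFun h i) v
    unfold kap at this
    rw [Fintype.card_subtype, Fintype.card_subtype]
    simpa [Prod.mk.injEq] using this
  let g := Equiv.ofFiberEquiv (f := fun p => (c p, w p)) (g := fun p => (c p, w' p)) (fun y => (this y).some)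
  have hg : ∀ p, (c (g p), w' (g p)) = (c p, w p) := by
    intro p
    exact Equiv.ofFiberEquiv_map (f := fun p => (c p, w p)) (g := fun p => (c p, w' p)) (fun y => (this y).some) p
  refine ⟨g, mem_Stb.2 (fun p => ?_), fun p => ?_⟩
  · exact (Prod.mk.inj (hg p)).1
  · exact (Prod.mk.inj (hg p)).2

lemma dk_eq_iff (c c' : Fin n → ℕ) (g g' : Equiv.Perm (Fin n)) :
    dk c c' g = dk c c' g' ↔ ∃ h ∈ Stb c, ∃ h' ∈ Stb c', g' = h * g * h' := by
  constructor
  · intro hd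
    obtain ⟨h, hh, hw⟩ := perm_of_kap _ _ _ hd
    refine ⟨h, hh, g⁻¹ * h⁻¹ * g', ?_, by group⟩
    have : (g⁻¹ * h⁻¹ * g')⁻¹ ∈ Stb c' := by
      rw [mem_Stb]
      intro p
      have := hw (g p)
      simpa [mul_inv_rev] using this
    simpa using Stb_inv this
  · rintro ⟨h, hh, h', hh', rfl⟩
    unfold dk
    have := kap_swap c (fun p => c' ((h * g * h')⁻¹ p)) h (mem_Stb.1 hh)
    rw [← this]
    congr 1
    funext p
    have h3 := mem_Stb.1 (Stb_inv hh') (g⁻¹ p)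
    rw [← h3]
    simp [mul_inv_rev, Equiv.Perm.mul_apply]

/-- the bi-invariant elements -/
def Wdc (c c' : Fin n → ℕ) : Submodule ℂ (RR n) :=
  (LinearMap.range (LinearMap.funLeft ℂ ℂ (Set.rangeFactorization (dk c c')))).comap cfE.toLinearMap

lemma mem_Wdc (c c' : Fin n → ℕ) (x : RR n) : x ∈ Wdc c c' ↔
    ∀ g g', dk c c' g = dk c c' g' → cfE x g = cfE x g' := by
  unfold Wdc
  rw [Submodule.mem_comap]
  constructor
  · rintro ⟨f, hf⟩ g g' h
    have h1 := congrFun hf g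
    have h2 := congrFun hf g'
    simp only [LinearMap.funLeft_apply] at h1 h2
    have h3 : Set.rangeFactorization (dk c c') g = Set.rangeFactorization (dk c c') g' := Subtype.ext h
    rw [h3, h2] at h1
    exact h1.symm
  · intro h
    refine ⟨fun y => cfE x y.2.choose, ?_⟩
    funext g
    rw [LinearMap.funLeft_apply]
    exact h _ _ (Set.rangeFactorization (dk c c') g).2.choose_spec

lemma finrank_Wdc (c c' : Fin n → ℕ) : Module.finrank ℂ (Wdc c c') = (Set.range (dk c c')).ncard := by
  have h1 : Module.finrank ℂ (Wdc c c') =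
      Module.finrank ℂ (LinearMap.range (LinearMap.funLeft ℂ ℂ (Set.rangeFactorization (dk c c')))) := by
    have h0 : Wdc c c' = (LinearMap.range (LinearMap.funLeft ℂ ℂ (Set.rangeFactorization (dk c c')))).map
        ((cfE (n := n)).symm.toLinearMap) := by
      exact (Submodule.map_equiv_eq_comap_symm (cfE (n := n)).symm _).symm
    rw [h0]
    exact LinearEquiv.finrank_map_eq cfE.symm _
  rw [h1, LinearMap.finrank_range_of_inj (LinearMap.funLeft_injective_of_surjective _ _ _ Set.rangeFactorization_surjective)]
  rw [Module.finrank_fintype_fun_eq_card, ← Nat.card_coe_set_eq, Nat.card_eq_fintype_card]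

lemma isProj_Lm (c c' : Fin n → ℕ) : LinearMap.IsProj (Wdc c c') (Lm (eps c) (eps c')) := by
  constructor
  · intro x
    rw [mem_Wdc]
    intro g g' h
    obtain ⟨a, ha, a', ha', rfl⟩ := (dk_eq_iff c c' g g').1 h
    have : Lm (eps c) (eps c') x = gg a * Lm (eps c) (eps c') x * gg a' := by
      rw [Lm_apply, ← mul_assoc (gg a), gg_eps ha, mul_assoc, mul_assoc, eps_gg ha']
    conv_rhs => rw [this]
    rw [coeff_gg, gg_coeff]
    group
  · intro x hx
    rw [mem_Wdc] at hx
    rw [Lm_apply]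
    have h1 : ∀ g ∈ Stb c', x * gg g = x := by
      intro a ha
      apply cfE_ext
      intro g
      rw [coeff_gg]
      apply hx
      rw [dk_eq_iff]
      exact ⟨1, Stb_one c, a, ha, by group⟩
    have h2 : ∀ g ∈ Stb c, gg g * x = x := by
      intro a ha
      apply cfE_ext
      intro g
      rw [gg_coeff]
      apply hx
      rw [dk_eq_iff]
      exact ⟨a, ha, 1, Stb_one c', by group⟩
    rw [mul_eps_of c' x h1, eps_mul_of c x h2]

lemma range_dk (c c' : Fin n → ℕ) (hc : ∀ p, c p < n) (hc' : ∀ p, c' p < n) :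
    Set.range (dk c c') = MS n n (cont c) (cont c') := by
  have hce : ∀ (w w' : Fin n → ℕ), cont w = cont w' → ∃ g : Equiv.Perm (Fin n), ∀ p, w' (g p) = w p := by
    intro w w' h
    obtain ⟨g, _, hg⟩ := perm_of_kap (fun _ => 0) w w' (by
      funext i v
      have := congrFun h v
      unfold cont at this
      unfold kap
      by_cases hi : 0 = i
      · simpa [hi] using this
      · simp [hi])
    exact ⟨g, hg⟩
  ext M
  constructor
  · rintro ⟨g, rfl⟩
    have := kap_mem c (fun p => c' (g⁻¹ p)) hc (fun p => hc' _)
    have h2 : cont (fun p => c' (g⁻¹ p)) = cont c' := by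
      funext v
      unfold cont
      refine Finset.card_bij' (fun p _ => g⁻¹ p) (fun p _ => g p) ?_ ?_ ?_ ?_
      · intro p hp; simpa using hp
      · intro p hp; simpa using hp
      · simp
      · simp
    rw [h2] at this
    exact this
  · intro hM
    obtain ⟨w, hw, rfl⟩ := kap_exists c hc (cont c') M hM
    have h2 := cont_of_kap c w hc hw (cont c') (fun v hv => cont_eq_zero c' hc' hv) _ hM
    obtain ⟨g, hg⟩ := hce w c' h2
    refine ⟨g⁻¹, ?_⟩
    unfold dk
    congr 1
    funext p
    simpa using hg p

theorem rk_gram (c c' : Fin n → ℕ) (hc : ∀ p, c p < n) (hc' : ∀ p, c' p < n) :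
    ∑ s, rk e s c * rk e s c' = MM n n (cont c) (cont c') := by
  have h1 := trace_Lm e (eps c) (eps c')
  rw [(isProj_Lm c c').trace, finrank_Wdc, range_dk c c' hc hc'] at h1
  rw [MM_eq, ← Set.ncard_eq_toFinset_card _ (MS_finite n n (cont c) (cont c'))]
  simp only [trace_eps] at h1
  exact_mod_cast h1.symm

end Gram
end CR

namespace CR

set_option linter.unusedSectionVars false
section Irr
variable {n : ℕ} [NeZero n]

lemma word_exists (l : ℕ → ℕ) (h0 : ∀ v, n ≤ v → l v = 0) (hs : sz n l = n) :
    ∃ c : Fin n → ℕ, (∀ p, c p < n) ∧ cont c = l := by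
  have hn : 0 < n := NeZero.pos n
  have hc0 : ∀ x : Fin n, (fun _ : Fin n => 0) x < n := fun x => hn
  have hM : (fun i v => if i = 0 then l v else 0) ∈ MS n n (cont (fun _ : Fin n => 0)) l := by
    refine ⟨?_, ?_, ?_⟩
    · intro i j h
      by_cases hi : i = 0
      · subst hi
        refine ⟨hn, ?_⟩
        by_contra hj
        apply h
        simp [h0 j (by omega)]
      · simp [hi] at h
    · intro i hi
      by_cases hi : i = 0
      · subst hi
        simp only [if_true, cont]
        unfold sz at hs
        simp [hs]
      · simp [hi, cont, Ne.symm hi]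
    · intro j hj
      simp [hn.ne']
  obtain ⟨w, hw, hk⟩ := kap_exists (fun _ : Fin n => 0) hc0 l _ hM
  exact ⟨w, hw, cont_of_kap _ w hc0 hw l h0 _ (hk ▸ hM)⟩

lemma psi_eq {l mu : ℕ → ℕ} (hl : l ∈ PP n) (hmu : mu ∈ PP n) (h : KK n n l mu ≠ 0) : 
    psi n mu ≤ psi n l ∧ (psi n mu = psi n l → mu = l) := by
  obtain ⟨h1, h2⟩ := KK_psi n n l mu hmu h
  refine ⟨h1, fun h3 => ?_⟩
  funext i
  by_cases hi : i < n
  · exact h2 h3 i hi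
  · rw [PP_zero hl (by omega), PP_zero hmu (by omega)]

variable {m : ℕ} {d : Fin m → ℕ} [∀ i, NeZero (d i)]
  (e : RR n ≃ₐ[ℂ] ((i : Fin m) → Matrix (Fin (d i)) (Fin (d i)) ℂ))

theorem exists_irr : ∀ (t : ℕ) (l : ℕ → ℕ), l ∈ PP n → sz n l = n → psi n l = t →
    ∃ s, ∀ c : Fin n → ℕ, (∀ p, c p < n) → rk e s c = KK n n (cont c) l := by
  intro t
  induction t using Nat.strong_induction_on with
  | _ t ih =>
    intro l hl hsz ht
    obtain ⟨cl, hcl, hcl'⟩ := word_exists (n := n) l (fun v hv => PP_zero hl hv) hsz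
    have hg : ∀ c : Fin n → ℕ, (∀ p, c p < n) →
        ∑ s, rk e s cl * rk e s c = ∑ mu ∈ PP n, KK n n l mu * KK n n (cont c) mu := by
      intro c hc
      rw [rk_gram e cl c hcl hc, hcl', gram n n n l (cont c) (by rw [sum_cont c hc])]
    let La := (PP n).filter (fun mu => mu ≠ l ∧ KK n n l mu ≠ 0)
    have hLa : ∀ mu ∈ La, ∃ s, ∀ c : Fin n → ℕ, (∀ p, c p < n) → rk e s c = KK n n (cont c) mu := by
      intro mu hmu
      rw [Finset.mem_filter] at hmu
      obtain ⟨h1, h2, h3⟩ := hmu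
      obtain ⟨h4, h5⟩ := psi_eq hl h1 h3
      have h6 : psi n mu < t := by
        rcases h4.lt_or_eq with h | h
        · omega
        · exact absurd (h5 h) h2
      refine ih _ h6 mu h1 ?_ rfl
      rw [KK_sz n n l mu h3]
      exact hsz
    have hsplit : ∀ c : Fin n → ℕ, ∑ mu ∈ PP n, KK n n l mu * KK n n (cont c) mu =
        KK n n (cont c) l + ∑ mu ∈ La, KK n n l mu * KK n n (cont c) mu := by
      intro c
      rw [← Finset.add_sum_erase _ _ hl, KK_diag n l hl, one_mul]
      congr 1
      symm
      apply Finset.sum_subset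
      · intro mu hmu
        rw [Finset.mem_filter] at hmu
        exact Finset.mem_erase.2 ⟨hmu.2.1, hmu.1⟩
      · intro mu hmu hmu'
        rw [Finset.mem_erase] at hmu
        have : KK n n l mu = 0 := by
          by_contra h
          exact hmu' (Finset.mem_filter.2 ⟨hmu.2, hmu.1, h⟩)
        rw [this, zero_mul]
    have hne : Nonempty (Fin m) := by
      by_contra hem
      rw [not_nonempty_iff] at hem
      have := hg cl hcl
      rw [hsplit, hcl', KK_diag n l hl] at this
      simp at this
      omega
    choose! si hsi using hLa
    have hinj : Set.InjOn si La := by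
      intro mu hmu mu' hmu' heq
      have hm := Finset.mem_filter.1 (Finset.mem_coe.1 hmu)
      have hm' := Finset.mem_filter.1 (Finset.mem_coe.1 hmu')
      have key : ∀ mu mu', mu ∈ La → mu' ∈ La → si mu = si mu' → psi n mu' ≤ psi n mu ∧ (psi n mu' = psi n mu → mu' = mu) := by
        intro mu mu' hmu hmu' heq
        have hm := Finset.mem_filter.1 hmu
        have hm' := Finset.mem_filter.1 hmu'
        apply psi_eq hm.1 hm'.1
        obtain ⟨c, hc, hc'⟩ := word_exists (n := n) mu (fun v hv => PP_zero hm.1 hv)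
          (by rw [KK_sz n n l mu hm.2.2]; exact hsz)
        have h1 := hsi mu hmu c hc
        have h2 := hsi mu' hmu' c hc
        rw [heq, h2, hc', KK_diag n mu hm.1] at h1
        omega
      have k1 := key mu mu' hmu hmu' heq
      have k2 := key mu' mu hmu' hmu heq.symm
      exact k2.2 (le_antisymm k2.1 k1.1)
    have hT : ∀ c : Fin n → ℕ, (∀ p, c p < n) →
        ∑ s ∈ (La.image si)ᶜ, rk e s cl * rk e s c = KK n n (cont c) l := by
      intro c hc
      have h1 := hg c hc
      rw [hsplit c, ← Finset.sum_add_sum_compl (La.image si), Finset.sum_image hinj] at h1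
      have h2 : ∑ mu ∈ La, rk e (si mu) cl * rk e (si mu) c = ∑ mu ∈ La, KK n n l mu * KK n n (cont c) mu := by
        apply Finset.sum_congr rfl
        intro mu hmu
        rw [hsi mu hmu c hc, hsi mu hmu cl hcl, hcl']
      omega
    have h1 := hT cl hcl
    rw [hcl', KK_diag n l hl] at h1
    obtain ⟨s0, hs0, hs0'⟩ : ∃ s ∈ (La.image si)ᶜ, rk e s cl * rk e s cl ≠ 0 := by
      apply Finset.exists_ne_zero_of_sum_ne_zero
      rw [h1]; omega
    rw [← Finset.add_sum_erase _ _ hs0] at h1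
    have h2 : rk e s0 cl * rk e s0 cl = 1 := by omega
    have h3 : ∑ s ∈ ((La.image si)ᶜ).erase s0, rk e s cl * rk e s cl = 0 := by omega
    rw [Finset.sum_eq_zero_iff] at h3
    refine ⟨s0, fun c hc => ?_⟩
    rw [← hT c hc, ← Finset.add_sum_erase _ _ hs0, Finset.sum_eq_zero, add_zero, Nat.eq_one_of_mul_eq_one_left h2, one_mul]
    intro s hs
    rw [mul_self_eq_zero.1 (h3 s hs), zero_mul]

lemma span_orbit (s : Fin m) (v0 : Fin (d s) → ℂ) (h0 : v0 ≠ 0) (Q : Submodule ℂ (Fin (d s) → ℂ))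
    (hQ : ∀ g, (act e s g).mulVec v0 ∈ Q) : Q = ⊤ := by
  rw [eq_top_iff]
  intro v _
  obtain ⟨i0, hi0⟩ : ∃ i, v0 i ≠ 0 := by
    by_contra h
    push Not at h
    exact h0 (funext h)
  let M : Matrix (Fin (d s)) (Fin (d s)) ℂ := Matrix.of fun r c => if c = i0 then v r / v0 i0 else 0
  have hM : M.mulVec v0 = v := by
    funext r
    simp only [Matrix.mulVec, dotProduct, M, Matrix.of_apply]
    simp [hi0]
  have hx : e (e.symm (Pi.single s M)) s = M := by simp
  rw [← hM, ← hx, eq_sum_gg (e.symm (Pi.single s M)), map_sum, Finset.sum_apply, Matrix.sum_mulVec]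
  apply Submodule.sum_mem
  intro g _
  rw [map_smul, Pi.smul_apply, Matrix.smul_mulVec]
  exact Submodule.smul_mem _ _ (hQ g)

lemma refl_top (s : Fin m) (a : ℕ) (han : a < n) (c : Fin n → ℕ) (hc : ∀ p, c p < a) (v0 : Fin (d s) → ℂ)
    (hv0 : v0 ∈ Inv e s c) (h0 : v0 ≠ 0) : (⨆ i ∈ Iv n a, Hs e s i) = ⊤ := by
  apply span_orbit e s v0 h0
  have S1 : ∀ i : Fin n, i.val < a → ∀ v, (act e s (ss i)).mulVec v + v ∈ (⨆ i ∈ Iv n a, Hs e s i) := by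
    intro i hi v
    have hle : Hs e s i ≤ (⨆ i ∈ Iv n a, Hs e s i) :=
      le_iSup₂ (f := fun i (_ : i ∈ Iv n a) => Hs e s i) i (by simp [Iv, hi])
    apply hle
    rw [mem_Hs, Matrix.mulVec_add, act_act]
    have : ss i * ss i = 1 := by simp [ss]
    rw [this, act_one, Matrix.one_mulVec, add_comm]
  have succ_val : ∀ p : Fin n, p.val + 1 < n → (p + 1).val = p.val + 1 := by
    intro p hp
    rw [Fin.val_add, Fin.val_one', Nat.add_mod_mod, Nat.mod_eq_of_lt hp]
  have S2 : ∀ (t : ℕ) (p q : Fin n), q.val = p.val + t + 1 → q.val ≤ a →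
      ∀ v, (act e s (Equiv.swap p q)).mulVec v + v ∈ (⨆ i ∈ Iv n a, Hs e s i) := by
    intro t
    induction t with
    | zero =>
      intro p q hpq hqa v
      have : q = p + 1 := Fin.ext (by rw [succ_val p (by omega)]; omega)
      subst this
      exact S1 p (by omega) v
    | succ t ih =>
      intro p q hpq hqa v
      have hq := q.2
      let q' : Fin n := ⟨q.val - 1, by omega⟩
      have hq' : q'.val = q.val - 1 := rfl
      have hqq : q = q' + 1 := Fin.ext (by rw [succ_val q' (by omega)]; omega)
      have hsw : Equiv.swap p q = ss q' * Equiv.swap p q' * ss q' := by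
        unfold ss
        rw [← hqq, Equiv.swap_mul_swap_mul_swap (x := p) (y := q') (z := q), Equiv.swap_comm]
        · intro h; have := congrArg Fin.val h; omega
        · intro h; have := congrArg Fin.val h; omega
      have i1 := S1 q' (by omega) v
      have i2 := ih p q' (by omega) (by omega) ((act e s (ss q')).mulVec v)
      have i3 := S1 q' (by omega) ((act e s (Equiv.swap p q')).mulVec ((act e s (ss q')).mulVec v))
      rw [hsw, act_mul, act_mul, ← Matrix.mulVec_mulVec, ← Matrix.mulVec_mulVec]
      have := Submodule.add_mem _ (Submodule.sub_mem _ i3 i2) i1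
      convert this using 1
      abel
  intro g
  obtain ⟨p, hp, q, hq, hpq, heq⟩ : ∃ p ∈ Iv n (a + 1), ∃ q ∈ Iv n (a + 1), p ≠ q ∧ c (g⁻¹ p) = c (g⁻¹ q) := by
    apply Finset.exists_ne_map_eq_of_card_lt_of_maps_to (t := Finset.range a)
    · rw [card_Iv (by omega)]; simp
    · intro p _; simp [hc]
  have S3 : ∀ p q : Fin n, p.val < q.val → q.val ≤ a → c (g⁻¹ p) = c (g⁻¹ q) →
      (act e s g).mulVec v0 ∈ (⨆ i ∈ Iv n a, Hs e s i) := by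
    intro p q hpq hqa heq
    have h1 := S2 (q.val - p.val - 1) p q (by omega) hqa ((act e s g).mulVec v0)
    have h2 : (act e s (Equiv.swap p q)).mulVec ((act e s g).mulVec v0) = (act e s g).mulVec v0 := by
      rw [act_act]
      have h3 : Equiv.swap p q * g = g * (g⁻¹ * Equiv.swap p q * g) := by group
      rw [h3, ← act_act, (mem_Inv e s c v0).1 hv0]
      intro r
      have : ∀ y : Fin n, c (g⁻¹ (Equiv.swap p q y)) = c (g⁻¹ y) := by
        intro y
        by_cases hy : y = p
        · subst hy; rw [Equiv.swap_apply_left, heq]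
        · by_cases hy' : y = q
          · subst hy'; rw [Equiv.swap_apply_right, heq]
          · rw [Equiv.swap_apply_of_ne_of_ne hy hy']
      have := this (g r)
      simpa [Equiv.Perm.mul_apply] using this
    rw [h2, ← two_smul ℂ] at h1
    exact (Submodule.smul_mem_iff _ two_ne_zero).1 h1
  simp only [Iv, Finset.mem_filter, Finset.mem_univ, true_and] at hp hq
  rcases lt_trichotomy p.val q.val with h | h | h
  · exact S3 p q h (by omega) heq
  · exact absurd (Fin.ext h) hpq
  · exact S3 q p h (by omega) heq.symm

lemma cont_big (b : ℕ) (hb : b < n) : b < cont (cB 0 (Iv n (n - b))) (cB 0 (Iv n (n - b)) (0 : Fin n)) := by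
  have h0 : (0 : Fin n) ∈ Iv n (n - b) := by simp [Iv]; omega
  have key : ∀ (t : ℕ), t + 1 ≤ b → ∀ p : Fin n, p.val = n - (t + 1) →
      cB 0 (Iv n (n - b)) p = cB 0 (Iv n (n - b)) (0 : Fin n) := by
    intro t
    induction t with
    | zero =>
      intro ht p hp
      have : p + 1 = 0 := by
        apply Fin.ext
        rw [Fin.val_add, Fin.val_one', Nat.add_mod_mod, hp, Nat.sub_add_cancel (by omega)]
        simp
      rw [← cB_succ_notMem 0 (Iv n (n-b)) p h0 (by simp [Iv]; omega), this]
    | succ t ih =>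
      intro ht p hp
      rw [← cB_succ_notMem 0 (Iv n (n-b)) p h0 (by simp [Iv]; omega)]
      apply ih (by omega)
      rw [Fin.val_add, Fin.val_one', Nat.add_mod_mod, Nat.mod_eq_of_lt (by omega)]
      omega
  have hsub : insert 0 (Iv n (n - b))ᶜ ⊆ Finset.univ.filter
      (fun p => cB 0 (Iv n (n - b)) p = cB 0 (Iv n (n - b)) (0 : Fin n)) := by
    intro p hp
    rw [Finset.mem_insert] at hp
    rw [Finset.mem_filter]
    refine ⟨Finset.mem_univ _, ?_⟩
    rcases hp with rfl | hp
    · rfl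
    · simp [Iv] at hp
      have := p.2
      exact key (n - p.val - 1) (by omega) p (by omega)
  have := Finset.card_le_card hsub
  rw [Finset.card_insert_of_notMem (by simpa using h0), Finset.card_compl, card_Iv (by omega), Fintype.card_fin] at this
  unfold cont
  omega

theorem rep_main (l : ℕ → ℕ) (hl : l ∈ PP n) (hsz : sz n l = n) (a : ℕ) (ha : l a = 0) (hab : a + l 0 ≤ n) :
    ∃ (V : Type) (_ : AddCommGroup V) (_ : Module ℂ V) (_ : FiniteDimensional ℂ V) (H : Fin n → Submodule ℂ V),
      DistP H ∧ (⨆ i ∈ Iv n a, H i) = ⊤ ∧ VB H (Iv n (n - l 0)) = ⊥ ∧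
      ∀ x B, x ∈ B → Module.finrank ℂ (VB H B) = KK n n (cont (cB x B)) l := by
  obtain ⟨m, d, hd, ⟨e⟩⟩ := IsSemisimpleRing.exists_algEquiv_pi_matrix_of_isAlgClosed ℂ (RR n)
  obtain ⟨s, hs⟩ := exists_irr e _ l hl hsz rfl
  have hn : 0 < n := NeZero.pos n
  have hanti := (mem_PP.1 hl).1
  have hl0 : 0 < l 0 := by
    by_contra h
    have : sz n l = 0 := Finset.sum_eq_zero (fun i _ => by have := hanti (Nat.zero_le i); omega)
    omega
  have ha0 : a ≠ 0 := by rintro rfl; omega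
  have hlt : ∀ (x : Fin n) (B : Finset (Fin n)), x ∈ B → ∀ p, cB x B p < n := by
    intro x B hx p
    have := cB_lt x B hx p
    have := Finset.card_le_univ B
    simp at this
    omega
  have hfin : ∀ x B, x ∈ B → Module.finrank ℂ (VB (Hs e s) B) = KK n n (cont (cB x B)) l := by
    intro x B hx
    rw [VB_eq_Inv e s x B hx]
    exact hs _ (hlt x B hx)
  refine ⟨Fin (d s) → ℂ, inferInstance, inferInstance, inferInstance, Hs e s, distP_Hs e s, ?_, ?_, hfin⟩
  · obtain ⟨c, hc, hc'⟩ := word_exists (n := n) l (fun v hv => PP_zero hl hv) hsz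
    have h1 := hs c hc
    rw [hc', KK_diag n l hl] at h1
    have h2 : Inv e s c ≠ ⊥ := by
      intro h
      unfold rk at h1
      rw [h, finrank_bot] at h1
      omega
    obtain ⟨v0, hv0, hne⟩ := Submodule.exists_mem_ne_zero_of_ne_bot h2
    refine refl_top e s a (by omega) c ?_ v0 hv0 hne
    apply lt_of_cont
    intro v hv
    rw [hc']
    have := hanti hv
    omega
  · have h0 : (0 : Fin n) ∈ Iv n (n - l 0) := by simp [Iv]; omega
    apply Submodule.finrank_eq_zero.1
    rw [hfin 0 _ h0]
    exact KK_big n n _ l hl _ (hlt 0 _ h0 0) (cont_big (l 0) (by omega))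

end Irr
end CR

namespace CR
set_option linter.unusedSectionVars false
section Transport
variable {n : ℕ} [NeZero n]

lemma tab_eq {X : Type} (S : Set X) (Ok : (X → ℕ) → Prop) (φ : Fin n → X) (hφ : Function.Injective φ)
    (hr : Set.range φ = S) (Ok' : (Fin n → ℕ) → Prop) (hOk : ∀ T, Ok T ↔ Ok' (T ∘ φ)) (N : ℕ) (e : ℕ →₀ ℕ)
    (he : ∀ v, N ≤ v → e v = 0) :
    tabSeries S Ok e = (((Wd n N e).filter Ok').card : ℚ) := by
  have hc : ∀ (T : X → ℕ) (v : ℕ), Nat.card {x : X // x ∈ S ∧ T x = v} = cont (T ∘ φ) v := by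
    intro T v
    have h1 : cont (T ∘ φ) v = Nat.card {p : Fin n // (T ∘ φ) p = v} := by
      rw [Nat.card_eq_fintype_card, Fintype.card_subtype]; rfl
    rw [h1]
    symm
    refine Nat.card_congr (Equiv.ofBijective (fun p => ⟨φ p.1, hr ▸ ⟨p.1, rfl⟩, p.2⟩) ⟨?_, ?_⟩)
    · intro p q h
      apply Subtype.ext
      exact hφ (congrArg (fun x => x.1) h)
    · rintro ⟨x, hx, hv⟩
      rw [← hr] at hx
      obtain ⟨p, rfl⟩ := hx
      exact ⟨⟨p, hv⟩, rfl⟩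
  have key : Nat.card {T : X → ℕ //
    Ok T ∧ (∀ x, x ∉ S → T x = 0) ∧ ∀ v, Nat.card {x : X // x ∈ S ∧ T x = v} = e v} =
      Nat.card {w // w ∈ (Wd n N e).filter Ok'} := by
    refine Nat.card_congr (Equiv.ofBijective (fun T => ⟨T.1 ∘ φ, ?_⟩) ⟨?_, ?_⟩)
    · obtain ⟨T, h1, h2, h3⟩ := T
      rw [Finset.mem_filter, mem_Wd]
      have h4 : cont (T ∘ φ) = e := by funext v; rw [← hc, h3]
      exact ⟨⟨lt_of_cont _ (fun v hv => by rw [h4]; exact he v hv), h4⟩, (hOk T).1 h1⟩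
    · rintro ⟨T, h1, h2, h3⟩ ⟨T', h1', h2', h3'⟩ h
      apply Subtype.ext
      have h4 : T ∘ φ = T' ∘ φ := congrArg (fun x => x.1) h
      funext x
      by_cases hx : x ∈ S
      · rw [← hr] at hx
        obtain ⟨p, rfl⟩ := hx
        exact congrFun h4 p
      · show T x = T' x
        rw [h2 x hx, h2' x hx]
    · rintro ⟨w, hw⟩
      rw [Finset.mem_filter, mem_Wd] at hw
      have h5 : (Function.extend φ w 0) ∘ φ = w := by
        funext p; exact hφ.extend_apply w 0 p
      refine ⟨⟨Function.extend φ w 0, ?_, ?_, ?_⟩, ?_⟩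
      · rw [hOk, h5]; exact hw.2
      · intro x hx
        rw [Function.extend_apply']
        · rfl
        · rintro ⟨p, rfl⟩; exact hx (hr ▸ ⟨p, rfl⟩)
      · intro v; rw [hc, h5, hw.1.2]
      · apply Subtype.ext; exact h5
  unfold tabSeries
  rw [key, Nat.card_eq_fintype_card, Fintype.card_coe]

lemma FD_univ (N : ℕ) (e : ℕ → ℕ) : FD N (Iv n n) e = 0 := by
  unfold FD
  rw [Finset.card_eq_zero, Finset.filter_eq_empty_iff]
  intro w _ h
  obtain ⟨i, hi⟩ := Finite.exists_max w
  have : i ∈ cAsc w := by rw [h]; simp [Iv]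
  simp only [cAsc, Finset.mem_filter] at this
  have := hi (i + 1)
  omega

lemma val_succ' (i : Fin n) (h : i.val + 1 < n) : (i + 1).val = i.val + 1 := by
  obtain ⟨m, rfl⟩ : ∃ m, n = m + 1 := ⟨n - 1, by omega⟩
  rw [Fin.val_add_one, if_neg]
  rintro rfl
  simp at h

lemma val_succ_last (i : Fin n) (h : i.val + 1 = n) : (i + 1) = 0 := by
  obtain ⟨m, rfl⟩ : ∃ m, n = m + 1 := ⟨n - 1, by omega⟩
  have : i = Fin.last m := by ext; simp; omega
  rw [this]; simp

lemma schur_hook (a b : ℕ) (ha : 1 ≤ a) (hab : a + b = n) (N : ℕ) (e : ℕ →₀ ℕ) (he : ∀ v, N ≤ v → e v = 0) :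
    schur (hookFun a b) e = (FD N (Iv n b) e : ℚ) + FD N (Iv n (b + 1)) e := by
  have hS : cells (hookFun a b) \ cells (fun _ => 0) = cells (hookFun a b) := by
    ext x; simp [cells]
  unfold schur skewSchur
  rw [hS]
  have hc : ∀ r c, (r, c) ∈ cells (hookFun a b) ↔ (r = 0 ∧ c < a) ∨ (0 < r ∧ r ≤ b ∧ c = 0) := by
    intro r c
    show c < hookFun a b r ↔ _
    cases r with
    | zero => rw [hook_zero]; omega
    | succ r =>
      rw [hook_succ]
      by_cases h : r < b
      · rw [if_pos h]; omega
      · rw [if_neg h]; omega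
  let φ : Fin n → ℕ × ℕ := fun i => if i.val ≤ b then (i.val, 0) else (0, n - i.val)
  have hφ1 : ∀ i : Fin n, i.val ≤ b → φ i = (i.val, 0) := fun i h => if_pos h
  have hφ2 : ∀ i : Fin n, b < i.val → φ i = (0, n - i.val) := fun i h => if_neg (by omega)
  rw [tab_eq (n := n) _ _ φ ?_ ?_ (fun w => ∀ i : Fin n, (i.val < b → w i < w (i + 1)) ∧ (b < i.val → w (i + 1) ≤ w i)) ?_ N e he]
  · unfold FD
    rw [← Nat.cast_add, ← Finset.card_union_of_disjoint]
    · congr 2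
      ext w
      simp only [Finset.mem_union, Finset.mem_filter, ← and_or_left]
      apply and_congr_right
      intro _
      constructor
      · intro h
        by_cases hb : w ⟨b, by omega⟩ < w (⟨b, by omega⟩ + 1)
        · right
          ext i
          simp only [cAsc, Iv, Finset.mem_filter, Finset.mem_univ, true_and]
          have := h i
          rcases lt_trichotomy i.val b with h' | h' | h'
          · have := this.1 h'; omega
          · have : i = ⟨b, by omega⟩ := Fin.ext h'
            rw [this]; simp only [hb]; simp
          · have := this.2 h'; omega
        · left
          ext i
          simp only [cAsc, Iv, Finset.mem_filter, Finset.mem_univ, true_and]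
          have := h i
          rcases lt_trichotomy i.val b with h' | h' | h'
          · have := this.1 h'; omega
          · have : i = ⟨b, by omega⟩ := Fin.ext h'
            rw [this]; simp only [hb]; simp
          · have := this.2 h'; omega
      · intro h i
        have h0 : i ∈ cAsc w ↔ w i < w (i + 1) := by simp [cAsc]
        rcases h with h | h <;> rw [h] at h0 <;> simp only [Iv, Finset.mem_filter, Finset.mem_univ, true_and] at h0 <;> constructor <;> intro h' <;> omega
    · rw [Finset.disjoint_left]
      intro w h1 h2
      rw [Finset.mem_filter] at h1 h2
      have h3 := h1.2.symm.trans h2.2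
      have : (⟨b, by omega⟩ : Fin n) ∈ Iv n (b + 1) := by simp [Iv]
      rw [← h3] at this
      simp [Iv] at this
  · intro i j h
    by_cases hi : i.val ≤ b <;> by_cases hj : j.val ≤ b
    · rw [hφ1 i hi, hφ1 j hj] at h
      simp only [Prod.mk.injEq] at h
      exact Fin.ext h.1
    · rw [hφ1 i hi, hφ2 j (by omega)] at h
      simp only [Prod.mk.injEq] at h; omega
    · rw [hφ2 i (by omega), hφ1 j hj] at h
      simp only [Prod.mk.injEq] at h; omega
    · rw [hφ2 i (by omega), hφ2 j (by omega)] at h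
      simp only [Prod.mk.injEq] at h
      apply Fin.ext; omega
  · ext ⟨r, c⟩
    rw [hc]
    constructor
    · rintro ⟨i, hi⟩
      by_cases h : i.val ≤ b
      · rw [hφ1 i h] at hi
        simp only [Prod.mk.injEq] at hi; omega
      · rw [hφ2 i (by omega)] at hi
        simp only [Prod.mk.injEq] at hi; omega
    · intro h
      by_cases hc0 : c = 0
      · refine ⟨⟨r, by omega⟩, ?_⟩
        rw [hφ1 _ (by show r ≤ b; omega)]
        exact Prod.ext rfl hc0.symm
      · refine ⟨⟨n - c, by omega⟩, ?_⟩
        rw [hφ2 _ (by show b < n - c; omega)]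
        ext <;> simp <;> omega
  · intro T
    constructor
    · rintro ⟨h1, h2⟩ i
      constructor
      · intro hi
        have hv := val_succ' i (by omega)
        simp only [Function.comp]
        rw [hφ1 i hi.le, hφ1 (i+1) (by omega), hv]
        exact h2 _ _ ((hc _ _).2 (by omega)) ((hc _ _).2 (by omega))
      · intro hi
        simp only [Function.comp]
        rw [hφ2 i hi]
        by_cases hl : i.val + 1 = n
        · rw [val_succ_last i hl, hφ1 0 (by simp)]
          have := h1 0 0 ((hc _ _).2 (by omega)) ((hc _ _).2 (by omega))
          have e1 : n - i.val = 0 + 1 := by omega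
          rw [e1]; simpa using this
        · have hv := val_succ' i (by omega)
          rw [hφ2 (i+1) (by omega), hv]
          have e1 : n - i.val = (n - (i.val + 1)) + 1 := by omega
          rw [e1]
          exact h1 _ _ ((hc _ _).2 (by omega)) ((hc _ _).2 (by omega))
    · intro h
      simp only [Function.comp] at h
      constructor
      · intro r c h1 h2
        rw [hc] at h1 h2
        obtain rfl : r = 0 := by omega
        have h3 := (h ⟨n - (c+1), by omega⟩).2 (by show b < n - (c+1); omega)
        rw [hφ2 ⟨n - (c+1), by omega⟩ (by show b < n - (c+1); omega)] at h3
        have e1 : n - (n - (c+1)) = c + 1 := by omega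
        simp only [e1] at h3
        refine le_trans (le_of_eq ?_) h3
        congr 1
        by_cases hc0 : c = 0
        · rw [val_succ_last _ (by show n - (c+1) + 1 = n; omega), hφ1 0 (by simp), hc0]; simp
        · have hv := val_succ' (⟨n - (c+1), by omega⟩ : Fin n) (by show n - (c+1) + 1 < n; omega)
          simp only at hv
          rw [hφ2 _ (by rw [hv]; omega), hv]
          ext <;> simp; omega
      · intro r c h1 h2
        rw [hc] at h1 h2
        have h3 := (h ⟨r, by omega⟩).1 (by show r < b; omega)
        have hv := val_succ' (⟨r, by omega⟩ : Fin n) (by show r + 1 < n; omega)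
        simp only at hv
        rw [hφ1 _ (by show r ≤ b; omega), hφ1 _ (by rw [hv]; omega), hv] at h3
        obtain rfl : c = 0 := by omega
        exact h3

lemma hook_sum (u k : ℕ) (hu : u + k = n) (N : ℕ) (e : ℕ →₀ ℕ) (he : ∀ v, N ≤ v → e v = 0) :
    ∑ j ∈ Finset.range u, ((-1 : ℚ) ^ j) * schur (hookFun (u - j) (k + j)) e = FD N (Iv n k) e := by
  have key : ∀ m ≤ u, ∑ j ∈ Finset.range m, ((-1 : ℚ) ^ j) * schur (hookFun (u - j) (k + j)) e
      = FD N (Iv n k) e - (-1) ^ m * FD N (Iv n (k + m)) e := by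
    intro m hm
    induction m with
    | zero => simp
    | succ m ih =>
      rw [Finset.sum_range_succ, ih (by omega), schur_hook (n := n) (u - m) (k + m) (by omega) (by omega) N e he]
      rw [pow_succ, ← add_assoc]; ring
  rw [key u le_rfl, show k + u = n by omega, FD_univ]
  simp

end Transport
end CR

namespace CR
set_option linter.unusedSectionVars false
section Ribbon

lemma cmk_eq {u v : ℕ} {a b : ℤ × ℤ} : cmk u v a = cmk u v b ↔ ∃ m : ℤ, b.1 = a.1 - m * u ∧ b.2 = a.2 + m * v := by
  unfold cmk
  rw [QuotientAddGroup.eq, AddSubgroup.mem_zmultiples_iff]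
  constructor
  · rintro ⟨m, hm⟩
    refine ⟨m, ?_⟩
    have h1 := congrArg Prod.fst hm
    have h2 := congrArg Prod.snd hm
    simp at h1 h2
    constructor <;> linarith
  · rintro ⟨m, h1, h2⟩
    refine ⟨m, ?_⟩
    ext
    · simp; linarith
    · simp; linarith

lemma path_cross {P : Set (ℤ × ℤ)} {a b : ℤ × ℤ} (ha : a ∈ P)
    (h : ReflTransGen (fun p q => q ∈ P ∧ adjZ p q) a b) (t : ℤ) (h1 : a.2 - a.1 ≤ t) (h2 : t < b.2 - b.1) :
    ∃ p q, p ∈ P ∧ q ∈ P ∧ p.2 - p.1 = t ∧ q.2 - q.1 = t + 1 ∧ adjZ p q := by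
  have hP : ∀ c, ReflTransGen (fun p q => q ∈ P ∧ adjZ p q) a c → c ∈ P := by
    intro c hc
    rcases hc.cases_tail with rfl | ⟨d, _, hd⟩
    · exact ha
    · exact hd.1
  induction h with
  | refl => omega
  | tail hab hbc ih =>
    rename_i b c
    by_cases hb : t < b.2 - b.1
    · exact ih hb
    · refine ⟨b, c, hP b hab, hbc.1, ?_, ?_, hbc.2⟩
      · rcases hbc.2 with h | h | h | h
        · rw [h] at h2; simp at h2; omega
        · have e1 := congrArg Prod.fst h; have e2 := congrArg Prod.snd h; simp at e1 e2; omega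
        · rw [h] at h2; simp at h2; omega
        · have e1 := congrArg Prod.fst h; have e2 := congrArg Prod.snd h; simp at e1 e2; omega
      · rcases hbc.2 with h | h | h | h <;>
        · have e1 := congrArg Prod.fst h; have e2 := congrArg Prod.snd h; simp at e1 e2; omega

/-- walking along the ribbon -/
def wk (P : Set (ℤ × ℤ)) (a : ℤ × ℤ) : ℕ → ℤ × ℤ
  | 0 => a
  | m + 1 => if ((wk P a m).1, (wk P a m).2 + 1) ∈ P then ((wk P a m).1, (wk P a m).2 + 1)
      else ((wk P a m).1 - 1, (wk P a m).2)

theorem ribbon_main {n : ℕ} [NeZero n] (u v : ℕ) (hu : 0 < u) (hv : 0 < v) (huv : u + v = n)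
    (C : Set (Cyl u v)) (hC : IsCylRibbon u v C) :
    ∃ D : Finset (Fin n), D.card = v ∧ ∀ (N : ℕ) (e : ℕ →₀ ℕ), (∀ i, N ≤ i → e i = 0) →
      cylSchur u v C e = (FD N D e : ℚ) := by
  obtain ⟨⟨_, hconv⟩, ⟨x0, hx0⟩, hpath, hblock⟩ := hC
  set P := preimg u v C with hP
  have memP : ∀ a, a ∈ P ↔ cmk u v a ∈ C := fun a => Iff.rfl
  have trans : ∀ a ∈ P, ∀ m : ℤ, (a.1 - m * u, a.2 + m * v) ∈ P := by
    intro a ha m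
    rw [memP] at *
    have h : cmk u v a = cmk u v (a.1 - m * u, a.2 + m * v) := cmk_eq.2 ⟨m, rfl, rfl⟩
    rw [← h]
    exact ha
  have conv : ∀ a b c, a ∈ P → c ∈ P → a.1 ≤ b.1 → a.2 ≤ b.2 → b.1 ≤ c.1 → b.2 ≤ c.2 → b ∈ P := by
    intro a b c ha hc h1 h2 h3 h4
    exact hconv _ _ _ ⟨a, b, rfl, rfl, h1, h2⟩ ⟨b, c, rfl, rfl, h3, h4⟩ ha hc
  have diag' : ∀ a b, a ∈ P → b ∈ P → a.2 - a.1 = b.2 - b.1 → ¬ a.1 < b.1 := by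
    intro a b ha hb h hlt
    apply hblock
    refine ⟨a, ha, ?_, ?_, ?_⟩ <;> apply conv a _ b ha hb <;> simp <;> omega
  have diag : ∀ a b, a ∈ P → b ∈ P → a.2 - a.1 = b.2 - b.1 → a = b := by
    intro a b ha hb h
    have h1 := diag' a b ha hb h
    have h2 := diag' b a hb ha h.symm
    ext <;> omega
  have next : ∀ a ∈ P, (a.1, a.2 + 1) ∈ P ∨ (a.1 - 1, a.2) ∈ P := by
    intro a ha
    have hb := trans a ha 1
    obtain ⟨p, q, hp, hq, h1, h2, h3⟩ := path_cross ha (hpath a _ ha hb) (a.2 - a.1) le_rfl (by simp; omega)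
    obtain rfl := diag p a hp ha h1
    rcases h3 with h | h | h | h
    · rw [h] at h2; simp at h2; omega
    · right
      have e1 := congrArg Prod.fst h
      have e2 := congrArg Prod.snd h
      simp at e1 e2
      have : q = (p.1 - 1, p.2) := by ext <;> simp <;> omega
      rw [← this]; exact hq
    · left; rw [← h]; exact hq
    · have e1 := congrArg Prod.fst h
      have e2 := congrArg Prod.snd h
      simp at e1 e2; omega
  obtain ⟨a0, rfl⟩ : ∃ a, cmk u v a = x0 := QuotientAddGroup.mk_surjective x0
  let f := wk P a0
  have f0 : f 0 = a0 := rfl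
  have fs1 : ∀ m, ((f m).1, (f m).2 + 1) ∈ P → f (m + 1) = ((f m).1, (f m).2 + 1) := fun m h => if_pos h
  have fs2 : ∀ m, ((f m).1, (f m).2 + 1) ∉ P → f (m + 1) = ((f m).1 - 1, (f m).2) := fun m h => if_neg h
  have fP : ∀ m, f m ∈ P := by
    intro m
    induction m with
    | zero => exact hx0
    | succ m ih =>
      by_cases h : ((f m).1, (f m).2 + 1) ∈ P
      · rw [fs1 m h]; exact h
      · rw [fs2 m h]; exact (next _ ih).resolve_left h
  have fd : ∀ m : ℕ, (f m).2 - (f m).1 = a0.2 - a0.1 + m := by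
    intro m
    induction m with
    | zero => simp [f0]
    | succ m ih =>
      by_cases h : ((f m).1, (f m).2 + 1) ∈ P
      · rw [fs1 m h]; push_cast; linarith
      · rw [fs2 m h]; push_cast; linarith
  have funiq : ∀ b ∈ P, ∀ m : ℕ, b.2 - b.1 = a0.2 - a0.1 + m → b = f m :=
    fun b hb m h => diag _ _ hb (fP m) (by rw [fd, h])
  have hn : (n : ℤ) = u + v := by rw [← huv]; push_cast; rfl
  have fn : f n = (a0.1 - u, a0.2 + v) := by
    symm
    apply funiq _ _ n
    · simp only; linarith
    · simpa using trans a0 hx0 1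
  let φ : Fin n → Cyl u v := fun i => cmk u v (f i)
  have φs : ∀ i : Fin n, φ (i + 1) = cmk u v (f (i.val + 1)) := by
    intro i
    show cmk u v (f (i + 1).val) = _
    by_cases hl : i.val + 1 = n
    · rw [val_succ_last i hl, hl, fn]
      simp only [Fin.val_zero, f0]
      rw [cmk_eq]; exact ⟨1, by simp, by simp⟩
    · rw [val_succ' i (by omega)]
  have hinj : Function.Injective φ := by
    intro i j h
    obtain ⟨m, h1, h2⟩ := cmk_eq.1 h
    have e1 := fd i; have e2 := fd j
    have e3 : ((j.val : ℤ)) = i.val + m * n := by rw [hn]; linarith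
    have hi := i.2; have hj := j.2
    have hm : m = 0 := by
      rcases lt_trichotomy m 0 with h' | h' | h'
      · nlinarith
      · exact h'
      · nlinarith
    apply Fin.ext
    rw [hm] at e3; omega
  have hrep : ∀ b ∈ P, ∃ i : Fin n, ∃ m : ℤ, (b.1 - m * u, b.2 + m * v) = f i := by
    intro b hb
    have hnpos : (0 : ℤ) < n := by have := NeZero.pos n; omega
    let s := (b.2 - b.1) - (a0.2 - a0.1)
    have h1 := Int.emod_nonneg s hnpos.ne'
    have h2 := Int.emod_lt_of_pos s hnpos
    have h3 := Int.emod_add_mul_ediv s n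
    refine ⟨⟨(s % n).toNat, by omega⟩, -(s / n), ?_⟩
    apply funiq _ (trans b hb _)
    simp only
    rw [Int.toNat_of_nonneg h1]
    have h4 : (n : ℤ) * (s / n) = (s / n) * u + (s / n) * v := by rw [hn]; ring
    have h5 : s = (b.2 - b.1) - (a0.2 - a0.1) := rfl
    linarith
  have hrange : Set.range φ = C := by
    ext x
    constructor
    · rintro ⟨i, rfl⟩; exact fP i
    · intro hx
      obtain ⟨b, rfl⟩ : ∃ a, cmk u v a = x := QuotientAddGroup.mk_surjective x
      obtain ⟨i, m, hi⟩ := hrep b hx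
      refine ⟨i, ?_⟩
      show cmk u v (f i) = _
      rw [← hi, eq_comm, cmk_eq]
      exact ⟨m, rfl, rfl⟩
  let D : Finset (Fin n) := Finset.univ.filter (fun i : Fin n => ((f i).1, (f i).2 + 1) ∈ P)
  have hD : ∀ i : Fin n, i ∈ D ↔ ((f i).1, (f i).2 + 1) ∈ P := by intro i; simp [D]
  refine ⟨D, ?_, ?_⟩
  · have hcount : ∀ m : ℕ, (f m).2 = a0.2 + ((Finset.range m).filter (fun i => ((f i).1, (f i).2 + 1) ∈ P)).card := by
      intro m
      induction m with
      | zero => simp [f0]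
      | succ m ih =>
        rw [Finset.range_add_one, Finset.filter_insert]
        by_cases h : ((f m).1, (f m).2 + 1) ∈ P
        · rw [fs1 m h, if_pos h, Finset.card_insert_of_notMem (by simp)]
          push_cast; linarith
        · rw [fs2 m h, if_neg h]
          exact ih
    have h1 := hcount n
    rw [fn] at h1
    simp only [add_right_inj, Nat.cast_inj] at h1
    rw [h1, ← Finset.card_map Fin.valEmbedding]
    congr 1
    ext j
    simp only [Finset.mem_map, Finset.mem_filter, Finset.mem_range, Fin.valEmbedding_apply, hD]
    constructor
    · rintro ⟨i, hi, rfl⟩; exact ⟨i.2, hi⟩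
    · rintro ⟨h, h'⟩; exact ⟨⟨j, h⟩, h', rfl⟩
  · intro N e he
    unfold cylSchur
    rw [tab_eq C (CylOk u v C) φ hinj hrange (fun w => cAsc w = D) ?_ N e he]
    · unfold FD
      congr 2
      ext w
      simp only [Finset.mem_filter]
    · intro T
      have hasc : ∀ i, i ∈ cAsc (T ∘ φ) ↔ T (φ i) < T (φ (i + 1)) := by intro i; simp [cAsc]
      constructor
      · rintro ⟨h1, h2⟩
        ext i
        rw [hasc, hD]
        have m1 : φ i ∈ C := fP i
        have m2 : φ (i + 1) ∈ C := by rw [φs]; exact fP _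
        constructor
        · intro hlt
          by_contra h
          have := h1 _ _ m2 m1 ⟨f (i.val + 1), φs i, by
            rw [fs2 _ h]; simp [φ]⟩
          omega
        · intro h
          exact h2 _ _ m1 m2 ⟨f i, rfl, by rw [φs, fs1 _ h]⟩
      · intro h
        constructor
        · rintro x y hx hy ⟨a, rfl, rfl⟩
          obtain ⟨i, m, hi⟩ := hrep _ hy
          have ha' := trans a hx m
          have e1 := congrArg Prod.fst hi
          have e2 := congrArg Prod.snd hi
          simp only at e1 e2
          have hfi := fd i
          have hfa : (a.1 - m * u, a.2 + m * v) = f (i.val + 1) := by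
            apply funiq _ ha'
            push_cast; linarith
          have hiD : i ∉ D := by
            rw [hD]
            intro h'
            rw [fs1 _ h'] at hfa
            have e3 := congrArg Prod.fst hfa
            simp only at e3
            linarith
          rw [← h, hasc, not_lt] at hiD
          have c1 : cmk u v a = φ (i + 1) := by
            rw [φs, ← hfa, cmk_eq]; exact ⟨m, rfl, rfl⟩
          have c2 : cmk u v (a.1 + 1, a.2) = φ i := by
            show _ = cmk u v (f i)
            rw [← hi, cmk_eq]; exact ⟨m, rfl, rfl⟩
          rw [c1, c2]; exact hiD
        · rintro x y hx hy ⟨a, rfl, rfl⟩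
          obtain ⟨i, m, hi⟩ := hrep _ hx
          have ha' := trans _ hy m
          have e1 := congrArg Prod.fst hi
          have e2 := congrArg Prod.snd hi
          simp only at e1 e2
          have hfi := fd i
          have hfa : (a.1 - m * u, a.2 + 1 + m * v) = f (i.val + 1) := by
            apply funiq _ ha'
            push_cast; linarith
          have hiD : i ∈ D := by
            rw [hD]
            have : ((f i).1, (f i).2 + 1) = (a.1 - m * u, a.2 + 1 + m * v) := by
              ext
              · simp only; linarith
              · simp only; linarith
            rw [this]; exact ha'
          rw [← h, hasc] at hiD
          have c1 : cmk u v (a.1, a.2 + 1) = φ (i + 1) := by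
            rw [φs, ← hfa, cmk_eq]; exact ⟨m, rfl, rfl⟩
          have c2 : cmk u v a = φ i := by
            show _ = cmk u v (f i)
            rw [← hi, cmk_eq]; exact ⟨m, rfl, rfl⟩
          rw [c1, c2]; exact hiD

end Ribbon
end CR

namespace CR
set_option linter.unusedSectionVars false
section Assembly
variable {n : ℕ} [NeZero n]

/-- Kostka number attached to a cyclic descent class -/
def kb (l : ℕ → ℕ) (B : Finset (Fin n)) : ℕ :=
  if h : B.Nonempty then KK n n (cont (cB h.choose B)) l else 0

/-- coefficient -/
def mm (l : ℕ → ℕ) (D : Finset (Fin n)) : ℤ := ∑ Y ∈ D.powerset, (-1) ^ Y.card * (kb l (D \ Y) : ℤ)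

lemma card_le_n (B : Finset (Fin n)) : B.card ≤ n := by simpa using Finset.card_le_univ B

lemma FD_exp (N : ℕ) (D : Finset (Fin n)) (e : ℕ → ℕ) (he : ∀ v, N ≤ v → e v = 0)
    (hs : ∑ i ∈ Finset.range N, e i = n) :
    (FD N D e : ℤ) = (-1) ^ D.card * (((Wd n N e).filter (fun w => cAsc w ⊆ (∅ : Finset (Fin n)))).card : ℤ)
      + ∑ l ∈ PP n, (KK n N e l : ℤ) * mm l D := by
  have h1 : ∀ B : Finset (Fin n), (((Wd n N e).filter (fun w => cAsc w ⊆ B)).card : ℤ) =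
      (if B = ∅ then (((Wd n N e).filter (fun w => cAsc w ⊆ (∅ : Finset (Fin n)))).card : ℤ) else 0)
      + ∑ l ∈ PP n, (KK n N e l : ℤ) * kb l B := by
    intro B
    by_cases hB : B.Nonempty
    · rw [if_neg hB.ne_empty, zero_add, NB_eq hB.choose B hB.choose_spec N e he,
        ← gram n n N (cont (cB hB.choose B)) e (by omega)]
      push_cast
      apply Finset.sum_congr rfl
      intro l _
      rw [kb, dif_pos hB, mul_comm]
    · have hB' := Finset.not_nonempty_iff_eq_empty.1 hB
      subst hB'
      simp [kb]
  rw [FD_eq]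
  rw [Finset.sum_congr rfl (fun Y _ => by rw [h1 (D \ Y)])]
  simp only [mul_add, Finset.sum_add_distrib]
  congr 1
  · rw [Finset.sum_eq_single D]
    · simp
    · intro Y hY hne
      rw [if_neg, mul_zero]
      intro h
      rw [Finset.sdiff_eq_empty_iff_subset] at h
      exact hne (Finset.Subset.antisymm (Finset.mem_powerset.1 hY) h)
    · simp
  · unfold mm
    simp only [Finset.mul_sum]
    rw [Finset.sum_comm]
    apply Finset.sum_congr rfl
    intro l _
    apply Finset.sum_congr rfl
    intro Y _
    ring

lemma kb_card (l : ℕ → ℕ) (hl : l ∈ PP n) (B : Finset (Fin n)) (hB : B.Nonempty) :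
    kb l B = KK n B.card (cont (cB hB.choose B)) l := by
  rw [kb, dif_pos hB]
  exact KK_trail n B.card _ l hl n (card_le_n B)
    (fun i hi _ => cont_eq_zero _ (cB_lt _ B hB.choose_spec) hi)

lemma hook_char (l : ℕ → ℕ) (hl : l ∈ PP n) (hsz : sz n l = n) (h : ¬ ∃ a, l a = 0 ∧ a + l 0 ≤ n) :
    1 ≤ l 0 ∧ l 0 ≤ n ∧ l = hookFun (l 0) (n - l 0) := by
  push Not at h
  have hn := NeZero.pos n
  have h0 : 1 ≤ l 0 := by
    by_contra h'
    have := h 0 (by omega)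
    omega
  have h1 : l 0 ≤ n := by
    rw [← hsz]
    exact Finset.single_le_sum (f := l) (fun _ _ => Nat.zero_le _) (Finset.mem_range.2 hn)
  refine ⟨h0, h1, ?_⟩
  have hb : l (n - l 0) ≠ 0 := fun h' => by have := h _ h'; omega
  have hle : ∀ i, hookFun (l 0) (n - l 0) i ≤ l i := by
    intro i
    cases i with
    | zero => rw [hook_zero]
    | succ i =>
      rw [hook_succ]
      by_cases hi : i < n - l 0
      · rw [if_pos hi]
        have := (mem_PP.1 hl).1 (show i + 1 ≤ n - l 0 by omega)
        omega
      · rw [if_neg hi]; omega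
  have hs2 := sz_hook n (l 0) (n - l 0) (by omega)
  have heq := (Finset.sum_eq_sum_iff_of_le (s := Finset.range n) (fun i _ => hle i)).1 (by
    show sz n _ = sz n l
    rw [hs2, hsz]; omega)
  funext i
  by_cases hi : i < n
  · exact (heq i (Finset.mem_range.2 hi)).symm
  · rw [PP_zero hl (not_lt.1 hi), PP_zero (hook_PP n (l 0) (n - l 0) h0 (by omega)) (not_lt.1 hi)]

lemma mm_hook (a b : ℕ) (ha : 1 ≤ a) (hab : a + b = n) (D D' : Finset (Fin n)) (h : D.card = D'.card) :
    mm (hookFun a b) D = mm (hookFun a b) D' := by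
  have hk : ∀ B : Finset (Fin n), kb (hookFun a b) B = if B.card = 0 then 0 else (B.card - 1).choose b := by
    intro B
    by_cases hB : B.Nonempty
    · have hc := Finset.card_pos.2 hB
      rw [if_neg (by omega), kb_card _ (hook_PP n a b ha (by omega)) B hB]
      obtain ⟨q, hq⟩ : ∃ q, B.card = q + 1 := ⟨B.card - 1, by omega⟩
      rw [hq]
      apply KK_hook n q _ a b ha
      · intro v hv; exact cont_cB_pos _ B hB.choose_spec v (by omega)
      · rw [← hq, sum_cont _ (cB_lt _ B hB.choose_spec), hab]
      · omega
    · have hB' := Finset.not_nonempty_iff_eq_empty.1 hB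
      subst hB'
      simp [kb]
  have key : ∀ D : Finset (Fin n), mm (hookFun a b) D = ∑ m ∈ Finset.range (D.card + 1), D.card.choose m •
      ((-1 : ℤ) ^ m * ((if D.card - m = 0 then 0 else (D.card - m - 1).choose b : ℕ) : ℤ)) := by
    intro D
    rw [← Finset.sum_powerset_apply_card]
    unfold mm
    apply Finset.sum_congr rfl
    intro Y hY
    rw [hk, Finset.card_sdiff_of_subset (Finset.mem_powerset.1 hY)]
  rw [key, key, h]

lemma mm_nonhook (l : ℕ → ℕ) (hl : l ∈ PP n) (hsz : sz n l = n) (h : ∃ a, l a = 0 ∧ a + l 0 ≤ n)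
    (D : Finset (Fin n)) (hD : D.card < n) : 0 ≤ mm l D ∧ mm l (Iv n D.card) = 0 := by
  obtain ⟨a, ha, hab⟩ := h
  obtain ⟨V, i1, i2, i3, H, hd, h1, h2, h3⟩ := rep_main l hl hsz a ha hab
  have key : ∀ E : Finset (Fin n), mm l E = ee H E E := by
    intro E
    unfold mm ee
    apply Finset.sum_congr rfl
    intro Y _
    congr 2
    by_cases hB : (E \ Y).Nonempty
    · rw [kb, dif_pos hB, h3 _ _ hB.choose_spec]
    · rw [kb, dif_neg hB]
      have hB' := Finset.not_nonempty_iff_eq_empty.1 hB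
      rw [hB']
      have : VB H (∅ : Finset (Fin n)) = ⊥ := by
        rw [eq_bot_iff, ← h2]
        exact VB_mono _ (Finset.empty_subset _)
      rw [this]
      simp
  rw [key, key]
  exact ⟨LA_nonneg hd a (l 0) hab h1 h2 D hD, (interval_zero hd a (l 0) hab h1 h2 D.card hD).1⟩

lemma mm_rows (l : ℕ → ℕ) (hl : l ∈ PP n) (D : Finset (Fin n)) (h : l D.card ≠ 0) : mm l D = 0 := by
  apply Finset.sum_eq_zero
  intro Y _
  have : kb l (D \ Y) = 0 := by
    by_cases hB : (D \ Y).Nonempty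
    · rw [kb_card l hl _ hB]
      by_contra h'
      exact h (KK_rows n _ _ l h' _ (Finset.card_le_card Finset.sdiff_subset))
    · rw [kb, dif_neg hB]
  rw [this]; simp

lemma FD_zero (N : ℕ) (D : Finset (Fin n)) (e : ℕ → ℕ) (h : n - D.card < e 0) : FD N D e = 0 := by
  unfold FD
  rw [Finset.card_eq_zero, Finset.filter_eq_empty_iff]
  intro w hw hD
  rw [mem_Wd] at hw
  have h1 : cont w 0 = e 0 := by rw [hw.2]
  have h2 : cont w 0 ≤ (Finset.univ \ D).card := by
    apply Finset.card_le_card_of_injOn (fun p => p - 1)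
    · intro p hp
      simp only [Finset.coe_filter, Finset.mem_univ, true_and] at hp
      have hp : w p = 0 := hp
      simp only [Finset.coe_sdiff, Finset.coe_univ, Set.mem_sdiff, Set.mem_univ, true_and, Finset.mem_coe]
      rw [← hD]
      simp [cAsc, hp]
    · intro p _ q _ h'
      exact sub_left_injective h'
  rw [Finset.card_sdiff_of_subset (Finset.subset_univ _), Finset.card_univ, Fintype.card_fin] at h2
  omega

lemma diff_exp (N : ℕ) (D : Finset (Fin n)) (e : ℕ → ℕ) (he : ∀ v, N ≤ v → e v = 0)
    (hs : ∑ i ∈ Finset.range N, e i = n) :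
    (FD N D e : ℤ) - FD N (Iv n D.card) e = ∑ l ∈ PP n, (KK n N e l : ℤ) * (mm l D - mm l (Iv n D.card)) := by
  rw [FD_exp N D e he hs, FD_exp N (Iv n D.card) e he hs, card_Iv (card_le_n D)]
  simp only [mul_sub, Finset.sum_sub_distrib]
  ring

lemma mm_diff_nonneg (l : ℕ → ℕ) (hl : l ∈ PP n) (hsz : sz n l = n) (D : Finset (Fin n)) (hD : D.card < n) :
    0 ≤ mm l D - mm l (Iv n D.card) := by
  by_cases h : ∃ a, l a = 0 ∧ a + l 0 ≤ n
  · have := mm_nonhook l hl hsz h D hD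
    rw [this.2]; simpa using this.1
  · obtain ⟨h0, h1, h2⟩ := hook_char l hl hsz h
    rw [h2, mm_hook (l 0) (n - l 0) h0 (by omega) D (Iv n D.card) (by rw [card_Iv (card_le_n D)])]
    simp

lemma mm_cols (l : ℕ → ℕ) (hl : l ∈ PP n) (hsz : sz n l = n) (D : Finset (Fin n)) (hD : D.card < n)
    (h : n - D.card < l 0) : mm l D - mm l (Iv n D.card) = 0 := by
  have h1 := diff_exp n D l (fun v hv => PP_zero hl hv) hsz
  rw [FD_zero n D l h, FD_zero n (Iv n D.card) l (by rw [card_Iv (card_le_n D)]; exact h)] at h1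
  have h2 : ∀ p ∈ PP n, 0 ≤ (KK n n l p : ℤ) * (mm p D - mm p (Iv n D.card)) := by
    intro p hp
    by_cases h0 : KK n n l p = 0
    · rw [h0]; simp
    · have := KK_sz n n l p h0
      exact mul_nonneg (by positivity) (mm_diff_nonneg p hp (this.trans hsz) D hD)
  have h3 := (Finset.sum_eq_zero_iff_of_nonneg h2).1 (by rw [← h1]; simp) l hl
  rw [KK_diag n l hl] at h3
  simpa using h3

theorem final_coeff (D : Finset (Fin n)) (hD : D.card < n) (N : ℕ) (e : ℕ →₀ ℕ) (he : ∀ v, N ≤ v → e v = 0) :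
    (FD N D e : ℚ) = (∑ p ∈ (PP n).filter (fun p => sz n p = n ∧ (∃ a, p a = 0 ∧ a + p 0 ≤ n) ∧
        FitsBox p D.card (n - D.card)), (((mm p D).toNat : ℕ) : ℚ) * schur p e) + FD N (Iv n D.card) e := by
  have e1 : ∑ p ∈ (PP n).filter (fun p => sz n p = n ∧ (∃ a, p a = 0 ∧ a + p 0 ≤ n) ∧
        FitsBox p D.card (n - D.card)), (((mm p D).toNat : ℕ) : ℚ) * schur p e =
      ((∑ p ∈ (PP n).filter (fun p => sz n p = n ∧ (∃ a, p a = 0 ∧ a + p 0 ≤ n) ∧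
        FitsBox p D.card (n - D.card)), (KK n N e p : ℤ) * (mm p D - mm p (Iv n D.card)) : ℤ) : ℚ) := by
    push_cast
    apply Finset.sum_congr rfl
    intro p hp
    rw [Finset.mem_filter] at hp
    obtain ⟨hp, hsz, hnh, _⟩ := hp
    have h := mm_nonhook p hp hsz hnh D hD
    rw [schur_coeff n N p hp e he, h.2]
    have h' : (((mm p D).toNat : ℕ) : ℚ) = (mm p D : ℚ) := by
      have : (((mm p D).toNat : ℕ) : ℤ) = mm p D := Int.toNat_of_nonneg h.1
      exact_mod_cast this
    rw [h']
    push_cast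
    ring
  rw [e1]
  have e2 : ∑ p ∈ (PP n).filter (fun p => sz n p = n ∧ (∃ a, p a = 0 ∧ a + p 0 ≤ n) ∧
        FitsBox p D.card (n - D.card)), (KK n N e p : ℤ) * (mm p D - mm p (Iv n D.card)) =
      (FD N D e : ℤ) - FD N (Iv n D.card) e := by
    by_cases hs : ∑ i ∈ Finset.range N, e i = n
    · rw [diff_exp N D e he hs]
      apply Finset.sum_subset (Finset.filter_subset _ _)
      intro p hp hp'
      by_cases h0 : KK n N e p = 0
      · rw [h0]; simp
      have hsz : sz n p = n := (KK_sz n N e p h0).trans hs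
      by_cases hnh : ∃ a, p a = 0 ∧ a + p 0 ≤ n
      · have hbox : ¬ FitsBox p D.card (n - D.card) := fun hb => hp' (Finset.mem_filter.2 ⟨hp, hsz, hnh, hb⟩)
        by_cases hrow : p D.card = 0
        · have : n - D.card < p 0 := by
            by_contra h'
            exact hbox ⟨not_lt.1 h', hrow⟩
          rw [mm_cols p hp hsz D hD this, mul_zero]
        · rw [mm_rows p hp D hrow, (mm_nonhook p hp hsz hnh D hD).2]; simp
      · obtain ⟨h0, h1, h2⟩ := hook_char p hp hsz hnh
        rw [h2, mm_hook (p 0) (n - p 0) h0 (by omega) D (Iv n D.card) (by rw [card_Iv (card_le_n D)])]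
        simp
    · have hz : ∀ E : Finset (Fin n), FD N E e = 0 := by
        intro E
        unfold FD
        rw [Finset.card_eq_zero, Finset.filter_eq_empty_iff]
        intro w hw _
        rw [mem_Wd] at hw
        apply hs
        rw [← hw.2, sum_cont w hw.1]
      rw [hz, hz]
      simp only [Nat.cast_zero, sub_zero]
      apply Finset.sum_eq_zero
      intro p hp
      rw [Finset.mem_filter] at hp
      have : KK n N e p = 0 := by
        by_contra h0
        exact hs ((KK_sz n N e p h0).symm.trans hp.2.1)
      rw [this]; simp
  rw [e2]
  push_cast
  ring

end Assembly
end CR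

/-- For a cylindric ribbon `C ⊆ C_{k,n-k}`, `s_C(x) = ∑_{ν ⊆ k×(n-k)} c_ν s_ν(x) + s_{H^{n-k}_k}(x)`
with non-negative integers `c_ν`; the cylindric hook part accounts exactly for the terms with
more than `k` rows. -/
theorem stmt6 (n k : ℕ) (hk : 0 < k) (hkn : k < n) (C : Set (Cyl (n - k) k))
    (hC : IsCylRibbon (n - k) k C) :
    ∃ (S : Finset (ℕ → ℕ)) (c : (ℕ → ℕ) → ℕ),
      (∀ p ∈ S, IsPtn p ∧ FitsBox p k (n - k)) ∧
      cylSchur (n - k) k C =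
        (∑ p ∈ S, (c p : ℚ) • schur p) +
        ∑ j ∈ Finset.range (n - k), ((-1 : ℚ) ^ j) • schur (hookFun (n - k - j) (k + j)) := by
  haveI : NeZero n := ⟨by omega⟩
  obtain ⟨D, hD, hF⟩ := CR.ribbon_main (n := n) (n - k) k (by omega) hk (by omega) C hC
  refine ⟨(CR.PP n).filter (fun p => CR.sz n p = n ∧ (∃ a, p a = 0 ∧ a + p 0 ≤ n) ∧
    FitsBox p k (n - k)), fun p => (CR.mm p D).toNat, ?_, ?_⟩
  · intro p hp
    rw [Finset.mem_filter] at hp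
    exact ⟨⟨(CR.mem_PP.1 hp.1).1, n, CR.PP_zero hp.1 le_rfl⟩, hp.2.2.2⟩
  · funext e
    obtain ⟨N, hN⟩ : ∃ N, ∀ v, N ≤ v → e v = 0 := by
      refine ⟨e.support.sup id + 1, fun v hv => ?_⟩
      by_contra h
      have h1 : v ≤ e.support.sup id := Finset.le_sup (f := id) (Finsupp.mem_support_iff.2 h)
      omega
    have key : ∀ (I : Type) (s : Finset I) (c : I → ℚ) (g : I → FPS),
        (∑ i ∈ s, c i • g i : FPS) e = ∑ i ∈ s, c i * g i e := by
      intro I s c g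
      have h1 : (∑ i ∈ s, c i • g i : FPS) e = MvPowerSeries.coeff e (∑ i ∈ s, c i • g i : FPS) := rfl
      rw [h1, map_sum]
      apply Finset.sum_congr rfl
      intro i _
      rw [map_smul]
      rfl
    have hadd : ∀ a b : FPS, (a + b) e = a e + b e := fun _ _ => rfl
    rw [hadd, key _ _ (fun p => (((CR.mm p D).toNat : ℕ) : ℚ)) schur,
      key _ _ (fun j => (-1 : ℚ) ^ j) (fun j => schur (hookFun (n - k - j) (k + j))),
      CR.hook_sum (n := n) (n - k) k (by omega) N e hN, hF N e hN,
      CR.final_coeff D (by omega) N e hN, hD]
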